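/- arXiv:1610.06586 — 4 statements merged into one kernel-verified Lean document; each statement's English description precedes it below -/
import Mathlib

section
/- Let K be a field with algebraic closure K̄, and let X be a separated scheme of finite type over K whose underlying topological space is irreducible and has Krull dimension at least 1. Let x̄_1, …, x̄_n : Spec K̄ → X be K̄-points of X over K, write X_K̄ = X ×_{Spec K} Spec K̄ and p : |X_K̄| → |X| for the projection, and let x̄_i' : Spec K̄ → X_K̄ denote the canonical lift of x̄_i (induced by x̄_i and the identity of Spec K̄). Assume that the images of x̄_1', …, x̄_n' all lie in one single irreducible component of |X_K̄|. Then there exists a closed irreducible subset C of |X| of Krull dimension 1 containing the images of all x̄_i, such that the images of x̄_1', …, x̄_n' all lie in a single irreducible component of p⁻¹(C). -/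
open AlgebraicGeometry CategoryTheory CategoryTheory.Limits

universe u

/-- `s` is an irreducible component of the subset `A` of a topological space,
i.e. a maximal irreducible subset of `A`. -/
def IsIrreducibleComponentIn {α : Type*} [TopologicalSpace α] (A s : Set α) : Prop :=
  s ⊆ A ∧ IsIrreducible s ∧ ∀ t : Set α, t ⊆ A → IsIrreducible t → s ⊆ t → t = s


/-- Specialization of linear independence. -/
lemma specialize_li {S : Type*} [CommRing S] [IsDomain S] {ι : Type*} [Fintype ι]
    (v : ι → ℕ → S) (hv : LinearIndependent S v) :
    ∃ Δ : S, Δ ≠ 0 ∧ ∀ {k : Type u} [Field k] (ev : S →+* k), ev Δ ≠ 0 →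
      LinearIndependent k (fun i m => ev (v i m)) := by
  classical
  let K := FractionRing S
  let ρ : ℕ → (ι → K) := fun m i => algebraMap S K (v i m)
  have hvK : LinearIndependent K (fun i m => algebraMap S K (v i m)) := by
    rw [← LinearIndependent.iff_fractionRing S K]
    have := hv.map' ((Algebra.linearMap S K).compLeft ℕ) (by
      rw [LinearMap.ker_eq_bot]
      intro a b hab
      funext m
      exact IsFractionRing.injective S K (congrFun hab m))
    exact this
  have hspan : Submodule.span K (Set.range ρ) = ⊤ := by
    by_contra hne
    obtain ⟨f, hf0, hf⟩ := Submodule.exists_le_ker_of_lt_top _ (lt_top_iff_ne_top.mpr hne)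
    apply hf0
    have key := Fintype.linearIndependent_iff.mp hvK (fun i => f (Pi.single i 1)) (by
      funext m
      have h1 : f (ρ m) = 0 := hf (Submodule.subset_span ⟨m, rfl⟩)
      rw [LinearMap.pi_apply_eq_sum_univ] at h1
      rw [Finset.sum_apply]
      simp only [Pi.smul_apply, smul_eq_mul, Pi.zero_apply]
      rw [← h1]
      refine Finset.sum_congr rfl fun i _ => ?_
      rw [smul_eq_mul, mul_comm]
      congr 2
      funext j
      simp [Pi.single_apply, eq_comm])
    refine LinearMap.pi_ext' fun i => ?_
    ext
    simpa using key i
  obtain ⟨b, hb, hbs, hbl⟩ := exists_linearIndependent K (Set.range ρ)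
  let B : Module.Basis b K (ι → K) := Module.Basis.mk hbl (by
    rw [Subtype.range_coe, hbs, hspan])
  let e : ι ≃ b := (Pi.basisFun K ι).indexEquiv B
  choose m hm using fun i => hb (e i).2
  let M : Matrix ι ι S := Matrix.of fun i j => v j (m i)
  refine ⟨M.det, ?_, ?_⟩
  · intro h0
    have hu : IsUnit (M.map (algebraMap S K)) := by
      rw [← Matrix.linearIndependent_rows_iff_isUnit]
      have : (M.map (algebraMap S K)).row = fun i => ((e i : b) : ι → K) := by
        funext i j
        rw [← hm i]
        rfl
      rw [this]
      exact hbl.comp e e.injective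
    rw [Matrix.isUnit_iff_isUnit_det] at hu
    have : (M.map (algebraMap S K)).det = algebraMap S K M.det := by
      rw [RingHom.map_det]; rfl
    rw [this, h0, map_zero] at hu
    exact not_isUnit_zero hu
  · intro k _ ev hev
    rw [Fintype.linearIndependent_iff]
    intro c hc
    have hdet : (M.map ev).det ≠ 0 := by
      have : (M.map ev).det = ev M.det := by rw [RingHom.map_det]; rfl
      rwa [this]
    have := Matrix.eq_zero_of_mulVec_eq_zero hdet (v := c) (by
      funext i
      have := congrFun hc (m i)
      rw [Finset.sum_apply] at this
      simp only [Pi.smul_apply, smul_eq_mul, Pi.zero_apply] at this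
      simp only [Matrix.mulVec, dotProduct, Matrix.map_apply, M, Matrix.of_apply, Pi.zero_apply]
      rw [← this]
      exact Finset.sum_congr rfl fun j _ => mul_comm _ _)
    exact fun i => congrFun this i

open Polynomial in
/-- Degree bounds on factors of bivariate polynomials. -/
lemma coeff_natDegree_le_of_mul {k : Type*} [Field k] (G H : k[X][X]) (D : ℕ) (hH : H ≠ 0)
    (hG : G ≠ 0)
    (h : ∀ j, ((G * H).coeff j).natDegree ≤ D) (j : ℕ) : (G.coeff j).natDegree ≤ D := by
  have hcs : ∀ (p : k[X][X]) (a b : ℕ),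
      ((Bivariate.swap p).coeff a).coeff b = (p.coeff b).coeff a := by
    intro p a b
    induction p using Polynomial.induction_on' with
    | add p q hp hq => simp [hp, hq]
    | monomial n f =>
      induction f using Polynomial.induction_on' with
      | add p q hp hq => simp only [map_add, coeff_add, hp, hq]
      | monomial m r =>
        rw [Bivariate.swap_monomial_monomial]
        simp only [coeff_monomial]
        split_ifs <;> simp_all [coeff_monomial]
  have hiff : ∀ (p : k[X][X]) (E : ℕ), (Bivariate.swap p).natDegree ≤ E ↔
      ∀ j, (p.coeff j).natDegree ≤ E := by
    intro p E
    simp only [natDegree_le_iff_coeff_eq_zero]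
    constructor
    · intro h j N hN
      rw [← hcs, h N hN, coeff_zero]
    · intro h N hN
      ext b
      rw [hcs, h b N hN, coeff_zero]
  rw [← hiff] at h
  have h2 : (Bivariate.swap G).natDegree ≤ D := by
    rw [map_mul, natDegree_mul] at h
    · omega
    · simpa using hG
    · simpa using hH
  exact (hiff G D).mp h2 j

open Polynomial in
/-- Bertini–Noether type specialization of irreducibility, in the presence of a simple root. -/
lemma specialize_irreducible {S : Type*} [CommRing S] [IsDomain S] [IsIntegrallyClosed S[X]]
    (Ψ : S[X][X]) (hm : Ψ.Monic) (hirr : Irreducible Ψ) (α₀ : S)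
    (hroot : (Ψ.map (evalRingHom (0 : S))).eval α₀ = 0)
    (hsimple : IsUnit ((Ψ.map (evalRingHom (0 : S))).derivative.eval α₀)) :
    ∃ Δ : S, Δ ≠ 0 ∧ ∀ {k : Type u} [Field k] (ev : S →+* k), ev Δ ≠ 0 →
      Irreducible (Ψ.map (mapRingHom ev)) := by
  classical
  -- the power series root
  let ι : S[X] →+* PowerSeries S := algebraMap S[X] (PowerSeries S)
  have hι : ∀ p, ι p = (p : PowerSeries S) := fun p => by
    simp [ι, PowerSeries.algebraMap_apply']
  have hcomp : (PowerSeries.constantCoeff (R := S)).comp ι = evalRingHom (0 : S) := by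
    ext
    · simp [hι]
    · simp [hι]
  have hinj : Function.Injective ι := by
    intro a b hab
    rw [hι, hι] at hab
    exact Polynomial.coe_injective S hab
  have : FaithfulSMul S[X] (PowerSeries S) := (faithfulSMul_iff_algebraMap_injective _ _).mpr hinj
  have : Module.IsTorsionFree S[X] (PowerSeries S) := inferInstance
  obtain ⟨α, hα, -⟩ := HenselianRing.is_henselian (I := Ideal.span {(PowerSeries.X : PowerSeries S)})
    (Ψ.map ι) (hm.map ι) (PowerSeries.C α₀) (by
      rw [Ideal.mem_span_singleton, PowerSeries.X_dvd_iff, ← Polynomial.eval_map_apply,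
        Polynomial.map_map, hcomp]
      simpa using hroot) (by
      have hu : IsUnit ((Ψ.map ι).derivative.eval (PowerSeries.C α₀)) := by
        rw [PowerSeries.isUnit_iff_constantCoeff, ← Polynomial.eval_map_apply,
          ← Polynomial.derivative_map, Polynomial.map_map, hcomp]
        simpa using hsimple
      exact hu.map _)
  have hα' : aeval α Ψ = 0 := by
    rw [IsRoot, Polynomial.eval_map] at hα
    exact hα
  have hIntegral : IsIntegral S[X] α := ⟨Ψ, hm, hα'⟩
  have hmin : minpoly S[X] α = Ψ := by
    have hd := minpoly.isIntegrallyClosed_dvd hIntegral hα'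
    have := (minpoly.irreducible hIntegral).dvd_irreducible_iff_associated hirr |>.mp hd
    exact eq_of_monic_of_associated (minpoly.monic hIntegral) hm this
  set e := Ψ.natDegree with he
  let D : ℕ := (Finset.range (e + 1)).sup fun j => (Ψ.coeff j).natDegree
  have hD : ∀ j, (Ψ.coeff j).natDegree ≤ D := by
    intro j
    by_cases hj : j ≤ e
    · exact Finset.le_sup (f := fun j => (Ψ.coeff j).natDegree) (by simpa using Nat.lt_succ_of_le hj)
    · rw [coeff_eq_zero_of_natDegree_lt (by omega)]; simp
  let v : Fin (D + 1) × Fin e → ℕ → S := fun ij m =>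
    PowerSeries.coeff m ((PowerSeries.X : PowerSeries S) ^ (ij.1 : ℕ) * α ^ (ij.2 : ℕ))
  have hv : LinearIndependent S v := by
    rw [Fintype.linearIndependent_iff]
    intro c hc
    let q : S[X][X] := ∑ ij : Fin (D + 1) × Fin e, monomial (ij.2 : ℕ) (monomial (ij.1 : ℕ) (c ij))
    have hq0 : aeval α q = 0 := by
      ext m
      have := congrFun hc m
      simp only [Finset.sum_apply, Pi.smul_apply, smul_eq_mul, Pi.zero_apply, v] at this
      simp only [q, map_sum, map_zero]
      rw [← this]
      refine Finset.sum_congr rfl fun ij _ => ?_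
      rw [aeval_monomial]
      change PowerSeries.coeff m (ι _ * _) = _
      rw [hι, ← C_mul_X_pow_eq_monomial, Polynomial.coe_mul, Polynomial.coe_C, Polynomial.coe_pow,
        Polynomial.coe_X, mul_assoc, PowerSeries.coeff_C_mul]
    have hqd : q.degree < Ψ.degree := by
      rw [degree_eq_natDegree hm.ne_zero]
      refine lt_of_le_of_lt (degree_sum_le _ _) ?_
      rw [Finset.sup_lt_iff (by simp [bot_lt_iff_ne_bot])]
      intro ij _
      refine lt_of_le_of_lt (degree_monomial_le _ _) ?_
      exact_mod_cast ij.2.2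
    have hq : q = 0 := by
      by_contra hne
      have := minpoly.IsIntegrallyClosed.degree_le_of_ne_zero hne hq0
      rw [hmin] at this
      exact absurd hqd (not_lt.mpr this)
    intro ij
    have : (q.coeff (ij.2 : ℕ)).coeff (ij.1 : ℕ) = c ij := by
      simp only [q, finsetSum_coeff, coeff_monomial]
      rw [Finset.sum_eq_single ij]
      · simp
      · rintro ⟨a, b⟩ - hne
        by_cases h : (b : ℕ) = ij.2
        · rw [if_pos h, coeff_monomial, if_neg]
          intro h2
          exact hne (Prod.ext (Fin.ext h2) (Fin.ext h))
        · rw [if_neg h, coeff_zero]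
      · simp
    rw [← this, hq]; simp
  obtain ⟨Δ, hΔ, H⟩ := specialize_li.{u} v hv
  refine ⟨Δ, hΔ, ?_⟩
  intro k _ ev hev
  have hli := H ev hev
  have hmk : (Ψ.map (mapRingHom ev)).Monic := hm.map _
  rw [hmk.irreducible_iff_natDegree]
  have hdeg : (Ψ.map (mapRingHom ev)).natDegree = e := hm.natDegree_map _
  have he0 : e ≠ 0 := by
    intro h0
    have := hm.natDegree_eq_zero.mp h0
    rw [this] at hirr
    exact not_irreducible_one hirr
  refine ⟨?_, ?_⟩
  · intro h1
    rw [h1, natDegree_one] at hdeg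
    exact he0 hdeg.symm
  -- the specialized root
  let φ : PowerSeries S →+* PowerSeries k := PowerSeries.map ev
  let κ : k[X] →+* PowerSeries k := algebraMap k[X] (PowerSeries k)
  have hκ : ∀ p, κ p = (p : PowerSeries k) := fun p => by
    simp [κ, PowerSeries.algebraMap_apply']
  have hφ : φ.comp ι = κ.comp (mapRingHom ev) := by
    ext
    · simp [hι, hκ, φ]
    · simp [hι, hκ, φ]
  have hβ : (Ψ.map (mapRingHom ev)).eval₂ κ (φ α) = 0 := by
    rw [eval₂_map, ← hφ, ← hom_eval₂]
    rw [show eval₂ ι α Ψ = 0 from hα', map_zero]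
  have main : ∀ G H : k[X][X], G.Monic → H.Monic → G * H = Ψ.map (mapRingHom ev) →
      G.natDegree < e → G.eval₂ κ (φ α) ≠ 0 := by
    intro G H hG hH hGH hGe h0
    have hGD : ∀ j, (G.coeff j).natDegree ≤ D := by
      refine coeff_natDegree_le_of_mul G H D hH.ne_zero hG.ne_zero ?_
      intro j
      rw [hGH, coeff_map, coe_mapRingHom]
      exact natDegree_map_le.trans (hD j)
    have := Fintype.linearIndependent_iff.mp hli (fun ij => (G.coeff ij.2).coeff ij.1) (by
      funext m
      rw [eval₂_eq_sum_range' κ hGe] at h0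
      have h1 := congrArg (PowerSeries.coeff m) h0
      rw [Finset.sum_apply]
      simp only [Pi.smul_apply, smul_eq_mul, Pi.zero_apply]
      rw [map_zero] at h1
      rw [← h1, map_sum, Fintype.sum_prod_type_right, Finset.sum_range]
      refine Finset.sum_congr rfl fun j _ => ?_
      have h2 : κ (G.coeff j) = ∑ i : Fin (D + 1),
          PowerSeries.C ((G.coeff j).coeff i) * PowerSeries.X ^ (i : ℕ) := by
        rw [hκ]
        conv_lhs => rw [(G.coeff j).as_sum_range' (D + 1) (Nat.lt_succ_of_le (hGD j))]
        rw [Finset.sum_range]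
        rw [← Polynomial.coeToPowerSeries.ringHom_apply, map_sum]
        refine Finset.sum_congr rfl fun i _ => ?_
        rw [Polynomial.coeToPowerSeries.ringHom_apply, ← C_mul_X_pow_eq_monomial,
          Polynomial.coe_mul, Polynomial.coe_C, Polynomial.coe_pow, Polynomial.coe_X]
      rw [h2, Finset.sum_mul, map_sum]
      refine Finset.sum_congr rfl fun i _ => ?_
      rw [mul_assoc, PowerSeries.coeff_C_mul]
      congr 1
      simp only [v]
      rw [← PowerSeries.coeff_map, map_mul, map_pow, map_pow, PowerSeries.map_X])
    have hlead := this (⟨0, by omega⟩, ⟨G.natDegree, hGe⟩)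
    have hl : G.coeff G.natDegree = 1 := hG
    simp [hl] at hlead
  intro G H hG hH hGH
  by_contra hcon
  push Not at hcon
  have hsum : G.natDegree + H.natDegree = e := by
    rw [← hG.natDegree_mul hH, hGH, hdeg]
  have h1 := main G H hG hH hGH (by omega)
  have h2 := main H G hH hG (by rw [mul_comm, hGH]) (by omega)
  rw [← hGH, eval₂_mul] at hβ
  exact (mul_ne_zero h1 h2) hβ

open Polynomial in
/-- A parametrized rational curve through given points over which a given monic irreducible
polynomial stays irreducible. -/
lemma exists_good_curve {k : Type u} [Field k] [Infinite k] (d n : ℕ)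
    (Φ : (MvPolynomial (Fin d) k)[X]) (hm : Φ.Monic) (hirr : Irreducible Φ)
    (a : Fin d → k) (α₀ : k)
    (hroot : (Φ.map (MvPolynomial.eval a)).eval α₀ = 0)
    (hsimple : (Φ.map (MvPolynomial.eval a)).derivative.eval α₀ ≠ 0)
    (h : MvPolynomial (Fin d) k) (hh : h ≠ 0) (b : Fin n → Fin d → k) :
    ∃ θ : MvPolynomial (Fin d) k →ₐ[k] k[X],
      (∀ i, ∃ τ : k, ∀ z, (θ z).eval τ = MvPolynomial.eval (b i) z) ∧ θ h ≠ 0 ∧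
      Irreducible (Φ.map (θ : MvPolynomial (Fin d) k →+* k[X])) := by
  classical
  let σ := Infinite.natEmbedding k
  let τ : Fin (n + 1) → k := fun i => σ i - σ 0
  have hτ : Function.Injective τ := by
    intro i j hij
    exact Fin.ext (σ.injective (sub_left_injective hij))
  let pt : Fin (n + 1) → Fin d → k := Fin.cons a b
  let q : Fin d → k[X] := fun j => Lagrange.interpolate Finset.univ τ (fun i => pt i j)
  have hq : ∀ i j, (q j).eval (τ i) = pt i j := fun i j =>
    Lagrange.eval_interpolate_at_node (fun i => pt i j) hτ.injOn (Finset.mem_univ i)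
  let r : k[X] := ∏ i, (X - C (τ i))
  have hr : ∀ i, r.eval (τ i) = 0 := fun i => by
    simp only [r, eval_prod]
    exact Finset.prod_eq_zero (Finset.mem_univ i) (by simp)
  have hr0 : r ≠ 0 := Finset.prod_ne_zero_iff.mpr fun i _ => X_sub_C_ne_zero _
  obtain ⟨t, ht⟩ : ∃ t, r.eval t ≠ 0 := by
    by_contra hcon
    push Not at hcon
    exact hr0 (Polynomial.funext fun x => by simpa using hcon x)
  let Θ : MvPolynomial (Fin d) k →ₐ[k] (MvPolynomial (Fin d) k)[X] := MvPolynomial.aeval fun j =>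
    (q j).map MvPolynomial.C + C (MvPolynomial.X j) * r.map MvPolynomial.C
  let ρ₀ : MvPolynomial (Fin d) k →ₐ[k] MvPolynomial (Fin d) k := MvPolynomial.aeval fun j =>
    MvPolynomial.C (r.eval t)⁻¹ * (MvPolynomial.X j - MvPolynomial.C ((q j).eval t))
  let ρ : (MvPolynomial (Fin d) k)[X] →+* MvPolynomial (Fin d) k := eval₂RingHom (ρ₀ : MvPolynomial (Fin d) k →+* MvPolynomial (Fin d) k) (MvPolynomial.C t)
  have hρC : (ρ₀ : MvPolynomial (Fin d) k →+* MvPolynomial (Fin d) k).comp MvPolynomial.C = MvPolynomial.C := by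
    ext x
    simp [ρ₀]
  have hρΘ : ρ.comp (Θ : MvPolynomial (Fin d) k →+* (MvPolynomial (Fin d) k)[X]) = RingHom.id (MvPolynomial (Fin d) k) := by
    apply MvPolynomial.ringHom_ext
    · intro x
      simp [Θ, ρ, ρ₀, MvPolynomial.algebraMap_eq, Polynomial.algebraMap_apply]
    · intro j
      have e1 : ∀ p : k[X], eval₂ (ρ₀ : MvPolynomial (Fin d) k →+* MvPolynomial (Fin d) k) (MvPolynomial.C t)
          (p.map MvPolynomial.C) = MvPolynomial.C (p.eval t) := by
        intro p
        rw [eval₂_map, hρC, Polynomial.eval₂_at_apply]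
      simp only [RingHom.comp_apply, RingHom.coe_coe, Θ, MvPolynomial.aeval_X, ρ,
        coe_eval₂RingHom, eval₂_add, eval₂_mul, e1, eval₂_C, RingHom.id_apply]
      simp only [ρ₀, MvPolynomial.aeval_X]
      rw [mul_assoc, mul_comm, mul_assoc, ← mul_assoc]
      have : (MvPolynomial.C (eval t r) * MvPolynomial.C (eval t r)⁻¹ : MvPolynomial (Fin d) k) = 1 := by
        rw [← map_mul, mul_inv_cancel₀ ht, map_one]
      linear_combination (MvPolynomial.X j - MvPolynomial.C (eval t (q j))) * this
  have hΘ0 : (evalRingHom (0 : MvPolynomial (Fin d) k)).comp (Θ : MvPolynomial (Fin d) k →+* (MvPolynomial (Fin d) k)[X]) =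
      (MvPolynomial.C).comp (MvPolynomial.eval a) := by
    have hτ0 : τ 0 = 0 := by simp [τ]
    have e1 : ∀ p : k[X], (p.map (MvPolynomial.C : k →+* MvPolynomial (Fin d) k)).eval 0 =
        MvPolynomial.C (p.eval 0) := by
      intro p
      rw [← map_zero (MvPolynomial.C : k →+* MvPolynomial (Fin d) k), eval_map_apply]
    apply MvPolynomial.ringHom_ext
    · intro x
      simp [Θ, MvPolynomial.algebraMap_eq, Polynomial.algebraMap_apply]
    · intro j
      have h1 := hq 0 j
      have h2 := hr 0
      rw [hτ0] at h1 h2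
      simp [Θ, e1, h1, h2, pt]
  let Ψ : (MvPolynomial (Fin d) k)[X][X] := Φ.map (Θ : MvPolynomial (Fin d) k →+* (MvPolynomial (Fin d) k)[X])
  have hΨm : Ψ.Monic := hm.map _
  have hΨρ : Ψ.map ρ = Φ := by
    simp only [Ψ]
    rw [Polynomial.map_map, hρΘ, Polynomial.map_id]
  have hΨi : Irreducible Ψ := by
    rw [hΨm.irreducible_iff_natDegree]
    rw [hm.irreducible_iff_natDegree] at hirr
    refine ⟨?_, ?_⟩
    · intro h1
      rw [h1, Polynomial.map_one] at hΨρ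
      exact hirr.1 hΨρ.symm
    · intro f g hf hg hfg
      have := hirr.2 (f.map ρ) (g.map ρ) (hf.map _) (hg.map _)
        (by rw [← Polynomial.map_mul, hfg, hΨρ])
      rwa [hf.natDegree_map, hg.natDegree_map] at this
  have hΨ0 : Ψ.map (evalRingHom (0 : MvPolynomial (Fin d) k)) = (Φ.map (MvPolynomial.eval a)).map MvPolynomial.C := by
    simp only [Ψ]
    rw [Polynomial.map_map, hΘ0, Polynomial.map_map]
  obtain ⟨Δ, hΔ, H⟩ := specialize_irreducible.{u} Ψ hΨm hΨi (MvPolynomial.C α₀) (by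
      rw [hΨ0, eval_map_apply, hroot, map_zero]) (by
      rw [hΨ0, derivative_map, eval_map_apply]
      exact (isUnit_iff_ne_zero.mpr hsimple).map _)
  have hΘh : Θ h ≠ 0 := by
    intro h0
    apply hh
    have := congrArg (fun f : MvPolynomial (Fin d) k →+* MvPolynomial (Fin d) k => f h) hρΘ
    simp only [RingHom.comp_apply, RingHom.coe_coe, h0, map_zero, RingHom.id_apply] at this
    exact this.symm
  obtain ⟨m, hm'⟩ : ∃ m, (Θ h).coeff m ≠ 0 := by
    by_contra hcon
    push Not at hcon
    exact hΘh (Polynomial.ext fun m => by simpa using hcon m)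
  obtain ⟨l, hl⟩ : ∃ l : Fin d → k, MvPolynomial.eval l (Δ * (Θ h).coeff m) ≠ 0 := by
    by_contra hcon
    push Not at hcon
    exact mul_ne_zero hΔ hm' (MvPolynomial.funext fun x => by simpa using hcon x)
  rw [map_mul] at hl
  let θ : MvPolynomial (Fin d) k →ₐ[k] k[X] := (Polynomial.mapAlgHom (MvPolynomial.aeval l)).comp Θ
  have hθ : (θ : MvPolynomial (Fin d) k →+* k[X]) = (mapRingHom (MvPolynomial.eval l)).comp (Θ : MvPolynomial (Fin d) k →+* (MvPolynomial (Fin d) k)[X]) := by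
    ext <;> simp [θ, MvPolynomial.aeval_eq_eval]
  have hθ' : ∀ z, θ z = (Θ z).map (MvPolynomial.eval l) := fun z =>
    congrArg (fun f : MvPolynomial (Fin d) k →+* k[X] => f z) hθ
  refine ⟨θ, ?_, ?_, ?_⟩
  · intro i
    refine ⟨τ i.succ, fun z => ?_⟩
    have : (evalRingHom (τ i.succ)).comp (θ : MvPolynomial (Fin d) k →+* k[X]) = MvPolynomial.eval (b i) := by
      rw [hθ]
      apply MvPolynomial.ringHom_ext
      · intro x
        simp [Θ, MvPolynomial.algebraMap_eq, Polynomial.algebraMap_apply]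
      · intro j
        have h1 := hq i.succ j
        have h2 := hr i.succ
        have e2 : (MvPolynomial.eval l).comp (MvPolynomial.C : k →+* MvPolynomial (Fin d) k) = RingHom.id k := by
          ext x; simp
        simp [Θ, Polynomial.map_map, e2, h1, h2, pt]
    exact congrArg (fun f : MvPolynomial (Fin d) k →+* k => f z) this
  · intro h0
    rw [hθ'] at h0
    have := congrArg (fun p : k[X] => p.coeff m) h0
    simp only [coeff_map, coeff_zero] at this
    exact right_ne_zero_of_mul hl this
  · have := H (MvPolynomial.eval l) (left_ne_zero_of_mul hl)
    simp only [Ψ] at this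
    rwa [Polynomial.map_map, ← hθ] at this

open Polynomial in
/-- Over a curve along which the minimal polynomial stays irreducible, the prime is unique. -/
lemma prime_over_le {k B A : Type*} [Field k] [CommRing B] [CommRing A] [IsDomain B] [IsDomain A]
    [Algebra B A] [Algebra.IsIntegral B A] (α : A) (h : B)
    (H : ∀ a : A, ∃ (q : ℕ) (G : B[X]), q ≠ 0 ∧ h • a ^ q = aeval α G)
    (θ : B →+* k[X]) (hθ : θ h ≠ 0) (hirr : Irreducible ((minpoly B α).map θ))
    (P P' : Ideal A) [P.IsPrime] [P'.IsPrime]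
    (hP : P.comap (algebraMap B A) = RingHom.ker θ)
    (hP' : P'.comap (algebraMap B A) = RingHom.ker θ) : P ≤ P' := by
  have hIntegral : IsIntegral B α := Algebra.IsIntegral.isIntegral α
  have hmon := minpoly.monic hIntegral
  have key : ∀ G : B[X], aeval α G ∈ P → aeval α G ∈ P' := by
    intro G hG
    have hmod : aeval α G = aeval α (G %ₘ minpoly B α) := by
      conv_lhs => rw [← modByMonic_add_div G (minpoly B α)]
      simp
    rw [hmod] at hG ⊢
    have hmne : minpoly B α ≠ 1 := by
      intro h1
      rw [h1, Polynomial.map_one] at hirr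
      exact not_irreducible_one hirr
    have hdeg := degree_modByMonic_lt G hmon
    set G1 := G %ₘ minpoly B α with hG1
    by_cases h0 : G1.map θ = 0
    · have hc : ∀ i, G1.coeff i ∈ P'.comap (algebraMap B A) := by
        intro i
        rw [hP', RingHom.mem_ker, ← coeff_map, h0, coeff_zero]
      rw [aeval_eq_sum_range]
      refine Ideal.sum_mem _ fun i _ => ?_
      rw [Algebra.smul_def]
      exact Ideal.mul_mem_right _ _ (hc i)
    · exfalso
      let D := B ⧸ RingHom.ker θ
      have : (RingHom.ker θ).IsPrime := RingHom.ker_isPrime θ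
      have : IsDomain D := Ideal.Quotient.isDomain _
      let F := FractionRing D
      let π : B →+* F := (algebraMap D F).comp (Ideal.Quotient.mk (RingHom.ker θ))
      let j1 : D →+* FractionRing k[X] := (algebraMap k[X] (FractionRing k[X])).comp (RingHom.kerLift θ)
      have hj1 : Function.Injective j1 :=
        (IsFractionRing.injective k[X] _).comp (RingHom.kerLift_injective θ)
      let J1 : F →+* FractionRing k[X] := IsFractionRing.lift (A := D) (K := F) hj1
      have hJ1 : J1.comp π = (algebraMap k[X] (FractionRing k[X])).comp θ := by
        ext x
        simp only [J1, π, RingHom.comp_apply, IsFractionRing.lift_algebraMap, j1]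
        rfl
      let j2 : D →+* FractionRing (A ⧸ P) := (algebraMap (A ⧸ P) (FractionRing (A ⧸ P))).comp
        (Ideal.quotientMap P (algebraMap B A) hP.ge)
      have hj2 : Function.Injective j2 :=
        (IsFractionRing.injective (A ⧸ P) _).comp
          (Ideal.quotientMap_injective' (H := hP.ge) hP.le)
      let J2 : F →+* FractionRing (A ⧸ P) := IsFractionRing.lift (A := D) (K := F) hj2
      let μ : A →+* FractionRing (A ⧸ P) :=
        (algebraMap (A ⧸ P) (FractionRing (A ⧸ P))).comp (Ideal.Quotient.mk P)
      have hJ2 : J2.comp π = μ.comp (algebraMap B A) := by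
        ext x
        simp only [J2, π, RingHom.comp_apply, IsFractionRing.lift_algebraMap, j2, μ]
        rfl
      have hi1 : Irreducible ((minpoly B α).map π) := by
        apply Polynomial.Monic.irreducible_of_irreducible_map J1 _ (hmon.map π)
        rw [Polynomial.map_map, hJ1, ← Polynomial.map_map]
        exact ((hmon.map θ).irreducible_iff_irreducible_map_fraction_map).mp hirr
      have hG0 : G1.map π ≠ 0 := by
        intro h1
        have := congrArg (Polynomial.map J1) h1
        rw [Polynomial.map_map, hJ1, ← Polynomial.map_map, Polynomial.map_zero,
          Polynomial.map_eq_zero_iff (IsFractionRing.injective k[X] _)] at this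
        exact h0 this
      have hcop : IsCoprime ((minpoly B α).map π) (G1.map π) := by
        rw [hi1.coprime_iff_not_dvd]
        intro hd
        have := degree_le_of_dvd hd hG0
        rw [hmon.degree_map] at this
        exact absurd ((this.trans degree_map_le).trans_lt hdeg) (lt_irrefl _)
      obtain ⟨U, V, hUV⟩ := hcop
      have hev : ∀ g : B[X], eval₂ J2 (μ α) (g.map π) = μ (aeval α g) := by
        intro g
        rw [eval₂_map, hJ2, aeval_def, hom_eval₂]
      have := congrArg (eval₂ J2 (μ α)) hUV
      rw [eval₂_add, eval₂_mul, eval₂_mul, hev, hev, minpoly.aeval, eval₂_one] at this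
      have h3 : μ (aeval α G1) = 0 := by
        simp only [μ, RingHom.comp_apply, Ideal.Quotient.eq_zero_iff_mem.mpr hG, map_zero]
      rw [h3] at this
      simp at this
  intro a ha
  obtain ⟨q, G, hq, hG⟩ := H a
  have h1 : aeval α G ∈ P := by
    rw [← hG, Algebra.smul_def]
    exact Ideal.mul_mem_left _ _ (Ideal.pow_mem_of_mem _ ha _ (Nat.pos_of_ne_zero hq))
  have h2 := key G h1
  rw [← hG, Algebra.smul_def] at h2
  rcases Ideal.IsPrime.mem_or_mem ‹_› h2 with h3 | h3
  · exact absurd (show θ h = 0 from hP'.le h3) hθ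
  · exact Ideal.IsPrime.mem_of_pow_mem ‹_› _ h3

open Polynomial in
lemma clear_denominators {B F : Type*} [CommRing B] [IsDomain B] [Field F] [Algebra B F]
    [IsFractionRing B F] (g : F[X]) : ∃ (b : B) (G : B[X]), b ≠ 0 ∧
      G.map (algebraMap B F) = C (algebraMap B F b) * g := by
  obtain ⟨b, hb, h⟩ := IsLocalization.integerNormalization_spec (nonZeroDivisors B) g
  refine ⟨b, _, nonZeroDivisors.ne_zero hb, h.trans ?_⟩
  ext i
  simp [Algebra.smul_def]

open Polynomial in
/-- A finite extension of a normal domain is birationally, up to Frobenius powers,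
generated by one separable element. -/
lemma exists_almost_generator {B A : Type u} [CommRing B] [CommRing A] [IsDomain B] [IsDomain A]
    [Algebra B A] [Module.Finite B A] [FaithfulSMul B A] [IsIntegrallyClosed B] :
    ∃ (α : A) (h : B), h ≠ 0 ∧
      (∀ a : A, ∃ (q : ℕ) (G : B[X]), q ≠ 0 ∧ h • a ^ q = aeval α G) ∧
      ∃ (c : B) (U V : B[X]), c ≠ 0 ∧
        U * minpoly B α + V * derivative (minpoly B α) = C c := by
  classical
  let F := FractionRing B
  let E := FractionRing A
  have : FaithfulSMul B E := by
    rw [faithfulSMul_iff_algebraMap_injective, IsScalarTower.algebraMap_eq B A E]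
    exact (IsFractionRing.injective A E).comp (FaithfulSMul.algebraMap_injective B A)
  letI : Algebra F E := FractionRing.liftAlgebra B E
  haveI : IsScalarTower B F E := FractionRing.isScalarTower_liftAlgebra B E
  have hIntegral : ∀ a : A, IsIntegral B a := fun a => Algebra.IsIntegral.isIntegral a
  -- elements of `E` become elements of `A` after multiplication by a scalar of `B`
  have hE : ∀ e : E, ∃ (r : B) (a : A), r ≠ 0 ∧ algebraMap B E r * e = algebraMap A E a := by
    intro e
    obtain ⟨x, y, hy, rfl⟩ := IsFractionRing.div_surjective (A := A) e
    obtain ⟨r, hr, z, hz⟩ := (hIntegral y).isAlgebraic.exists_nonzero_dvd hy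
    refine ⟨r, z * x, hr, ?_⟩
    have hy0 : algebraMap A E y ≠ 0 := by
      rw [Ne, IsFractionRing.to_map_eq_zero_iff]
      exact nonZeroDivisors.ne_zero hy
    rw [IsScalarTower.algebraMap_apply B A E, hz, map_mul, map_mul]
    rw [mul_div_assoc', mul_comm (algebraMap A E y), mul_assoc, mul_comm (algebraMap A E y), ← mul_assoc,
      mul_div_assoc, div_self hy0, mul_one]
  have : Module.Finite F E := by
    have : IsLocalization (Algebra.algebraMapSubmonoid A (nonZeroDivisors B)) E := inferInstance
    exact Module.Finite.of_isLocalization B A (nonZeroDivisors B)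
  let Es := separableClosure F E
  obtain ⟨β, hβ⟩ := Field.exists_primitive_element F Es
  obtain ⟨r, α, hr, hα⟩ := hE β
  have hr' : algebraMap B F r ≠ 0 := by
    rw [Ne, IsFractionRing.to_map_eq_zero_iff]; exact hr
  let γ : Es := algebraMap F Es (algebraMap B F r) * β
  have hγ : (γ : E) = algebraMap A E α := by
    rw [← hα, IsScalarTower.algebraMap_apply B F E]
    rfl
  have hβγ : β = algebraMap F Es (algebraMap B F r)⁻¹ * γ := by
    simp only [γ]
    rw [← mul_assoc, ← map_mul, inv_mul_cancel₀ hr', map_one, one_mul]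
  have htop : IntermediateField.adjoin F {γ} = ⊤ := by
    rw [eq_top_iff, ← hβ, IntermediateField.adjoin_simple_le_iff, hβγ]
    exact mul_mem (IntermediateField.algebraMap_mem _ _) (IntermediateField.mem_adjoin_simple_self F γ)
  have hs : ∀ s : Es, ∃ g : F[X], (s : E) = aeval (algebraMap A E α) g := by
    intro s
    have h1 : s ∈ (IntermediateField.adjoin F {γ}).toSubalgebra := by rw [htop]; trivial
    rw [IntermediateField.adjoin_simple_toSubalgebra_of_isAlgebraic
      (Algebra.IsAlgebraic.isAlgebraic γ), Algebra.adjoin_singleton_eq_range_aeval] at h1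
    obtain ⟨g, hg⟩ := h1
    refine ⟨g, ?_⟩
    rw [← hγ, ← hg]
    exact (Polynomial.aeval_algHom_apply Es.val γ g).symm
  have hmin : minpoly F (algebraMap A E α) = (minpoly B α).map (algebraMap B F) :=
    minpoly.isIntegrallyClosed_eq_field_fractions F E (hIntegral α)
  obtain ⟨p, hp⟩ := ExpChar.exists Es
  have : ExpChar E p := expChar_of_injective_algebraMap (algebraMap Es E).injective p
  have : ExpChar A p := (RingHom.expChar_iff (algebraMap A E) (IsFractionRing.injective A E) p).mpr ‹_›
  let e := IsPurelyInseparable.exponent Es E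
  have he : ∀ a : E, a ^ p ^ e ∈ (algebraMap Es E).range :=
    IsPurelyInseparable.exponent_def' Es p
  have hsingle : ∀ a : A, ∃ (b : B) (G : B[X]), b ≠ 0 ∧ b • a ^ p ^ e = aeval α G := by
    intro a
    obtain ⟨s, hs'⟩ := he (algebraMap A E a)
    obtain ⟨g, hg⟩ := hs s
    obtain ⟨b, G, hb, hG⟩ := clear_denominators (B := B) g
    refine ⟨b, G, hb, IsFractionRing.injective A E ?_⟩
    have h2 : (s : E) = algebraMap A E a ^ p ^ e := hs'
    rw [← Polynomial.aeval_algebraMap_apply, ← Polynomial.aeval_map_algebraMap F, hG, map_mul,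
      ← hg, h2, aeval_C, ← IsScalarTower.algebraMap_apply, Algebra.smul_def, map_mul, map_pow,
      ← IsScalarTower.algebraMap_apply]
  obtain ⟨S, hS⟩ := (Module.Finite.fg_top : (⊤ : Submodule B A).FG)
  choose b G hb hG using hsingle
  refine ⟨α, ∏ a ∈ S, b a, Finset.prod_ne_zero_iff.mpr fun a _ => hb a, ?_, ?_⟩
  · intro a
    have : a ∈ Submodule.span B (S : Set A) := by rw [hS]; trivial
    suffices ∃ G : B[X], (∏ a ∈ S, b a) • a ^ p ^ e = aeval α G by
      obtain ⟨G, hG⟩ := this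
      exact ⟨p ^ e, G, (pow_pos (expChar_pos E p) e).ne', hG⟩
    induction this using Submodule.span_induction with
    | mem x hx =>
      refine ⟨C (∏ a ∈ S.erase x, b a) * G x, ?_⟩
      rw [map_mul, ← hG, aeval_C, ← Finset.mul_prod_erase S b hx]
      simp only [Algebra.smul_def, map_mul]
      ring
    | zero => exact ⟨0, by rw [zero_pow (pow_pos (expChar_pos E p) e).ne', smul_zero, map_zero]⟩
    | add x y _ _ hx hy =>
      obtain ⟨G1, h1⟩ := hx
      obtain ⟨G2, h2⟩ := hy
      exact ⟨G1 + G2, by rw [add_pow_expChar_pow, smul_add, h1, h2, map_add]⟩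
    | smul c x _ hx =>
      obtain ⟨G1, h1⟩ := hx
      exact ⟨C (c ^ p ^ e) * G1, by rw [_root_.smul_pow, smul_comm, h1, map_mul, aeval_C,
        Algebra.smul_def]⟩
  · have hsep : (minpoly F (algebraMap A E α)).Separable := by
      rw [← hγ]
      exact mem_separableClosure_iff.mp γ.2
    rw [hmin] at hsep
    obtain ⟨U, V, hUV⟩ := hsep
    obtain ⟨b1, U1, hb1, hU1⟩ := clear_denominators (B := B) U
    obtain ⟨b2, V1, hb2, hV1⟩ := clear_denominators (B := B) V
    refine ⟨b1 * b2, C b2 * U1, C b1 * V1, mul_ne_zero hb1 hb2, ?_⟩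
    apply Polynomial.map_injective _ (IsFractionRing.injective B F)
    simp only [Polynomial.map_add, Polynomial.map_mul, Polynomial.map_C, hU1, hV1, map_mul,
      ← derivative_map]
    linear_combination C (algebraMap B F b1) * C (algebraMap B F b2) * hUV

open Polynomial in
/-- **Theorem T**: a curve through finitely many points of an affine variety. -/
lemma exists_curve_prime {k A : Type u} [Field k] [IsAlgClosed k] [CommRing A] [IsDomain A]
    [Algebra k A] [Algebra.FiniteType k A] (n : ℕ) (χ : Fin n → A →ₐ[k] k) :
    ∃ P : Ideal A, P.IsPrime ∧ (∀ i, P ≤ RingHom.ker (χ i)) ∧ Algebra.trdeg k (A ⧸ P) ≤ 1 := by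
  classical
  have : Infinite k := IsAlgClosed.instInfinite
  obtain ⟨d, g, hg, hfin⟩ := exists_finite_inj_algHom_of_fg k A
  letI : Algebra (MvPolynomial (Fin d) k) A := g.toRingHom.toAlgebra
  have hgA : ∀ z, algebraMap (MvPolynomial (Fin d) k) A z = g z := fun z => rfl
  have : IsScalarTower k (MvPolynomial (Fin d) k) A :=
    IsScalarTower.of_algebraMap_eq fun x => (g.commutes x).symm
  have : Module.Finite (MvPolynomial (Fin d) k) A := hfin
  have : FaithfulSMul (MvPolynomial (Fin d) k) A :=
    (faithfulSMul_iff_algebraMap_injective _ _).mpr hg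
  obtain ⟨α, h, hh, H, c, U, V, hc, hUV⟩ :=
    exists_almost_generator (B := MvPolynomial (Fin d) k) (A := A)
  have hIntegral : IsIntegral (MvPolynomial (Fin d) k) α := Algebra.IsIntegral.isIntegral α
  obtain ⟨a, ha⟩ : ∃ a : Fin d → k, MvPolynomial.eval a c ≠ 0 := by
    by_contra hcon
    push Not at hcon
    exact hc (MvPolynomial.funext fun x => by simpa using hcon x)
  have hmon := minpoly.monic hIntegral
  obtain ⟨α₀, hα₀⟩ : ∃ α₀, ((minpoly (MvPolynomial (Fin d) k) α).map
      (MvPolynomial.eval a)).IsRoot α₀ := by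
    apply IsAlgClosed.exists_root
    rw [hmon.degree_map]
    exact (minpoly.degree_pos hIntegral).ne'
  obtain ⟨θ, hθ, hθh, hθi⟩ := exists_good_curve d n (minpoly (MvPolynomial (Fin d) k) α) hmon
    (minpoly.irreducible hIntegral) a α₀ hα₀ (by
      intro h0
      have := congrArg (fun p => (p.map (MvPolynomial.eval a)).eval α₀) hUV
      simp only [Polynomial.map_add, Polynomial.map_mul, Polynomial.map_C, eval_add, eval_mul,
        eval_C, ← derivative_map] at this
      rw [hα₀, h0, mul_zero, mul_zero, add_zero] at this
      exact ha this.symm) h hh (fun i j => χ i (g (MvPolynomial.X j)))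
  have hχ : ∀ i z, MvPolynomial.eval (fun j => χ i (g (MvPolynomial.X j))) z = χ i (g z) := by
    intro i z
    have : MvPolynomial.aeval (fun j => χ i (g (MvPolynomial.X j))) = (χ i).comp g := by
      ext j; simp
    rw [← MvPolynomial.aeval_eq_eval, this]
    rfl
  let p : Ideal (MvPolynomial (Fin d) k) := RingHom.ker (θ : MvPolynomial (Fin d) k →+* k[X])
  have hp : p.IsPrime := RingHom.ker_isPrime _
  obtain ⟨P, -, hP, hPp⟩ := Ideal.exists_ideal_over_prime_of_isIntegral (S := A) p ⊥ (by
    rw [← RingHom.ker_eq_comap_bot,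
      (RingHom.injective_iff_ker_eq_bot (algebraMap (MvPolynomial (Fin d) k) A)).mp hg]
    exact bot_le)
  refine ⟨P, hP, ?_, ?_⟩
  · intro i
    let Q : Ideal A := RingHom.ker (χ i)
    have hQ : Q.IsPrime := RingHom.ker_isPrime _
    let q : Ideal (MvPolynomial (Fin d) k) := Q.comap (algebraMap _ _)
    have hq : q.IsPrime := Ideal.comap_isPrime _ _
    have : Q.LiesOver q := ⟨rfl⟩
    have hpq : p ≤ q := by
      intro z hz
      obtain ⟨τ, hτ⟩ := hθ i
      have h1 : θ z = 0 := hz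
      have h2 := hτ z
      rw [h1, hχ, eval_zero] at h2
      exact h2.symm
    obtain ⟨P', hP'Q, hP', hP'p⟩ := Ideal.exists_ideal_le_liesOver_of_le Q hpq
    refine le_trans ?_ hP'Q
    exact prime_over_le α h H (θ : MvPolynomial (Fin d) k →+* k[X]) hθh hθi P P' hPp
      hP'p.over.symm
  · have : P.LiesOver p := ⟨hPp.symm⟩
    have : IsDomain (MvPolynomial (Fin d) k ⧸ p) := Ideal.Quotient.isDomain _
    have : IsDomain (A ⧸ P) := Ideal.Quotient.isDomain _
    have : IsScalarTower k (MvPolynomial (Fin d) k ⧸ p) (A ⧸ P) := inferInstance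
    have e1 := trdeg_add_eq k (MvPolynomial (Fin d) k ⧸ p) (A := A ⧸ P)
    have : Algebra.IsIntegral (MvPolynomial (Fin d) k ⧸ p) (A ⧸ P) := inferInstance
    rw [trdeg_eq_zero (R := MvPolynomial (Fin d) k ⧸ p), add_zero] at e1
    rw [← e1, ← Polynomial.trdeg_of_isDomain (R := k)]
    exact trdeg_le_of_injective (Ideal.kerLiftAlg θ) (Ideal.kerLiftAlg_injective θ)

/-- Weak Nullstellensatz in the form used below. -/
lemma exists_algHom_to_algClosed {k R : Type*} [Field k] [IsAlgClosed k] [CommRing R] [Algebra k R]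
    [Algebra.FiniteType k R] (I : Ideal R) (hI : I ≠ ⊤) :
    ∃ χ : R →ₐ[k] k, ∀ x ∈ I, χ x = 0 := by
  obtain ⟨M, hM, hIM⟩ := Ideal.exists_le_maximal I hI
  letI : Field (R ⧸ M) := Ideal.Quotient.field M
  have : Module.Finite k (R ⧸ M) := finite_of_finite_type_of_isJacobsonRing k (R ⧸ M)
  have hb : Function.Bijective (algebraMap k (R ⧸ M)) :=
    IsAlgClosed.algebraMap_bijective_of_isIntegral
  let e : k ≃ₐ[k] (R ⧸ M) := AlgEquiv.ofBijective (Algebra.ofId k (R ⧸ M)) hb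
  refine ⟨(e.symm : (R ⧸ M) →ₐ[k] k).comp (Ideal.Quotient.mkₐ k M), fun x hx => ?_⟩
  have : Ideal.Quotient.mkₐ k M x = 0 := Ideal.Quotient.eq_zero_iff_mem.mpr (hIM hx)
  rw [AlgHom.comp_apply, this, map_zero]

/-- A scalar avoiding the residues of `a` at finitely many valuation rings. -/
lemma exists_good_scalar {k L : Type*} [Field k] [Infinite k] [Field L] [Algebra k L] (n : ℕ)
    (V : Fin n → ValuationSubring L) (hV : ∀ i c, algebraMap k L c ∈ V i) (a : L) :
    ∃ c : k, ∀ j, 1 ≤ (V j).valuation (a - algebraMap k L c) := by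
  classical
  have hsub : ∀ j, {c : k | (V j).valuation (a - algebraMap k L c) < 1}.Subsingleton := by
    intro j c hc c' hc'
    by_contra hne
    have h1 : (V j).valuation (algebraMap k L (c' - c)) < 1 := by
      have : algebraMap k L (c' - c) = (a - algebraMap k L c) - (a - algebraMap k L c') := by
        rw [map_sub]; ring
      rw [this]
      exact lt_of_le_of_lt (Valuation.map_sub _ _ _) (max_lt hc hc')
    have h2 : (V j).valuation (algebraMap k L (c' - c)⁻¹) ≤ 1 :=
      ((V j).valuation_le_one_iff _).mpr (hV j _)
    have h3 : (V j).valuation (algebraMap k L (c' - c)) * (V j).valuation (algebraMap k L (c' - c)⁻¹) = 1 := by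
      rw [← map_mul, ← map_mul, mul_inv_cancel₀ (sub_ne_zero.mpr (Ne.symm hne)), map_one, map_one]
    have := mul_lt_one_of_lt_of_le h1 h2
    exact absurd h3 this.ne
  have hfin : (⋃ j, {c : k | (V j).valuation (a - algebraMap k L c) < 1}).Finite :=
    Set.finite_iUnion fun j => (hsub j).finite
  obtain ⟨c, hc⟩ := hfin.infinite_compl.nonempty
  refine ⟨c, fun j => ?_⟩
  by_contra hlt
  exact hc (Set.mem_iUnion.mpr ⟨j, not_le.mp hlt⟩)

/-- The algebraic core: a common one-dimensional specialization. -/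
lemma exists_common_specialization {k L : Type u} [Field k] [IsAlgClosed k] [Field L] [Algebra k L]
    (n : ℕ) (A : Fin n → Subalgebra k L) (hA : ∀ i, (A i).FG) (φ : ∀ i, A i →ₐ[k] k) :
    ∃ (O : Subalgebra k L) (hAO : ∀ i, A i ≤ O) (M : Type u) (_ : Field M) (_ : Algebra k M)
      (ψ : O →ₐ[k] M), Algebra.trdeg k M ≤ 1 ∧
      ∀ i (a : A i), ψ (Subalgebra.inclusion (hAO i) a) = 0 → φ i a = 0 := by
  classical
  have : Infinite k := IsAlgClosed.instInfinite
  have hVex : ∀ i, ∃ V : ValuationSubring L, (∀ a : A i, (a : L) ∈ V) ∧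
      ∀ a : A i, φ i a = 0 → V.valuation (a : L) < 1 := by
    intro i
    obtain ⟨V, hV1, hV2⟩ := Ideal.image_subset_nonunits_valuationSubring
      (A := (A i).toSubring) (RingHom.ker (φ i)) (RingHom.ker_ne_top (φ i))
    refine ⟨V, fun a => hV1 a.2, fun a ha => ?_⟩
    rw [← ValuationSubring.mem_nonunits_iff]
    exact hV2 ⟨a, ha, rfl⟩
  choose V hAV hφV using hVex
  have hkV : ∀ i c, algebraMap k L c ∈ V i := fun i c => hAV i (algebraMap k (A i) c)
  choose c hc using exists_good_scalar n V hkV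
  choose S hS using hA
  let b : L → L := fun a => (a - algebraMap k L (c a))⁻¹
  have hbV : ∀ a j, b a ∈ V j := by
    intro a j
    rw [← ValuationSubring.valuation_le_one_iff]
    simp only [b, map_inv₀]
    exact inv_le_one_of_one_le₀ (hc a j)
  have hbinv : ∀ a, (b a)⁻¹ = a - algebraMap k L (c a) := fun a => inv_inv _
  have hbinvV : ∀ i, ∀ a ∈ S i, (b a)⁻¹ ∈ V i := by
    intro i a ha
    rw [hbinv]
    refine sub_mem ?_ (hkV i _)
    have : a ∈ A i := by rw [← hS i]; exact Algebra.subset_adjoin ha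
    exact hAV i ⟨a, this⟩
  have hb0 : ∀ i, ∀ a ∈ S i, b a ≠ 0 := by
    intro i a ha h0
    have h1 := hc a i
    have h2 : a - algebraMap k L (c a) = 0 := by rw [← hbinv, h0, inv_zero]
    rw [h2, map_zero] at h1
    exact absurd h1 (by simp)
  let T : Finset L := (Finset.univ.biUnion S).image b
  let A' : Subalgebra k L := Algebra.adjoin k (T : Set L)
  have hA'fg : A'.FG := ⟨T, rfl⟩
  have : Algebra.FiniteType k A' := (Subalgebra.fg_iff_finiteType _).mp hA'fg
  have hbT : ∀ i, ∀ a ∈ S i, b a ∈ A' := fun i a ha => Algebra.subset_adjoin (by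
    simp only [T, Finset.coe_image]
    exact ⟨a, by simp only [Finset.coe_biUnion, Finset.mem_coe, Set.mem_iUnion]
                 exact ⟨i, Finset.mem_univ i, ha⟩, rfl⟩)
  let s : Fin n → L := fun i => ∏ a ∈ S i, b a
  have hs0 : ∀ i, s i ≠ 0 := fun i => Finset.prod_ne_zero_iff.mpr (hb0 i)
  have hsA' : ∀ i, s i ∈ A' := fun i => Subalgebra.prod_mem _ (hbT i)
  have hsinvV : ∀ i, (s i)⁻¹ ∈ V i := by
    intro i
    simp only [s]
    rw [← Finset.prod_inv_distrib]
    exact prod_mem (hbinvV i)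
  let A1 : Fin n → Subalgebra k L := fun i => Algebra.adjoin k ((insert (s i)⁻¹ T : Finset L) : Set L)
  have hA1fg : ∀ i, Algebra.FiniteType k (A1 i) := fun i =>
    (Subalgebra.fg_iff_finiteType _).mp ⟨_, rfl⟩
  have hA'A1 : ∀ i, A' ≤ A1 i := fun i => Algebra.adjoin_mono (by simp)
  have hsA1 : ∀ i, (s i)⁻¹ ∈ A1 i := fun i => Algebra.subset_adjoin (by simp)
  have hA1V : ∀ i, ∀ z ∈ A1 i, z ∈ V i := by
    intro i z hz
    induction hz using Algebra.adjoin_induction with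
    | mem x hx =>
      rw [Finset.coe_insert, Set.mem_insert_iff] at hx
      rcases hx with rfl | hx
      · exact hsinvV i
      · simp only [T, Finset.coe_image] at hx
        obtain ⟨a, -, rfl⟩ := hx
        exact hbV a i
    | algebraMap r => exact hkV i r
    | add x y _ _ hx hy => exact add_mem hx hy
    | mul x y _ _ hx hy => exact mul_mem hx hy
  have hAA1 : ∀ i, A i ≤ A1 i := by
    intro i
    rw [← hS i]
    refine Algebra.adjoin_le fun a ha => ?_
    have h1 : a = algebraMap k L (c a) + (∏ x ∈ (S i).erase a, b x) * (s i)⁻¹ := by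
      have h2 : s i = b a * ∏ x ∈ (S i).erase a, b x := (Finset.mul_prod_erase (S i) b ha).symm
      have h3 : ∏ x ∈ (S i).erase a, b x ≠ 0 :=
        Finset.prod_ne_zero_iff.mpr fun x hx => hb0 i x (Finset.mem_of_mem_erase hx)
      rw [h2, mul_inv, mul_comm (b a)⁻¹, ← mul_assoc, mul_inv_cancel₀ h3, one_mul, hbinv]
      ring
    rw [h1]
    refine add_mem (Subalgebra.algebraMap_mem _ _) (mul_mem (hA'A1 i ?_) (hsA1 i))
    exact Subalgebra.prod_mem _ fun x hx => hbT i x (Finset.mem_of_mem_erase hx)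
  have hA1pow : ∀ i, ∀ z ∈ A1 i, ∃ N : ℕ, z * s i ^ N ∈ A' := by
    intro i z hz
    induction hz using Algebra.adjoin_induction with
    | mem x hx =>
      rw [Finset.coe_insert, Set.mem_insert_iff] at hx
      rcases hx with rfl | hx
      · exact ⟨1, by rw [pow_one, inv_mul_cancel₀ (hs0 i)]; exact one_mem _⟩
      · exact ⟨0, by rw [pow_zero, mul_one]; exact Algebra.subset_adjoin hx⟩
    | algebraMap r => exact ⟨0, by rw [pow_zero, mul_one]; exact Subalgebra.algebraMap_mem _ _⟩
    | add x y _ _ hx hy =>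
      obtain ⟨N, hN⟩ := hx
      obtain ⟨N', hN'⟩ := hy
      refine ⟨N + N', ?_⟩
      have : (x + y) * s i ^ (N + N') = (x * s i ^ N) * s i ^ N' + (y * s i ^ N') * s i ^ N := by
        ring
      rw [this]
      exact add_mem (mul_mem hN (pow_mem (hsA' i) _)) (mul_mem hN' (pow_mem (hsA' i) _))
    | mul x y _ _ hx hy =>
      obtain ⟨N, hN⟩ := hx
      obtain ⟨N', hN'⟩ := hy
      refine ⟨N + N', ?_⟩
      have : (x * y) * s i ^ (N + N') = (x * s i ^ N) * (y * s i ^ N') := by ring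
      rw [this]
      exact mul_mem hN hN'
  have hχex : ∀ i, ∃ χ : A1 i →ₐ[k] k, ∀ x : A1 i, (V i).valuation (x : L) < 1 → χ x = 0 := by
    intro i
    let j : A1 i →+* V i := 
      { toFun := fun z => ⟨z, hA1V i z z.2⟩
        map_one' := rfl
        map_mul' := fun _ _ => rfl
        map_zero' := rfl
        map_add' := fun _ _ => rfl }
    obtain ⟨χ, hχ⟩ := exists_algHom_to_algClosed (k := k)
      ((IsLocalRing.maximalIdeal (V i)).comap j) (Ideal.comap_ne_top _ (Ideal.IsPrime.ne_top'))
    refine ⟨χ, fun x hx => hχ x ?_⟩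
    rw [Ideal.mem_comap]
    exact ((V i).valuation_lt_one_iff _).mpr hx
  choose χ hχ using hχex
  have hχφ : ∀ i (a : A i), χ i (Subalgebra.inclusion (hAA1 i) a) = φ i a := by
    intro i a
    have h1 : χ i (Subalgebra.inclusion (hAA1 i) (a - algebraMap k (A i) (φ i a))) = 0 := by
      apply hχ
      apply hφV i (a - algebraMap k (A i) (φ i a))
      rw [map_sub, AlgHom.commutes]
      simp
    rw [map_sub, map_sub, AlgHom.commutes, AlgHom.commutes] at h1
    exact sub_eq_zero.mp h1
  obtain ⟨P, hP, hPχ, htr⟩ := exists_curve_prime (A := A') n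
    (fun i => (χ i).comp (Subalgebra.inclusion (hA'A1 i)))
  have hPχ' : ∀ i (x : A'), x ∈ P → χ i (Subalgebra.inclusion (hA'A1 i) x) = 0 :=
    fun i x hx => hPχ i hx
  have hχs : ∀ i, χ i (Subalgebra.inclusion (hA'A1 i) ⟨s i, hsA' i⟩) ≠ 0 := by
    intro i h0
    have h1 : (Subalgebra.inclusion (hA'A1 i) ⟨s i, hsA' i⟩) * (⟨(s i)⁻¹, hsA1 i⟩ : A1 i) = 1 :=
      Subtype.ext (mul_inv_cancel₀ (hs0 i))
    have h2 := congrArg (χ i) h1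
    rw [map_mul, h0, zero_mul, map_one] at h2
    exact zero_ne_one h2
  have hsP : ∀ i, (⟨s i, hsA' i⟩ : A') ∉ P := fun i h => hχs i (hPχ' i _ h)
  let Loc := Localization.AtPrime P
  let ι : Loc →ₐ[k] L := IsLocalization.liftAlgHom (M := P.primeCompl) (f := A'.val) (by
    intro y
    rw [isUnit_iff_ne_zero]
    intro h0
    apply y.2
    have : (y : A') = 0 := Subtype.ext h0
    rw [this]
    exact zero_mem _)
  have hι : ∀ x : A', ι (algebraMap A' Loc x) = x := fun x => by
    simp only [ι]
    exact IsLocalization.lift_eq _ x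
  have hιinj : Function.Injective ι := by
    rw [injective_iff_map_eq_zero]
    intro z hz
    obtain ⟨x, y, rfl⟩ := IsLocalization.exists_mk'_eq P.primeCompl z
    have h1 := congrArg ι (IsLocalization.mk'_spec Loc x y)
    rw [map_mul, hz, zero_mul, hι] at h1
    have h2 : x = 0 := Subtype.ext h1.symm
    rw [h2, IsLocalization.mk'_zero]
  have : IsDomain (A' ⧸ P) := Ideal.Quotient.isDomain P
  let M := FractionRing (A' ⧸ P)
  let π : A' →ₐ[k] M := (IsScalarTower.toAlgHom k (A' ⧸ P) M).comp (Ideal.Quotient.mkₐ k P)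
  have hπ : ∀ x, π x = 0 ↔ x ∈ P := by
    intro x
    rw [← Ideal.Quotient.eq_zero_iff_mem]
    exact IsFractionRing.to_map_eq_zero_iff (R := A' ⧸ P) (K := M)
  let ψ : Loc →ₐ[k] M := IsLocalization.liftAlgHom (M := P.primeCompl) (f := π) (by
    intro y
    rw [isUnit_iff_ne_zero, Ne, hπ]
    exact y.2)
  have hψ : ∀ x : A', ψ (algebraMap A' Loc x) = π x := fun x => by
    simp only [ψ]
    exact IsLocalization.lift_eq _ x
  let e : Loc ≃ₐ[k] ι.range := AlgEquiv.ofInjective ι hιinj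
  have hA'O : A' ≤ ι.range := fun x hx => ⟨algebraMap A' Loc ⟨x, hx⟩, hι ⟨x, hx⟩⟩
  have hA1O : ∀ i, A1 i ≤ ι.range := by
    intro i z hz
    obtain ⟨N, hN⟩ := hA1pow i z hz
    refine ⟨IsLocalization.mk' Loc (⟨_, hN⟩ : A') (⟨_, hsP i⟩ ^ N : P.primeCompl), ?_⟩
    have h1 := IsLocalization.mk'_spec Loc (⟨_, hN⟩ : A') (⟨_, hsP i⟩ ^ N : P.primeCompl)
    have h2 := congrArg ι h1
    rw [map_mul, hι, hι] at h2
    exact mul_right_cancel₀ (pow_ne_zero N (hs0 i)) h2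
  have heA' : ∀ x : A', e.symm (Subalgebra.inclusion hA'O x) = algebraMap A' Loc x := by
    intro x
    rw [AlgEquiv.symm_apply_eq]
    exact Subtype.ext (hι x).symm
  refine ⟨ι.range, fun i => (hAA1 i).trans (hA1O i), M, inferInstance, inferInstance,
    ψ.comp (e.symm : ι.range →ₐ[k] Loc), ?_, ?_⟩
  · have : FaithfulSMul k (A' ⧸ P) :=
      (faithfulSMul_iff_algebraMap_injective _ _).mpr (algebraMap k (A' ⧸ P)).injective
    rw [← trdeg_add_eq k (A' ⧸ P) (A := M)]
    have := IsLocalization.isAlgebraic (R := A' ⧸ P) M (nonZeroDivisors (A' ⧸ P))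
    rw [trdeg_eq_zero (R := A' ⧸ P), add_zero]
    exact htr
  · intro i a ha
    rw [← hχφ i a]
    obtain ⟨N, hN⟩ := hA1pow i a (hAA1 i a.2)
    have h1 : Subalgebra.inclusion hA'O ⟨_, hN⟩ =
        Subalgebra.inclusion ((hAA1 i).trans (hA1O i)) a *
          Subalgebra.inclusion hA'O ⟨s i, hsA' i⟩ ^ N := rfl
    have h2 := congrArg (ψ.comp (e.symm : ι.range →ₐ[k] Loc)) h1
    rw [map_mul, ha, zero_mul] at h2
    have h3 : (⟨_, hN⟩ : A') ∈ P := by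
      rw [← hπ, ← hψ, ← heA']
      exact h2
    have h4 := hPχ' i _ h3
    have h5 : Subalgebra.inclusion (hA'A1 i) ⟨_, hN⟩ =
        Subalgebra.inclusion (hAA1 i) a * Subalgebra.inclusion (hA'A1 i) ⟨s i, hsA' i⟩ ^ N := rfl
    rw [h5, map_mul, map_pow] at h4
    exact (mul_eq_zero.mp h4).resolve_right (pow_ne_zero N (hχs i))

/-- A finitely generated algebra mapping to a field of transcendence degree at most one
has no chains of length two above the kernel. -/
lemma no_chain_of_trdeg_le_one {K R M : Type u} [Field K] [CommRing R] [Algebra K R]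
    [Algebra.FiniteType K R] [Field M] [Algebra K M] (g : R →ₐ[K] M) (htr : Algebra.trdeg K M ≤ 1)
    (q₂ q₁ q₀ : PrimeSpectrum R) (h : RingHom.ker g ≤ q₂.asIdeal) (h1 : q₂ < q₁) (h2 : q₁ < q₀) :
    False := by
  let D := R ⧸ RingHom.ker g
  have hinj : Function.Injective (Ideal.kerLiftAlg g) := Ideal.kerLiftAlg_injective g
  have : (RingHom.ker g).IsPrime := RingHom.ker_isPrime g
  have hDdim : ringKrullDim D ≤ 1 := by
    obtain ⟨s, j, hj, hfin⟩ := exists_finite_inj_algHom_of_fg K D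
    have hs : s ≤ 1 := by
      have e1 : Algebra.trdeg K (MvPolynomial (Fin s) K) ≤ 1 :=
        (trdeg_le_of_injective ((Ideal.kerLiftAlg g).comp j) (hinj.comp hj)).trans htr
      rw [MvPolynomial.trdeg_of_isDomain] at e1
      simpa using e1
    letI : Algebra (MvPolynomial (Fin s) K) D := j.toRingHom.toAlgebra
    have : Module.Finite (MvPolynomial (Fin s) K) D := hfin
    have : Algebra.IsIntegral (MvPolynomial (Fin s) K) D := inferInstance
    have hle : ringKrullDim D ≤ ringKrullDim (MvPolynomial (Fin s) K) := by
      refine Order.krullDim_le_of_strictMono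
        (PrimeSpectrum.comap (algebraMap (MvPolynomial (Fin s) K) D)) ?_
      intro a b hab
      exact Ideal.IsIntegral.comap_lt_comap hab
    refine hle.trans ?_
    rw [MvPolynomial.ringKrullDim_of_isNoetherianRing, ringKrullDim_eq_zero_of_field]
    simpa using hs
  rw [ringKrullDim_quotient] at hDdim
  let Z := PrimeSpectrum.zeroLocus (R := R) (RingHom.ker g)
  have m2 : q₂ ∈ Z := h
  have m1 : q₁ ∈ Z := h.trans h1.le
  have m0 : q₀ ∈ Z := h.trans (h1.trans h2).le
  have hs : StrictMono (![⟨q₂, m2⟩, ⟨q₁, m1⟩, ⟨q₀, m0⟩] : Fin (2 + 1) → Z) := by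
    refine Fin.strictMono_iff_lt_succ.mpr fun i => ?_
    fin_cases i
    · exact h1
    · exact h2
  let l : LTSeries Z := LTSeries.mk 2 _ hs
  have := (Order.LTSeries.length_le_krullDim l).trans hDdim
  have hl : l.length = 2 := rfl
  rw [hl] at this
  exact absurd this (by norm_num)

lemma exists_chart {k : Type u} [Field k] {Y : Scheme.{u}} (h : Y ⟶ Spec (CommRingCat.of k))
    [LocallyOfFiniteType h] (y : Y) :
    ∃ (R : Type u) (_ : CommRing R) (_ : Algebra k R) (_ : Algebra.FiniteType k R)
      (j : Spec (CommRingCat.of R) ⟶ Y), IsOpenImmersion j ∧ y ∈ Set.range j ∧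
      j ≫ h = Spec.map (CommRingCat.ofHom (algebraMap k R)) := by
  obtain ⟨U, hU, hyU, -⟩ := exists_isAffineOpen_mem_and_subset (U := ⊤) (x := y) (by simp)
  let j : Spec (CommRingCat.of Γ(Y, U)) ⟶ Y := hU.fromSpec
  have hj : IsOpenImmersion j := inferInstanceAs (IsOpenImmersion hU.fromSpec)
  let φ : CommRingCat.of k ⟶ CommRingCat.of Γ(Y, U) := Spec.preimage (j ≫ h)
  have hφ : Spec.map φ = j ≫ h := Spec.map_preimage _
  have hft : LocallyOfFiniteType (Spec.map φ) := by rw [hφ]; infer_instance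
  have hft' : φ.hom.FiniteType := HasRingHomProperty.Spec_iff.mp hft
  letI : Algebra k Γ(Y, U) := φ.hom.toAlgebra
  refine ⟨Γ(Y, U), inferInstance, inferInstance, hft', j, hj, ?_, ?_⟩
  · have : Set.range j = U := hU.range_fromSpec
    rw [this]; exact hyU
  · rw [← hφ]; rfl

lemma exists_lift_chart {k : Type u} [Field k] {Y : Scheme.{u}} (h : Y ⟶ Spec (CommRingCat.of k))
    {R : Type u} [CommRing R] [Algebra k R] (j : Spec (CommRingCat.of R) ⟶ Y) [IsOpenImmersion j]
    (hj : j ≫ h = Spec.map (CommRingCat.ofHom (algebraMap k R)))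
    {M : Type u} [Field M] [Algebra k M] (m : Spec (CommRingCat.of M) ⟶ Y)
    (hm : m ≫ h = Spec.map (CommRingCat.ofHom (algebraMap k M)))
    (y : Y) (hy : y ∈ Set.range j) (hs : ∀ t, m t ⤳ y) :
    ∃ r : R →ₐ[k] M, Spec.map (CommRingCat.ofHom r.toRingHom) ≫ j = m := by
  have hr : Set.range m ⊆ Set.range j := by
    rintro _ ⟨t, rfl⟩
    exact (hs t).mem_open j.isOpenEmbedding.isOpen_range hy
  let q := IsOpenImmersion.lift j m hr
  have hq : q ≫ j = m := IsOpenImmersion.lift_fac j m hr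
  let ρ : CommRingCat.of R ⟶ CommRingCat.of M := Spec.preimage q
  have hρ : Spec.map ρ = q := Spec.map_preimage _
  have e : CommRingCat.ofHom (algebraMap k R) ≫ ρ = CommRingCat.ofHom (algebraMap k M) := by
    apply Spec.map_injective
    rw [Spec.map_comp, ← hj, hρ, ← hm, ← hq, Category.assoc]
  refine ⟨{ ρ.hom with commutes' := fun a => ?_ }, ?_⟩
  · exact congrArg (fun φ => φ.hom a) e
  · rw [← hq, ← hρ]; rfl

lemma spec_field_apply {R M : Type u} [CommRing R] [Field M] (r : R →+* M)
    (t : Spec (CommRingCat.of M)) :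
    ((Spec.map (CommRingCat.ofHom r) t : Spec (CommRingCat.of R)) : PrimeSpectrum R).asIdeal =
      RingHom.ker r := by
  have : (t : PrimeSpectrum M).asIdeal = ⊥ := by
    have := (t : PrimeSpectrum M).2
    exact (eq_bot_or_eq_top _).resolve_right this.ne_top
  change Ideal.comap r (t : PrimeSpectrum M).asIdeal = _
  rw [this]; rfl

lemma curve_dim_le_one {K : Type u} [Field K] {X : Scheme.{u}} (f : X ⟶ Spec (CommRingCat.of K))
    [LocallyOfFiniteType f] {M : Type u} [Field M] [Algebra K M] (htr : Algebra.trdeg K M ≤ 1)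
    (m : Spec (CommRingCat.of M) ⟶ X)
    (hm : m ≫ f = Spec.map (CommRingCat.ofHom (algebraMap K M)))
    (t : Spec (CommRingCat.of M)) :
    topologicalKrullDim (closure {m t} : Set X) ≤ 1 := by
  by_contra hcon
  let C : Set X := closure {m t}
  have hC : IsClosed C := isClosed_closure
  have hl : ∃ l : LTSeries (TopologicalSpace.IrreducibleCloseds C), 2 ≤ l.length := by
    by_contra hno
    push Not at hno
    apply hcon
    refine iSup_le fun l => ?_
    have := hno l
    have h1 : l.length ≤ 1 := by omega
    exact_mod_cast h1
  obtain ⟨l, hl⟩ := hl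
  have hgen : ∀ Z : TopologicalSpace.IrreducibleCloseds C,
      ∃ z : X, IsGenericPoint z (Subtype.val '' (Z : Set C)) := by
    intro Z
    have h1 : IsIrreducible (Subtype.val '' (Z : Set C)) :=
      Z.isIrreducible.image _ continuous_subtype_val.continuousOn
    exact ⟨_, h1.isGenericPoint_genericPoint (hC.isClosedEmbedding_subtypeVal.isClosedMap _ Z.isClosed)⟩
  have key : ∀ (Z Z' : TopologicalSpace.IrreducibleCloseds C) (z z' : X),
      IsGenericPoint z (Subtype.val '' (Z : Set C)) →
      IsGenericPoint z' (Subtype.val '' (Z' : Set C)) → Z < Z' → z' ⤳ z ∧ z' ≠ z := by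
    intro Z Z' z z' hz hz' hlt
    refine ⟨hz'.specializes (Set.image_mono hlt.le hz.mem), ?_⟩
    rintro rfl
    apply hlt.ne
    have : Subtype.val '' (Z : Set C) = Subtype.val '' (Z' : Set C) := hz.def.symm.trans hz'.def
    exact SetLike.coe_injective (Subtype.val_injective.image_injective this)
  obtain ⟨z0, hz0⟩ := hgen (l ⟨0, by omega⟩)
  obtain ⟨z1, hz1⟩ := hgen (l ⟨1, by omega⟩)
  obtain ⟨z2, hz2⟩ := hgen (l ⟨2, by omega⟩)
  obtain ⟨s01, n01⟩ := key _ _ _ _ hz0 hz1 (l.strictMono (show (0:ℕ) < 1 by omega))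
  obtain ⟨s12, n12⟩ := key _ _ _ _ hz1 hz2 (l.strictMono (show (1:ℕ) < 2 by omega))
  have s2 : m t ⤳ z2 := by
    obtain ⟨w, -, hw⟩ := hz2.mem
    rw [specializes_iff_mem_closure, ← hw]
    exact w.2
  obtain ⟨R, _, _, _, j, _, hj0, hjf⟩ := exists_chart f z0
  have hsub : ∀ t', t' = t := fun t' => Subsingleton.elim (α := PrimeSpectrum M) t' t
  obtain ⟨r, hr⟩ := exists_lift_chart f j hjf m hm z0 hj0
    (fun t' => by rw [hsub t']; exact (s2.trans s12).trans s01)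
  have ho := j.isOpenEmbedding.isOpen_range
  have hj1 := s01.mem_open ho hj0
  have hj2 := s12.mem_open ho hj1
  obtain ⟨q0, rfl⟩ := hj0
  obtain ⟨q1, rfl⟩ := hj1
  obtain ⟨q2, rfl⟩ := hj2
  have hi := j.isOpenEmbedding.isInducing
  have c01 := hi.specializes_iff.mp s01
  have c12 := hi.specializes_iff.mp s12
  have c2 : (Spec.map (CommRingCat.ofHom r.toRingHom) t) ⤳ q2 := by
    apply hi.specializes_iff.mp
    have : j (Spec.map (CommRingCat.ofHom r.toRingHom) t) = m t := by
      rw [← hr]; simp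
    rw [this]; exact s2
  have d01 : LE.le (α := PrimeSpectrum R) q1 q0 := (PrimeSpectrum.le_iff_specializes _ _).mpr c01
  have d12 : LE.le (α := PrimeSpectrum R) q2 q1 := (PrimeSpectrum.le_iff_specializes _ _).mpr c12
  have d2 : LE.le (α := PrimeSpectrum R) (Spec.map (CommRingCat.ofHom r.toRingHom) t) q2 :=
    (PrimeSpectrum.le_iff_specializes _ _).mpr c2
  have d2' : RingHom.ker r ≤ (q2 : PrimeSpectrum R).asIdeal := by
    have := spec_field_apply r.toRingHom t
    exact this.symm.le.trans d2
  refine no_chain_of_trdeg_le_one r htr q2 q1 q0 d2' (lt_of_le_of_ne d12 ?_)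
    (lt_of_le_of_ne d01 ?_)
  · intro e; exact n12 (congrArg j e)
  · intro e; exact n01 (congrArg j e)

lemma one_le_dim {X : Type u} [TopologicalSpace X] (C : Set X) (hC : IsIrreducible C)
    (a b : X) (ha : IsClosed {a}) (haC : a ∈ C) (hbC : b ∈ C) (hab : b ≠ a) :
    1 ≤ topologicalKrullDim C := by
  have : IrreducibleSpace C := isIrreducible_iff_irreducibleSpace.mp hC
  let Z0 : TopologicalSpace.IrreducibleCloseds C :=
    ⟨{⟨a, haC⟩}, isIrreducible_singleton, by
      convert ha.preimage (continuous_subtype_val (p := (· ∈ C)))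
      ext z; simp [Subtype.ext_iff]⟩
  let Z1 : TopologicalSpace.IrreducibleCloseds C :=
    ⟨Set.univ, IrreducibleSpace.isIrreducible_univ _, isClosed_univ⟩
  have hlt : Z0 < Z1 := by
    refine lt_of_le_of_ne (fun z _ => Set.mem_univ z) fun e => hab ?_
    have : (⟨b, hbC⟩ : C) ∈ Z0 := by rw [e]; exact Set.mem_univ _
    exact congrArg Subtype.val (show (⟨b, hbC⟩ : C) = ⟨a, haC⟩ from this)
  have hs : StrictMono (![Z0, Z1] : Fin (1 + 1) → _) := by
    refine Fin.strictMono_iff_lt_succ.mpr fun i => ?_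
    fin_cases i
    exact hlt
  exact_mod_cast Order.LTSeries.length_le_krullDim (LTSeries.mk 1 _ hs)

lemma exists_common_curve {k : Type u} [Field k] [IsAlgClosed k] {Y : Scheme.{u}}
    (h : Y ⟶ Spec (CommRingCat.of k)) [LocallyOfFiniteType h] [IsSeparated h]
    {L : Type u} [Field L] [Algebra k L] (e : Spec (CommRingCat.of L) ⟶ Y)
    (he : e ≫ h = Spec.map (CommRingCat.ofHom (algebraMap k L)))
    {n : ℕ} (i0 : Fin n) (s : Fin n → (Spec (CommRingCat.of k) ⟶ Y)) (hs : ∀ i, s i ≫ h = 𝟙 _)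
    (hes : ∀ i t t', e t ⤳ s i t') :
    ∃ (M : Type u) (_ : Field M) (_ : Algebra k M) (m : Spec (CommRingCat.of M) ⟶ Y),
      Algebra.trdeg k M ≤ 1 ∧ m ≫ h = Spec.map (CommRingCat.ofHom (algebraMap k M)) ∧
      ∀ i t t', m t ⤳ s i t' := by
  have pt : Spec (CommRingCat.of k) := (⊥ : PrimeSpectrum k)
  have ptL : Spec (CommRingCat.of L) := (⊥ : PrimeSpectrum L)
  have hsub : ∀ t' : Spec (CommRingCat.of k), t' = pt :=
    fun t' => Subsingleton.elim (α := PrimeSpectrum k) t' pt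
  have hk : Spec.map (CommRingCat.ofHom (algebraMap k k)) = 𝟙 (Spec (CommRingCat.of k)) :=
    Spec.map_id _
  choose R hR1 hR2 hR3 j hj1 hj2 hj3 using fun i => exists_chart h (s i pt)
  choose rL hrL using fun i => exists_lift_chart h (j i) (hj3 i) e he (s i pt) (hj2 i)
    (fun t => hes i t pt)
  choose rk hrk using fun i => exists_lift_chart h (j i) (hj3 i) (s i) ((hs i).trans hk.symm)
    (s i pt) (hj2 i) (fun t => by rw [hsub t])
  have hker : ∀ i (a : R i), rL i a = 0 → rk i a = 0 := by
    intro i a ha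
    have hi := (j i).isOpenEmbedding.isInducing
    have c : (Spec.map (CommRingCat.ofHom (rL i).toRingHom) ptL) ⤳
        (Spec.map (CommRingCat.ofHom (rk i).toRingHom) pt) := by
      apply hi.specializes_iff.mp
      rw [← Scheme.Hom.comp_apply, ← Scheme.Hom.comp_apply, hrL, hrk]
      exact hes i _ _
    have d := (PrimeSpectrum.le_iff_specializes _ _).mpr c
    have d' := (spec_field_apply (rL i).toRingHom ptL).symm.le.trans
      (le_trans d (spec_field_apply (rk i).toRingHom pt).le)
    exact d' ha
  let A : Fin n → Subalgebra k L := fun i => (rL i).range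
  have hA : ∀ i, (A i).FG := fun i => by
    have := (hR3 i).1
    change (rL i).range.FG
    rw [← Algebra.map_top]
    exact this.map _
  have hφ : ∀ i, ∃ φ : A i →ₐ[k] k, ∀ a, φ ((rL i).rangeRestrict a) = rk i a := by
    intro i
    have hsurj : Function.Surjective (rL i).rangeRestrict := (rL i).rangeRestrict_surjective
    refine ⟨AlgHom.liftOfSurjective (rL i).rangeRestrict hsurj (rk i) ?_, ?_⟩
    · intro a ha
      exact hker i a (congrArg Subtype.val ha)
    · intro a; exact AlgHom.liftOfSurjective_apply _ _ _ _ _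
  choose φ hφ using hφ
  obtain ⟨O, hAO, M, _, _, ψ, htr, hψ⟩ := exists_common_specialization n A hA φ
  let τ : ∀ i, R i →ₐ[k] O := fun i => (Subalgebra.inclusion (hAO i)).comp (rL i).rangeRestrict
  let T : ∀ i, Spec (CommRingCat.of O) ⟶ Y := fun i =>
    Spec.map (CommRingCat.ofHom (τ i).toRingHom) ≫ j i
  let ι : Spec (CommRingCat.of L) ⟶ Spec (CommRingCat.of O) :=
    Spec.map (CommRingCat.ofHom O.val.toRingHom)
  have hdom : IsDominant ι := by
    constructor
    exact (PrimeSpectrum.denseRange_comap_iff_ker_le_nilRadical O.val.toRingHom).mpr (by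
      rw [(RingHom.injective_iff_ker_eq_bot _).mp Subtype.val_injective]; exact bot_le)
  have hιT : ∀ i, ι ≫ T i = e := by
    intro i
    rw [← hrL i]
    change Spec.map _ ≫ Spec.map _ ≫ j i = _
    rw [← Category.assoc, ← Spec.map_comp]
    rfl
  have hTh : ∀ i, T i ≫ h = Spec.map (CommRingCat.ofHom (algebraMap k O)) := by
    intro i
    change (Spec.map _ ≫ j i) ≫ h = _
    rw [Category.assoc, hj3, ← Spec.map_comp]
    congr 1
    ext a
    exact congrArg Subtype.val ((τ i).commutes a)
  have hTT : ∀ i, T i = T i0 := by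
    intro i
    have : IsReduced (Spec (CommRingCat.of O)) := inferInstance
    exact ext_of_isDominant_of_isSeparated h ((hTh i).trans (hTh i0).symm) ι
      ((hιT i).trans (hιT i0).symm)
  refine ⟨M, inferInstance, inferInstance, Spec.map (CommRingCat.ofHom ψ.toRingHom) ≫ T i0, htr,
    ?_, ?_⟩
  · rw [Category.assoc, hTh, ← Spec.map_comp]
    congr 1
    ext a
    exact ψ.commutes a
  · intro i t t'
    rw [← hTT i]
    have e1 : Spec.map (CommRingCat.ofHom ψ.toRingHom) ≫ T i =
        Spec.map (CommRingCat.ofHom (ψ.comp (τ i)).toRingHom) ≫ j i := by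
      change Spec.map _ ≫ Spec.map _ ≫ j i = _
      rw [← Category.assoc, ← Spec.map_comp]
      rfl
    rw [e1, ← hrk i, Scheme.Hom.comp_apply, Scheme.Hom.comp_apply]
    refine Specializes.map ?_ (j i).continuous
    refine (PrimeSpectrum.le_iff_specializes _ _).mp ?_
    refine le_trans (α := Ideal (R i)) (spec_field_apply (ψ.comp (τ i)).toRingHom t).le ?_
    refine le_trans ?_ (spec_field_apply (rk i).toRingHom t').symm.le
    intro a ha
    have := hψ i ((rL i).rangeRestrict a) ha
    rw [hφ] at this
    exact this

lemma exists_component_in {α : Type*} [TopologicalSpace α] (A s : Set α) (hsA : s ⊆ A)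
    (hs : IsIrreducible s) : ∃ Z, IsIrreducibleComponentIn A Z ∧ s ⊆ Z := by
  obtain ⟨m, hsm, hm⟩ := zorn_subset_nonempty { t : Set α | t ⊆ A ∧ IsPreirreducible t }
      (fun c hc hcc _ =>
        ⟨⋃₀ c, ⟨Set.sUnion_subset fun t ht => (hc ht).1,
          fun u v hu hv ⟨y, hy, hyu⟩ ⟨x, hx, hxv⟩ =>
          let ⟨p, hpc, hyp⟩ := Set.mem_sUnion.1 hy
          let ⟨q, hqc, hxq⟩ := Set.mem_sUnion.1 hx
          Or.casesOn (hcc.total hpc hqc)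
            (fun hpq : p ⊆ q =>
              let ⟨x, hxp, hxuv⟩ := (hc hqc).2 u v hu hv ⟨y, hpq hyp, hyu⟩ ⟨x, hxq, hxv⟩
              ⟨x, Set.mem_sUnion_of_mem hxp hqc, hxuv⟩)
            fun hqp : q ⊆ p =>
            let ⟨x, hxp, hxuv⟩ := (hc hpc).2 u v hu hv ⟨y, hyp, hyu⟩ ⟨x, hqp hxq, hxv⟩
            ⟨x, Set.mem_sUnion_of_mem hxp hpc, hxuv⟩⟩,
          fun _ hxc => Set.subset_sUnion_of_mem hxc⟩)
      s ⟨hsA, hs.2⟩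
  exact ⟨m, ⟨hm.prop.1, ⟨hs.1.mono hsm, hm.prop.2⟩,
    fun t htA ht hmt => (hm.eq_of_subset ⟨htA, ht.2⟩ hmt).symm⟩, hsm⟩

lemma exists_ne_of_dim {X : Type u} [TopologicalSpace X] (hdim : 1 ≤ topologicalKrullDim X)
    (a : X) : ∃ b, b ≠ a := by
  by_contra hcon
  push Not at hcon
  have : Subsingleton X := ⟨fun b c => (hcon b).trans (hcon c).symm⟩
  have h0 := topologicalKrullDim_zero_of_discreteTopology X
  exact absurd (hdim.trans h0) (by norm_num)


/-- **Bertini–Charles–Poonen, points in one geometric component**: if the canonical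
lifts of the `K̄`-points `x̄ᵢ` to `X_K̄` all lie in a single irreducible component of
`|X_K̄|`, then there is a closed irreducible curve `C ⊆ |X|` through the images of the
`x̄ᵢ` such that the lifted points all lie in a single irreducible component of `p⁻¹(C)`. -/
theorem curve_through_points_one_component
    (K Kbar : Type u) [Field K] [Field Kbar] [Algebra K Kbar] [IsAlgClosure K Kbar]
    (X : Scheme.{u}) (f : X ⟶ Spec (CommRingCat.of K))
    [QuasiCompact f] [LocallyOfFiniteType f] [IsSeparated f]
    [IrreducibleSpace X] (hdim : 1 ≤ topologicalKrullDim X)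
    (n : ℕ) (x : Fin n → (Spec (CommRingCat.of Kbar) ⟶ X))
    (hx : ∀ i, x i ≫ f = Spec.map (CommRingCat.ofHom (algebraMap K Kbar))) :
    let g : Spec (CommRingCat.of Kbar) ⟶ Spec (CommRingCat.of K) :=
      Spec.map (CommRingCat.ofHom (algebraMap K Kbar))
    let XK : Scheme.{u} := pullback f g
    let p : XK → X := (pullback.fst f g).base
    -- the canonical lift of `x i` to a `K̄`-point of `X_K̄`
    let x' : Fin n → (Spec (CommRingCat.of Kbar) ⟶ XK) := fun i =>
      pullback.lift (x i) (𝟙 (Spec (CommRingCat.of Kbar)))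
        ((hx i).trans (Category.id_comp g).symm)
    (∃ W ∈ irreducibleComponents XK,
        ∀ (i : Fin n) (y : Spec (CommRingCat.of Kbar)), (x' i).base y ∈ W) →
    ∃ C : Set X, IsClosed C ∧ IsIrreducible C ∧ topologicalKrullDim C = 1 ∧
      (∀ (i : Fin n) (y : Spec (CommRingCat.of Kbar)), (x i).base y ∈ C) ∧
      ∃ Z : Set XK, IsIrreducibleComponentIn (p ⁻¹' C) Z ∧
        ∀ (i : Fin n) (y : Spec (CommRingCat.of Kbar)), (x' i).base y ∈ Z := by

  intro g XK p x' hW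
  obtain ⟨W, hW, hxW⟩ := hW
  have : IsAlgClosed Kbar := IsAlgClosure.isAlgClosed K
  have halg : Algebra.IsAlgebraic K Kbar := IsAlgClosure.isAlgebraic
  have : Algebra.IsIntegral K Kbar := inferInstance
  have hgint : IsIntegralHom g := by
    refine IsIntegralHom.SpecMap_iff.mpr ?_
    exact algebraMap_isIntegral_iff.mpr inferInstance
  have hgflat : Flat g := by
    refine HasRingHomProperty.Spec_iff.mpr ?_
    change (algebraMap K Kbar).Flat
    rw [RingHom.flat_algebraMap_iff]
    infer_instance
  let P : XK ⟶ X := pullback.fst f g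
  let h : XK ⟶ Spec (CommRingCat.of Kbar) := pullback.snd f g
  have hPint : IsIntegralHom P := inferInstanceAs (IsIntegralHom (pullback.fst f g))
  have hPflat : Flat P := inferInstanceAs (Flat (pullback.fst f g))
  have hlft : LocallyOfFiniteType h := inferInstanceAs (LocallyOfFiniteType (pullback.snd f g))
  have hsep : IsSeparated h := inferInstanceAs (IsSeparated (pullback.snd f g))
  have hcond : P ≫ f = h ≫ g := pullback.condition
  have hPclosed : IsClosedMap P := P.isClosedMap
  have hWc : IsClosed W := isClosed_of_mem_irreducibleComponents W hW
  have hWi : IsIrreducible W := hW.1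
  obtain ⟨ξ, hξ⟩ : ∃ ξ : XK, IsGenericPoint ξ W := ⟨_, hWi.isGenericPoint_genericPoint hWc⟩
  have hPξ : ∀ z, P ξ ⤳ z := by
    intro z
    obtain ⟨ξ', h1, h2⟩ := Flat.generalizingMap P (genericPoint_specializes (P ξ))
    have h3 : W ⊆ closure {ξ'} := by
      rw [← hξ.def]
      exact closure_minimal (by simpa using h1.mem_closure) isClosed_closure
    have h4 : closure {ξ'} ⊆ W := hW.2 isIrreducible_singleton.closure h3
    have h5 : IsGenericPoint ξ' W := subset_antisymm h4 h3
    rw [hξ.eq h5, h2]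
    exact genericPoint_specializes z
  have hjac : JacobsonSpace XK := LocallyOfFiniteType.jacobsonSpace h
  obtain ⟨y1, hy1W, hy1'⟩ := nonempty_inter_closedPoints hWi.1 hWc.isLocallyClosed
  have hy1 : IsClosed {y1} := hy1'
  have hPy1 : IsClosed {P y1} := by
    have := hPclosed _ hy1
    rwa [Set.image_singleton] at this
  have hne : P ξ ≠ P y1 := by
    intro e
    obtain ⟨b, hb⟩ := exists_ne_of_dim hdim (P y1)
    have := hPξ b
    rw [e, specializes_iff_mem_closure, hPy1.closure_eq] at this
    exact hb this
  obtain ⟨y2, ⟨hy2W, hy2n⟩, hy2'⟩ := nonempty_inter_closedPoints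
    (Z := W ∩ P ⁻¹' {P y1}ᶜ) ⟨ξ, hξ.mem, hne⟩
    (hWc.isLocallyClosed.inter (hPy1.isOpen_compl.preimage P.continuous).isLocallyClosed)
  have hy2 : IsClosed {y2} := hy2'
  let e : Spec (CommRingCat.of (XK.residueField ξ)) ⟶ XK := XK.fromSpecResidueField ξ
  let ρ : CommRingCat.of Kbar ⟶ CommRingCat.of (XK.residueField ξ) := Spec.preimage (e ≫ h)
  letI : Algebra Kbar (XK.residueField ξ) := ρ.hom.toAlgebra
  have he : e ≫ h = Spec.map (CommRingCat.ofHom (algebraMap Kbar (XK.residueField ξ))) :=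
    (Spec.map_preimage _).symm
  have het : ∀ t, e t = ξ := fun t => Scheme.fromSpecResidueField_apply ξ t
  let s : Fin (n + 2) → (Spec (CommRingCat.of Kbar) ⟶ XK) :=
    Fin.cons (pointOfClosedPoint h y1 hy1) (Fin.cons (pointOfClosedPoint h y2 hy2) x')
  have hs : ∀ i, s i ≫ h = 𝟙 _ := by
    intro i
    refine Fin.cases ?_ (fun i => Fin.cases ?_ (fun i => ?_) i) i
    · exact pointOfClosedPoint_comp h y1 hy1
    · exact pointOfClosedPoint_comp h y2 hy2
    · exact pullback.lift_snd _ _ _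
  have hsW : ∀ i t, s i t ∈ W := by
    intro i t
    refine Fin.cases ?_ (fun i => Fin.cases ?_ (fun i => ?_) i) i
    · change pointOfClosedPoint h y1 hy1 t ∈ W
      rw [pointOfClosedPoint_apply]; exact hy1W
    · change pointOfClosedPoint h y2 hy2 t ∈ W
      rw [pointOfClosedPoint_apply]; exact hy2W
    · exact hxW i t
  obtain ⟨M, _, _, m, htr, hm, hms⟩ := exists_common_curve h e he (0 : Fin (n + 2)) s hs
    (fun i t t' => by rw [het]; exact hξ.specializes (hsW i t'))
  letI : Algebra K M := ((algebraMap Kbar M).comp (algebraMap K Kbar)).toAlgebra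
  have : IsScalarTower K Kbar M := IsScalarTower.of_algebraMap_eq fun _ => rfl
  have htrK : Algebra.trdeg K M ≤ 1 := by
    rw [← trdeg_add_eq K Kbar (A := M), trdeg_eq_zero, zero_add]
    exact htr
  have hmf : (m ≫ P) ≫ f = Spec.map (CommRingCat.ofHom (algebraMap K M)) := by
    rw [Category.assoc, hcond, ← Category.assoc, hm, ← Spec.map_comp]
    rfl
  let t : Spec (CommRingCat.of M) := (⊥ : PrimeSpectrum M)
  let pt : Spec (CommRingCat.of Kbar) := (⊥ : PrimeSpectrum Kbar)
  have hsp : ∀ i t', P (m t) ⤳ P (s i t') := fun i t' => (hms i t t').map P.continuous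
  have hmP : (m ≫ P) t = P (m t) := Scheme.Hom.comp_apply _ _ _
  have hle := curve_dim_le_one f htrK (m ≫ P) hmf t
  rw [hmP] at hle
  have hy1C : P y1 ∈ closure {P (m t)} := by
    have := (hsp 0 pt).mem_closure
    change P (pointOfClosedPoint h y1 hy1 pt) ∈ _ at this
    rwa [pointOfClosedPoint_apply] at this
  have hy2C : P y2 ∈ closure {P (m t)} := by
    have := (hsp 1 pt).mem_closure
    change P (pointOfClosedPoint h y2 hy2 pt) ∈ _ at this
    rwa [pointOfClosedPoint_apply] at this
  obtain ⟨Z, hZ, hmZ⟩ := exists_component_in (P ⁻¹' closure {P (m t)}) (closure {m t})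
    (closure_minimal (by simpa using subset_closure (Set.mem_singleton _))
      (isClosed_closure.preimage P.continuous)) isIrreducible_singleton.closure
  refine ⟨closure {P (m t)}, isClosed_closure, isIrreducible_singleton.closure,
    le_antisymm hle (one_le_dim _ isIrreducible_singleton.closure _ _ hPy1 hy1C hy2C hy2n), ?_,
    Z, hZ, fun i y => hmZ (hms i.succ.succ t y).mem_closure⟩
  intro i y
  have h1 := (hsp i.succ.succ y).mem_closure
  have h2 : P (x' i y) = x i y := by
    rw [← Scheme.Hom.comp_apply]
    have h3 : x' i ≫ P = x i := pullback.lift_fst _ _ _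
    rw [h3]
  exact h2 ▸ h1
end

section
/- Let K be a field with algebraic closure K̄, and let X be a scheme of finite type over K (not necessarily separated) whose underlying topological space is irreducible and has Krull dimension at least 1, and let x̄_1, x̄_0 : Spec K̄ → X be two K̄-points of X over K. Then there exist a positive integer r and closed irreducible subsets C_1, …, C_r of |X|, each of Krull dimension 1 as a topological space, such that the image of x̄_1 lies in C_1, the image of x̄_0 lies in C_r, and for each i = 1, …, r−1 the intersection C_i ∩ C_{i+1} contains a closed point of X. -/
section
section
open Polynomial

/-- splitting a monic polynomial according to a colouring of points -/
lemma split_colour {R K Pt : Type*} [CommRing R] [IsDomain R] [IsNoetherianRing R] [Field K]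
    (e : Pt → (R[X] →+* K)) (c : Pt → Prop) (D : Pt → Prop) (n : ℕ) :
    ∀ F : R[X], F.Monic → F.natDegree ≤ n →
    (∀ φ : R[X], Irreducible φ → φ ∣ F → ∀ p q, D p → D q → e p φ = 0 → e q φ = 0 → c p → c q) →
    ∃ G H : R[X], G.Monic ∧ H.Monic ∧ F = G * H ∧ (∀ p, D p → e p G = 0 → c p) ∧
      (∀ p, D p → e p H = 0 → ¬ c p) := by
  classical
  induction n with
  | zero =>
    intro F hF hn _
    have : F = 1 := hF.natDegree_eq_zero.mp (by omega)
    subst this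
    exact ⟨1, 1, monic_one, monic_one, by simp, by simp, by simp⟩
  | succ n ih =>
    intro F hF hn hc
    by_cases hu : F = 1
    · subst hu
      exact ⟨1, 1, monic_one, monic_one, by simp, by simp, by simp⟩
    have hnu : ¬ IsUnit F := fun h => hu (hF.eq_one_of_isUnit h)
    obtain ⟨φ, hφ, F', rfl⟩ := WfDvdMonoid.exists_irreducible_factor hnu hF.ne_zero
    have hl : φ.leadingCoeff * F'.leadingCoeff = 1 := by
      rw [← leadingCoeff_mul]; exact hF
    set u : R[X] := C F'.leadingCoeff with hu'
    set v : R[X] := C φ.leadingCoeff with hv'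
    have huv : u * v = 1 := by rw [hu', hv', ← C_mul, mul_comm, hl, C_1]
    have hm1 : (u * φ).Monic := by
      simp [Monic, hu', leadingCoeff_mul, mul_comm, hl]
    have hm2 : (v * F').Monic := by
      simp [Monic, hv', leadingCoeff_mul, hl]
    have hprod : φ * F' = (u * φ) * (v * F') := by linear_combination (- φ * F') * huv
    have hdeg : 0 < (u * φ).natDegree := by
      by_contra h
      have h1 := hm1.natDegree_eq_zero.mp (by omega)
      exact hφ.not_isUnit (IsUnit.of_mul_eq_one u (by rw [mul_comm]; exact h1))
    have hsum : (φ * F').natDegree = (u * φ).natDegree + (v * F').natDegree := by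
      rw [hprod, hm1.natDegree_mul hm2]
    obtain ⟨G, H, hG, hH, hgHy, hGc, hHc⟩ := ih (v * F') hm2 (by omega) (by
      intro ψ hψ hd
      exact hc ψ hψ (hd.trans ⟨u * φ, by rw [hprod]; ring⟩))
    have key : ∀ p, e p (u * φ) = 0 → e p φ = 0 := by
      intro p hp
      have : φ = v * (u * φ) := by linear_combination (-φ) * huv
      rw [this, map_mul, hp, mul_zero]
    by_cases hex : ∃ p, D p ∧ e p φ = 0 ∧ c p
    · obtain ⟨p0, hD0, h0, hc0⟩ := hex
      refine ⟨u * φ * G, H, hm1.mul hG, hH, by rw [hprod, hgHy]; ring, ?_, hHc⟩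
      intro p hp h
      rw [map_mul, mul_eq_zero] at h
      rcases h with h | h
      · exact hc φ hφ (Dvd.intro _ rfl) p0 p hD0 hp h0 (key p h) hc0
      · exact hGc p hp h
    · push Not at hex
      refine ⟨G, u * φ * H, hG, hm1.mul hH, by rw [hprod, hgHy]; ring, hGc, ?_⟩
      intro p hp h
      rw [map_mul, mul_eq_zero] at h
      rcases h with h | h
      · exact hex p hp (key p h)
      · exact hHc p hp h

lemma uniq_split {K : Type*} [Field K] [IsAlgClosed K] (c : K → Prop) {g h g' h' : K[X]}
    (hg : g.Monic) (hg' : g'.Monic) (e : g * h = g' * h')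
    (h1 : ∀ x, g.eval x = 0 → c x) (h2 : ∀ x, h.eval x = 0 → ¬ c x)
    (h3 : ∀ x, g'.eval x = 0 → c x) (h4 : ∀ x, h'.eval x = 0 → ¬ c x) : g = g' := by
  have cop : ∀ a b : K[X], a ≠ 0 → (∀ x, a.eval x = 0 → c x) → (∀ x, b.eval x = 0 → ¬ c x) →
      IsCoprime a b := by
    intro a b ha hac hbc
    refine isCoprime_of_dvd _ _ (fun h => ha h.1) ?_
    rintro z hz hz0 ⟨a', rfl⟩ ⟨b', rfl⟩
    obtain ⟨x, hx⟩ := IsAlgClosed.exists_root z (fun h => hz (by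
      exact isUnit_iff_degree_eq_zero.mpr h))
    exact hbc x (by simp [hx.eq_zero]) (hac x (by simp [hx.eq_zero]))
  have d1 : g ∣ g' := (cop g h' hg.ne_zero h1 h4).dvd_of_dvd_mul_right (e ▸ Dvd.intro _ rfl)
  have d2 : g' ∣ g := (cop g' h hg'.ne_zero h3 h2).dvd_of_dvd_mul_right (e ▸ Dvd.intro _ rfl)
  exact eq_of_monic_of_associated hg hg' (associated_of_dvd_dvd d1 d2)

lemma swap_coeff_coeff {R : Type*} [CommRing R] (p : R[X][X]) (i j : ℕ) :
    ((Bivariate.swap p).coeff i).coeff j = (p.coeff j).coeff i := by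
  induction p using Polynomial.induction_on' with
  | add p q hp hq => simp [hp, hq]
  | monomial n f =>
    induction f using Polynomial.induction_on' with
    | add p q hp hq => simp [hp, hq]
    | monomial m r =>
      rw [Bivariate.swap_monomial_monomial]
      simp only [coeff_monomial]
      split_ifs <;> simp_all [coeff_monomial]

lemma natDegree_coeff_le_of_dvd {R : Type*} [CommRing R] [IsDomain R] {F G : R[X][X]} (hF : F ≠ 0)
    (hd : G ∣ F) (N : ℕ) (hN : ∀ i, (F.coeff i).natDegree ≤ N) (i : ℕ) :
    (G.coeff i).natDegree ≤ N := by
  have h1 : (Bivariate.swap F).natDegree ≤ N := by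
    rw [natDegree_le_iff_coeff_eq_zero]
    intro k hk
    ext j
    rw [swap_coeff_coeff]
    exact coeff_eq_zero_of_natDegree_lt ((hN j).trans_lt hk)
  have h2 : (Bivariate.swap G).natDegree ≤ (Bivariate.swap F).natDegree := by
    apply natDegree_le_of_dvd (_root_.map_dvd (Bivariate.swap (R := R)) hd)
    simpa using hF
  rw [natDegree_le_iff_coeff_eq_zero]
  intro k hk
  rw [← swap_coeff_coeff, coeff_eq_zero_of_natDegree_lt (p := Bivariate.swap G) (by omega), coeff_zero]

section core
variable {K ι : Type*} [Field K]

/-- evaluation of an element of `K[t][s][z]` at a point -/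
noncomputable def evT (a : K) (b : ι → K) (ζ : K) : (MvPolynomial ι K)[X][X] →+* K :=
  eval₂RingHom (eval₂RingHom (MvPolynomial.eval b) a) ζ

noncomputable def specB (b : ι → K) : (MvPolynomial ι K)[X][X] →+* K[X][X] :=
  mapRingHom (mapRingHom (MvPolynomial.eval b))

noncomputable def specA (a : K) : (MvPolynomial ι K)[X][X] →+* (MvPolynomial ι K)[X] :=
  mapRingHom (evalRingHom (MvPolynomial.C a))

noncomputable def evL (a ζ : K) : K[X][X] →+* K := eval₂RingHom (evalRingHom a) ζ
noncomputable def evH (b : ι → K) (ζ : K) : (MvPolynomial ι K)[X] →+* K :=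
  eval₂RingHom (MvPolynomial.eval b) ζ

lemma evL_specB (a ζ : K) (b : ι → K) : (evL a ζ).comp (specB b) = evT a b ζ := by
  ext <;> simp [evL, specB, evT]

lemma evH_specA (a ζ : K) (b : ι → K) : (evH b ζ).comp (specA a) = evT a b ζ := by
  ext <;> simp [evH, specA, evT]

lemma specB_surj (b : ι → K) : Function.Surjective (specB b) := by
  apply map_surjective
  apply map_surjective
  intro x
  exact ⟨MvPolynomial.C x, by simp⟩

lemma specA_surj (a : K) : Function.Surjective (specA (ι := ι) a) := by
  apply map_surjective
  intro x
  exact ⟨Polynomial.C x, by simp⟩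

lemma ev_comm (a : K) (b : ι → K) : (evalRingHom a).comp (mapRingHom (MvPolynomial.eval b)) =
    (MvPolynomial.eval b).comp (evalRingHom (MvPolynomial.C a)) := by
  ext <;> simp

lemma not_le_span {R : Type*} [CommRing R] [IsDomain R] {F : R[X]} (hF : F.Monic)
    (hirr : Irreducible F) {u : R} (hu : u ≠ 0) : C u ∉ Ideal.span {F} := by
  rw [Ideal.mem_span_singleton]
  intro hd
  have := natDegree_le_of_dvd hd (by simpa using hu)
  rw [natDegree_C] at this
  have := hF.natDegree_eq_zero.mp (by omega)
  exact hirr.not_isUnit (this ▸ isUnit_one)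

theorem core [IsAlgClosed K] [Finite ι] [Nonempty ι] (F : (MvPolynomial ι K)[X][X])
    (hF : F.Monic) (hirr : Irreducible F)
    (h : (MvPolynomial ι K)[X]) (hh : h ≠ 0) :
    ∃ h' : (MvPolynomial ι K)[X], h' ≠ 0 ∧ ∀ (c : K → (ι → K) → K → Prop),
    (∀ P : Ideal (MvPolynomial ι K)[X][X], P.IsPrime → F ∈ P → ¬ (P ≤ Ideal.span {F}) →
      ∀ a b ζ a' b' ζ', P ≤ RingHom.ker (evT a b ζ) → P ≤ RingHom.ker (evT a' b' ζ') →
        evT a b ζ (C h) ≠ 0 → evT a' b' ζ' (C h) ≠ 0 → c a b ζ → c a' b' ζ') →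
    ∀ a b ζ a' b' ζ', evT a b ζ F = 0 → evT a' b' ζ' F = 0 →
      evT a b ζ (C h') ≠ 0 → evT a' b' ζ' (C h') ≠ 0 → c a b ζ → c a' b' ζ' := by
  classical
  have : Infinite K := IsAlgClosed.instInfinite
  -- degree bound
  obtain ⟨N, hN⟩ : ∃ N, ∀ i, (F.coeff i).natDegree ≤ N := by
    refine ⟨F.support.sup (fun i => (F.coeff i).natDegree), fun i => ?_⟩
    by_cases hi : i ∈ F.support
    · exact Finset.le_sup (f := fun i => (F.coeff i).natDegree) hi
    · rw [notMem_support_iff.mp hi]; simp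
  -- interpolation nodes
  obtain ⟨s, hs, hcard⟩ : ∃ s : Finset K, (∀ a ∈ s, h.eval (MvPolynomial.C a) ≠ 0) ∧
      s.card = N + 1 := by
    have hfin : {a : K | h.eval (MvPolynomial.C a) = 0}.Finite := by
      refine Set.Finite.of_injOn (f := (MvPolynomial.C : K → MvPolynomial ι K))
        (t := (h.roots.toFinset : Set (MvPolynomial ι K))) ?_ ?_ (Finset.finite_toSet _)
      · intro a ha
        simpa [hh] using ha
      · exact (MvPolynomial.C_injective ι K).injOn
    obtain ⟨s, hs, hc⟩ := hfin.infinite_compl.exists_subset_card_eq (N + 1)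
    exact ⟨s, fun a ha => hs ha, hc⟩
  let h1 : MvPolynomial ι K := ∏ a ∈ s, h.eval (MvPolynomial.C a)
  have h1ne : h1 ≠ 0 := Finset.prod_ne_zero_iff.mpr hs
  refine ⟨h * C h1, mul_ne_zero hh (by simpa using h1ne), ?_⟩
  intro c hc
  -- value of `h`
  let hv : K → (ι → K) → K := fun a b => MvPolynomial.eval b (h.eval (MvPolynomial.C a))
  have hT : ∀ a b ζ, evT a b ζ (C h) = hv a b := by
    intro a b ζ
    rw [← evH_specA]
    simp [evH, specA, hv]
  -- splitting along lines
  have hL : ∀ b : ι → K, ∃ G H : K[X][X], G.Monic ∧ H.Monic ∧ specB b F = G * H ∧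
      (∀ p : K × K, hv p.1 b ≠ 0 → evL p.1 p.2 G = 0 → c p.1 b p.2) ∧
      (∀ p : K × K, hv p.1 b ≠ 0 → evL p.1 p.2 H = 0 → ¬ c p.1 b p.2) := by
    intro b
    refine split_colour (fun p : K × K => evL p.1 p.2) (fun p => c p.1 b p.2)
      (fun p => hv p.1 b ≠ 0) _ (specB b F) (hF.map _) le_rfl ?_
    intro φ hφ hd p q hp hq hpφ hqφ
    have hprime : (Ideal.span {φ}).IsPrime :=
      (Ideal.span_singleton_prime hφ.ne_zero).mpr hφ.prime
    have hle : ∀ p : K × K, evL p.1 p.2 φ = 0 →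
        Ideal.comap (specB b) (Ideal.span {φ}) ≤ RingHom.ker (evT p.1 b p.2) := by
      intro p hp x hx
      rw [RingHom.mem_ker, ← evL_specB, RingHom.comp_apply]
      obtain ⟨y, hy⟩ := Ideal.mem_span_singleton.mp (Ideal.mem_comap.mp hx)
      rw [hy, map_mul, hp, zero_mul]
    refine hc (Ideal.comap (specB b) (Ideal.span {φ})) (hprime.comap _)
      (Ideal.mem_comap.mpr (Ideal.mem_span_singleton.mpr hd)) ?_ p.1 b p.2 q.1 b q.2
      (hle p hpφ) (hle q hqφ) (by rw [hT]; exact hp) (by rw [hT]; exact hq)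
    intro hle
    obtain ⟨i⟩ := ‹Nonempty ι›
    refine not_le_span hF hirr (u := C (MvPolynomial.X i - MvPolynomial.C (b i))) ?_ (hle ?_)
    · rw [Ne, C_eq_zero]
      intro h0
      have := congrArg (MvPolynomial.eval (fun j => b j + 1)) h0
      simp at this
    · rw [Ideal.mem_comap]
      have : specB b (C (C (MvPolynomial.X i - MvPolynomial.C (b i)))) = 0 := by
        simp [specB]
      rw [this]
      exact zero_mem _
  have hH : ∀ a : K, ∃ G H : (MvPolynomial ι K)[X], G.Monic ∧ H.Monic ∧ specA a F = G * H ∧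
      (∀ p : (ι → K) × K, hv a p.1 ≠ 0 → evH p.1 p.2 G = 0 → c a p.1 p.2) ∧
      (∀ p : (ι → K) × K, hv a p.1 ≠ 0 → evH p.1 p.2 H = 0 → ¬ c a p.1 p.2) := by
    intro a
    refine split_colour (fun p : (ι → K) × K => evH p.1 p.2) (fun p => c a p.1 p.2)
      (fun p => hv a p.1 ≠ 0) _ (specA a F) (hF.map _) le_rfl ?_
    intro φ hφ hd p q hp hq hpφ hqφ
    have hprime : (Ideal.span {φ}).IsPrime :=
      (Ideal.span_singleton_prime hφ.ne_zero).mpr hφ.prime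
    have hle : ∀ p : (ι → K) × K, evH p.1 p.2 φ = 0 →
        Ideal.comap (specA a) (Ideal.span {φ}) ≤ RingHom.ker (evT a p.1 p.2) := by
      intro p hp x hx
      rw [RingHom.mem_ker, ← evH_specA, RingHom.comp_apply]
      obtain ⟨y, hy⟩ := Ideal.mem_span_singleton.mp (Ideal.mem_comap.mp hx)
      rw [hy, map_mul, hp, zero_mul]
    refine hc (Ideal.comap (specA a) (Ideal.span {φ})) (hprime.comap _)
      (Ideal.mem_comap.mpr (Ideal.mem_span_singleton.mpr hd)) ?_ a p.1 p.2 a q.1 q.2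
      (hle p hpφ) (hle q hqφ) (by rw [hT]; exact hp) (by rw [hT]; exact hq)
    intro hle
    refine not_le_span hF hirr (u := X - C (MvPolynomial.C a)) (X_sub_C_ne_zero _) (hle ?_)
    rw [Ideal.mem_comap]
    have : specA a (C (X - C (MvPolynomial.C a))) = (0 : (MvPolynomial ι K)[X]) := by
      simp [specA]
    rw [this]
    exact zero_mem _
  choose gLn hLn mgLn mhLn eL cgLn chLn using hL
  choose gHy hHy mgHy mhHy eH cgHy chHy using hH
  -- comparison
  have hmapc : ∀ a b, (specB b F).map (evalRingHom a) = (specA a F).map (MvPolynomial.eval b) := by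
    intro a b
    simp only [specB, specA, coe_mapRingHom, Polynomial.map_map]
    rw [ev_comm]
  have heL : ∀ a ζ (p : K[X][X]), evL a ζ p = (p.map (evalRingHom a)).eval ζ := by
    intro a ζ p; simp [evL, eval_map]
  have heH : ∀ (b : ι → K) ζ (p : (MvPolynomial ι K)[X]),
      evH b ζ p = (p.map (MvPolynomial.eval b)).eval ζ := by
    intro a ζ p; simp [evH, eval_map]
  have cmp : ∀ a b, hv a b ≠ 0 →
      (gLn b).map (evalRingHom a) = (gHy a).map (MvPolynomial.eval b) := by
    intro a b hab
    refine uniq_split (c a b) (h := (hLn b).map (evalRingHom a))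
      (h' := (hHy a).map (MvPolynomial.eval b)) ((mgLn b).map _) ((mgHy a).map _) ?_ ?_ ?_ ?_ ?_
    · rw [← Polynomial.map_mul, ← Polynomial.map_mul, ← eL, ← eH, hmapc]
    · intro x hx; exact cgLn b (a, x) hab (by rw [heL]; exact hx)
    · intro x hx; exact chLn b (a, x) hab (by rw [heL]; exact hx)
    · intro x hx; exact cgHy a (b, x) hab (by rw [heH]; exact hx)
    · intro x hx; exact chHy a (b, x) hab (by rw [heH]; exact hx)
  have cmp' : ∀ a b, hv a b ≠ 0 →
      (hLn b).map (evalRingHom a) = (hHy a).map (MvPolynomial.eval b) := by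
    intro a b hab
    have h1 : (gLn b).map (evalRingHom a) * (hLn b).map (evalRingHom a) =
        (gHy a).map (MvPolynomial.eval b) * (hHy a).map (MvPolynomial.eval b) := by
      rw [← Polynomial.map_mul, ← Polynomial.map_mul, ← eL, ← eH, hmapc]
    rw [cmp a b hab] at h1
    exact mul_left_cancel₀ ((mgHy a).map _).ne_zero h1
  have hNb : ∀ b i, ((specB b F).coeff i).natDegree ≤ N := by
    intro b i
    simp only [specB, coe_mapRingHom, coeff_map]
    exact natDegree_map_le.trans (hN i)
  let interp : (K → (MvPolynomial ι K)[X]) → (MvPolynomial ι K)[X][X] := fun Q =>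
    ∑ a ∈ s, C ((Lagrange.basis s id a).map MvPolynomial.C) * (Q a).map C
  have hinterp : ∀ (Q : K → (MvPolynomial ι K)[X]) (b : ι → K) (p : K[X][X]),
      (∀ i, (p.coeff i).natDegree ≤ N) →
      (∀ a ∈ s, p.map (evalRingHom a) = (Q a).map (MvPolynomial.eval b)) →
      specB b (interp Q) = p := by
    intro Q b p hp hQ
    ext1 i
    have hdeg : (p.coeff i).degree < s.card := by
      rw [hcard]
      exact lt_of_le_of_lt (degree_le_of_natDegree_le (hp i)) (by exact_mod_cast Nat.lt_succ_self N)
    rw [Lagrange.eq_interpolate (s := s) (v := id) (f := p.coeff i) (Function.injective_id.injOn) hdeg]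
    simp only [interp, specB, map_sum, map_mul, finsetSum_coeff, coe_mapRingHom, map_C,
      coeff_C_mul, Lagrange.interpolate_apply]
    refine Finset.sum_congr rfl fun a ha => ?_
    have h2 := congrArg (fun q => q.coeff i) (hQ a ha)
    simp only [coeff_map, coe_evalRingHom] at h2
    simp only [Polynomial.map_map, coeff_map, id, h2]
    rw [mul_comm]
    congr 1
    · simp
    · have : (MvPolynomial.eval b).comp (MvPolynomial.C) = RingHom.id K := by ext; simp
      rw [this, Polynomial.map_id]
  have hb1 : ∀ b, MvPolynomial.eval b h1 ≠ 0 → ∀ a ∈ s, hv a b ≠ 0 := by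
    intro b hb a ha h0
    apply hb
    simp only [h1, map_prod]
    exact Finset.prod_eq_zero ha h0
  have hGb : ∀ b, MvPolynomial.eval b h1 ≠ 0 → specB b (interp gHy) = gLn b := by
    intro b hb
    refine hinterp gHy b (gLn b) ?_ (fun a ha => cmp a b (hb1 b hb a ha))
    exact natDegree_coeff_le_of_dvd (hF.map _).ne_zero ⟨hLn b, eL b⟩ N (hNb b)
  have hHb : ∀ b, MvPolynomial.eval b h1 ≠ 0 → specB b (interp hHy) = hLn b := by
    intro b hb
    refine hinterp hHy b (hLn b) ?_ (fun a ha => cmp' a b (hb1 b hb a ha))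
    exact natDegree_coeff_le_of_dvd (hF.map _).ne_zero ⟨gLn b, (eL b).trans (mul_comm _ _)⟩ N (hNb b)
  have hprod : interp gHy * interp hHy = F := by
    ext1 i
    ext1 j
    refine mul_right_cancel₀ h1ne ?_
    apply MvPolynomial.funext
    intro b
    by_cases hb : MvPolynomial.eval b h1 = 0
    · simp [hb]
    have : specB b (interp gHy * interp hHy) = specB b F := by
      rw [map_mul, hGb b hb, hHb b hb, eL]
    have h3 := congrArg (fun q => (q.coeff i).coeff j) this
    simp only [specB, coe_mapRingHom, coeff_map] at h3
    rw [map_mul, h3, map_mul]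
  have hT' : ∀ a b ζ, evT a b ζ (C (h * C h1)) ≠ 0 → hv a b ≠ 0 ∧ MvPolynomial.eval b h1 ≠ 0 := by
    intro a b ζ h0
    rw [C_mul, map_mul, hT] at h0
    refine ⟨left_ne_zero_of_mul h0, ?_⟩
    have := right_ne_zero_of_mul h0
    simpa [evT] using this
  intro a b ζ a' b' ζ' hf hf' h0 h0' hcab
  obtain ⟨h2, h3⟩ := hT' _ _ _ h0
  obtain ⟨h2', h3'⟩ := hT' _ _ _ h0'
  rcases hirr.isUnit_or_isUnit hprod.symm with hu | hu
  · exfalso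
    have hu2 : IsUnit (evL a ζ (gLn b)) := by
      rw [← hGb b h3]
      exact (hu.map (specB b)).map (evL a ζ)
    refine chLn b (a, ζ) h2 ?_ hcab
    rw [← evL_specB, RingHom.comp_apply, eL, map_mul] at hf
    exact (mul_eq_zero.mp hf).resolve_left hu2.ne_zero
  · have hu2 : IsUnit (evL a' ζ' (hLn b')) := by
      rw [← hHb b' h3']
      exact (hu.map (specB b')).map (evL a' ζ')
    refine cgLn b' (a', ζ') h2' ?_
    rw [← evL_specB, RingHom.comp_apply, eL, map_mul] at hf'
    exact (mul_eq_zero.mp hf').resolve_right hu2.ne_zero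
end core
end

theorem noether2 (K : Type*) {A : Type*} [Field K] [CommRing A] [IsDomain A] [Algebra K A]
    [Algebra.FiniteType K A] (P : Ideal A) [P.IsPrime] (hP : P ≠ ⊥) (hPm : ¬ P.IsMaximal) :
    ∃ n : ℕ, ∃ g : MvPolynomial (Fin (n + 2)) K →ₐ[K] A, Function.Injective g ∧ g.IsIntegral := by
  obtain ⟨s, g, hg, hi⟩ := exists_integral_inj_algHom_of_fg K A
  have hs : 2 ≤ s := by
    by_contra hlt
    have hd : Ring.KrullDimLE 1 (MvPolynomial (Fin s) K) := by
      rw [Ring.krullDimLE_iff]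
      simp only [MvPolynomial.ringKrullDim_of_isNoetherianRing, ringKrullDim_eq_zero_of_field,
        Nat.card_eq_fintype_card, Fintype.card_fin, zero_add]
      exact_mod_cast (by omega : s ≤ 1)
    let _ : Algebra (MvPolynomial (Fin s) K) A := g.toRingHom.toAlgebra
    have : Algebra.IsIntegral (MvPolynomial (Fin s) K) A := ⟨hi⟩
    refine hPm (Ideal.isMaximal_of_isIntegral_of_isMaximal_comap (R := MvPolynomial (Fin s) K) P ?_)
    refine Ideal.isMaximal_of_isPrime_of_ne_bot _ fun h => hP (Ideal.eq_bot_of_comap_eq_bot h)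
  obtain ⟨n, rfl⟩ := Nat.exists_eq_add_of_le' hs
  exact ⟨n, g, hg, hi⟩

theorem height_max_mv (K : Type*) [Field K] : ∀ (n : ℕ) (m : Ideal (MvPolynomial (Fin n) K)),
    m.IsMaximal → (n : ℕ∞) ≤ m.height := by
  intro n
  induction n with
  | zero => simp
  | succ n ih =>
    intro m hm
    let e := (MvPolynomial.finSuccEquiv K n).toRingEquiv
    rw [← e.height_map m]
    have hM : (m.map e).IsMaximal := Ideal.map_isMaximal_of_equiv e
    have h1 : ((m.map e).comap (Polynomial.C)).IsMaximal :=
      Polynomial.isMaximal_comap_C_of_isJacobsonRing _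
    have : (m.map e).LiesOver ((m.map e).comap Polynomial.C) := ⟨rfl⟩
    rw [Polynomial.height_eq_height_add_one ((m.map e).comap Polynomial.C) (m.map e)]
    push_cast
    gcongr
    exact ih _ h1

theorem two_le_height (K : Type*) {A : Type*} [Field K] [CommRing A] [IsDomain A] [Algebra K A]
    [Algebra.FiniteType K A] (P : Ideal A) [P.IsPrime] (hP : P ≠ ⊥) (hPm : ¬ P.IsMaximal)
    (m : Ideal A) (hm : m.IsMaximal) : 2 ≤ m.height := by
  obtain ⟨n, g, hg, hi⟩ := noether2 K P hP hPm
  let _ : Algebra (MvPolynomial (Fin (n + 2)) K) A := g.toRingHom.toAlgebra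
  have : Algebra.IsIntegral (MvPolynomial (Fin (n + 2)) K) A := ⟨hi⟩
  have : FaithfulSMul (MvPolynomial (Fin (n + 2)) K) A :=
    (faithfulSMul_iff_algebraMap_injective _ _).2 hg
  have : IsNoetherianRing A := Algebra.FiniteType.isNoetherianRing K A
  have h1 : (m.under (MvPolynomial (Fin (n + 2)) K)).IsMaximal :=
    Ideal.isMaximal_comap_of_isIntegral_of_isMaximal m
  have h2 := height_max_mv K _ _ h1
  have : m.LiesOver (m.under (MvPolynomial (Fin (n + 2)) K)) := ⟨rfl⟩
  rw [Ideal.height_eq_height_add_of_liesOver_of_hasGoingDown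
    (m.under (MvPolynomial (Fin (n + 2)) K)) m]
  refine le_trans (le_trans ?_ h2) le_self_add
  exact_mod_cast (by omega : 2 ≤ n + 2)

theorem alg2 (K : Type*) {A : Type*} [Field K] [CommRing A] [IsDomain A] [Algebra K A]
    [Algebra.FiniteType K A] (P : Ideal A) [P.IsPrime] (hP : P ≠ ⊥) (hPm : ¬ P.IsMaximal)
    (m : Ideal A) (hm : m.IsMaximal) (f : A) (hf : f ≠ 0) :
    ∃ Q : Ideal A, Q.IsPrime ∧ Q ≠ ⊥ ∧ Q < m ∧ f ∉ Q := by
  have : IsNoetherianRing A := Algebra.FiniteType.isNoetherianRing K A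
  have h2 := two_le_height K P hP hPm m hm
  have hmp := hm.isPrime
  have hlt : ∀ (a : A) (q : Ideal A), q ∈ (Ideal.span {a}).minimalPrimes → ¬ m ≤ q := by
    intro a q hq hmq
    have := Ideal.height_le_one_of_isPrincipal_of_mem_minimalPrimes _ q hq
    have h3 := h2.trans ((Ideal.height_mono hmq).trans this)
    exact absurd h3 (by norm_num)
  have hfin := Ideal.finite_minimalPrimes_of_isNoetherianRing A (Ideal.span {f})
  obtain ⟨g, hgm, hg⟩ : ∃ g ∈ m, ∀ q ∈ (Ideal.span {f}).minimalPrimes, g ∉ q := by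
    by_contra hcon
    push Not at hcon
    have := (Ideal.subset_union_prime (s := hfin.toFinset) (f := id) (I := m) ⊤ ⊤
      (fun i hi _ _ => (hfin.mem_toFinset.1 hi).1.1)).1 (by
        intro x hx
        obtain ⟨q, hq, hxq⟩ := hcon x hx
        simp only [Set.mem_iUnion]
        exact ⟨q, by simpa using hq, hxq⟩)
    obtain ⟨q, hq, hle⟩ := this
    exact hlt f q (hfin.mem_toFinset.1 hq) hle
  have hmb : m ≠ ⊥ := by
    rintro rfl
    simp at h2
  obtain ⟨g, hgm, hg, hg0⟩ : ∃ g ∈ m, (∀ q ∈ (Ideal.span {f}).minimalPrimes, g ∉ q) ∧ g ≠ 0 := by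
    by_cases hg0 : g = 0
    · obtain ⟨g', hg', hg'0⟩ := Submodule.exists_mem_ne_zero_of_ne_bot hmb
      refine ⟨g', hg', ?_, hg'0⟩
      intro q hq
      exact absurd (hg0 ▸ q.zero_mem) (hg q hq)
    · exact ⟨g, hgm, hg, hg0⟩
  obtain ⟨Q, hQ, hQm⟩ := Ideal.exists_minimalPrimes_le
    ((Ideal.span_singleton_le_iff_mem m).2 hgm)
  have hgQ : g ∈ Q := hQ.1.2 (Ideal.mem_span_singleton_self g)
  have hQp : Q.IsPrime := hQ.1.1
  refine ⟨Q, hQp, ?_, lt_of_le_of_ne hQm ?_, ?_⟩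
  · rintro rfl
    exact hg0 hgQ
  · rintro rfl
    exact hlt g Q hQ le_rfl
  · intro hfQ
    obtain ⟨q, hq, hqQ⟩ := Ideal.exists_minimalPrimes_le
      ((Ideal.span_singleton_le_iff_mem Q).2 hfQ)
    have hqp : q.IsPrime := hq.1.1
    have hqb : q ≠ ⊥ := by
      rintro rfl
      exact hf (hq.1.2 (Ideal.mem_span_singleton_self f))
    have hqlt : q < Q := lt_of_le_of_ne hqQ (by rintro rfl; exact hg q hq hgQ)
    have h1 := Ideal.height_add_one_le_of_lt_of_isPrime hqlt
    have h3 := Ideal.height_le_one_of_isPrincipal_of_mem_minimalPrimes _ Q hQ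
    have h4 : q.height ≠ 0 := fun h => hqb (Ideal.height_eq_zero_iff_eq_bot.1 h)
    have h5 : 1 ≤ q.height := Order.one_le_iff_pos.2 (pos_iff_ne_zero.2 h4)
    have : (1 : ℕ∞) + 1 ≤ 1 := le_trans (by gcongr) (h1.trans h3)
    exact absurd this (by norm_num)

theorem loc_ext {S Ω κ : Type*} [CommRing S] [CommRing Ω] [Field κ] (ρ : S →+* Ω) (s : S)
    (hs : IsUnit (ρ s)) (hl : ∀ ω, ∃ k t, ρ s ^ k * ω = ρ t) (χ : S →+* κ)
    (hk : RingHom.ker ρ ≤ RingHom.ker χ) (hχ : χ s ≠ 0) :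
    ∃ χ' : Ω →+* κ, ∀ x, χ' (ρ x) = χ x := by
  let x : ρ.range := ρ.rangeRestrict s
  have hL : IsLocalization.Away x Ω := by
    refine IsLocalization.Away.mk x hs ?_ ?_
    · intro ω
      obtain ⟨k, t, h⟩ := hl ω
      exact ⟨k, ρ.rangeRestrict t, by rw [mul_comm]; exact h⟩
    · intro a b hab
      exact ⟨0, by rw [Subtype.ext hab]⟩
  let χ₁ : ρ.range →+* κ := (RingHom.liftOfSurjective ρ.rangeRestrict
    ρ.rangeRestrict_surjective) ⟨χ, by rwa [RingHom.ker_rangeRestrict]⟩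
  have h1 : ∀ y, χ₁ (ρ.rangeRestrict y) = χ y := fun y =>
    RingHom.liftOfRightInverse_comp_apply _ _ _ _ _
  have hu : IsUnit (χ₁ x) := by rw [h1]; exact hχ.isUnit
  refine ⟨IsLocalization.Away.lift x hu, fun y => ?_⟩
  rw [← h1]
  exact IsLocalization.Away.lift_eq x hu (ρ.rangeRestrict y)

theorem denoms {K L : Type*} [Field K] [Field L] [Algebra K L] (D E : Subalgebra K L) (hE : E.FG)
    (M : Submonoid L) (hM : (M : Set L) ⊆ D) (hx : ∀ x : L, ∃ c ∈ M, c * x ∈ D) :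
    ∃ c ∈ M, ∀ x ∈ E, ∃ k : ℕ, c ^ k * x ∈ D := by
  classical
  obtain ⟨t, rfl⟩ := hE
  choose c hc hcx using hx
  refine ⟨∏ x ∈ t, c x, prod_mem fun x _ => hc x, fun x hx => ?_⟩
  have hcD : ∏ x ∈ t, c x ∈ D := prod_mem fun x _ => hM (hc x)
  induction hx using Algebra.adjoin_induction with
  | mem x hx =>
    refine ⟨1, ?_⟩
    have hx : x ∈ t := hx
    rw [pow_one, ← Finset.prod_erase_mul _ _ hx, mul_assoc]
    exact mul_mem (prod_mem fun x _ => hM (hc x)) (hcx x)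
  | algebraMap r => exact ⟨0, by simp⟩
  | add x y _ _ hx hy =>
    obtain ⟨k, hk⟩ := hx
    obtain ⟨l, hl⟩ := hy
    refine ⟨k + l, ?_⟩
    have : (∏ x ∈ t, c x) ^ (k + l) * (x + y) = (∏ x ∈ t, c x) ^ l * ((∏ x ∈ t, c x) ^ k * x) +
      (∏ x ∈ t, c x) ^ k * ((∏ x ∈ t, c x) ^ l * y) := by ring
    rw [this]
    exact add_mem (mul_mem (pow_mem hcD _) hk) (mul_mem (pow_mem hcD _) hl)
  | mul x y _ _ hx hy =>
    obtain ⟨k, hk⟩ := hx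
    obtain ⟨l, hl⟩ := hy
    refine ⟨k + l, ?_⟩
    have : (∏ x ∈ t, c x) ^ (k + l) * (x * y) = ((∏ x ∈ t, c x) ^ k * x) *
      ((∏ x ∈ t, c x) ^ l * y) := by ring
    rw [this]
    exact mul_mem hk hl

theorem common {K L : Type*} [Field K] [Field L] [Algebra K L] (A D : Subalgebra K L)
    (d : L) (hdA : d ∈ A) (hd0 : d ≠ 0) (hd : ∀ x ∈ D, ∃ k : ℕ, d ^ k * x ∈ A)
    (H : Submonoid L) (hHD : (H : Set L) ⊆ D) (hH0 : (0 : L) ∉ H)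
    (h0 : L) (hh0 : h0 ∈ H) (hA : ∀ x ∈ A, ∃ k : ℕ, h0 ^ k * x ∈ D)
    (hint : ∀ t ∈ D, t ≠ 0 → ∃ t' ∈ D, t * t' ∈ H) :
    ∃ e ∈ A, e ≠ 0 ∧ ∃ h ∈ H, ∃ Ω : Subalgebra K L, A ≤ Ω ∧ D ≤ Ω ∧ e⁻¹ ∈ Ω ∧ h⁻¹ ∈ Ω ∧
      (∀ ω ∈ Ω, ∃ k : ℕ, e ^ k * ω ∈ A) ∧ (∀ ω ∈ Ω, ∃ k : ℕ, h ^ k * ω ∈ D) := by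
  have hne : ∀ x ∈ H, x ≠ 0 := fun x hx h => hH0 (h ▸ hx)
  have h00 := hne h0 hh0
  obtain ⟨k, hk⟩ := hA d hdA
  obtain ⟨t', ht'D, ht'H⟩ := hint _ hk (mul_ne_zero (pow_ne_zero _ h00) hd0)
  set h3 := h0 ^ k * d * t' with hh3
  have hhH : h0 * h3 ∈ H := mul_mem hh0 ht'H
  set h := h0 * h3 with hh
  have hh0' := hne h hhH
  obtain ⟨l, hl⟩ := hd h (hHD hhH)
  have hde : ∀ n, d ^ n ∈ A := fun n => pow_mem hdA n
  let e := d * (d ^ l * h)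
  have heA : e ∈ A := mul_mem hdA hl
  have he0 : e ≠ 0 := mul_ne_zero hd0 (mul_ne_zero (pow_ne_zero _ hd0) hh0')
  let Ω : Subalgebra K L :=
    { carrier := {x | ∃ k : ℕ, e ^ k * x ∈ A}
      mul_mem' := by
        rintro x y ⟨k, hk⟩ ⟨l, hl⟩
        refine ⟨k + l, ?_⟩
        have : e ^ (k + l) * (x * y) = (e ^ k * x) * (e ^ l * y) := by ring
        rw [this]
        exact mul_mem hk hl
      add_mem' := by
        rintro x y ⟨k, hk⟩ ⟨l, hl⟩
        refine ⟨k + l, ?_⟩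
        have : e ^ (k + l) * (x + y) = e ^ l * (e ^ k * x) + e ^ k * (e ^ l * y) := by ring
        rw [this]
        exact add_mem (mul_mem (pow_mem heA _) hk) (mul_mem (pow_mem heA _) hl)
      algebraMap_mem' := fun r => ⟨0, by simp⟩ }
  have hΩ : ∀ x, x ∈ Ω ↔ ∃ k : ℕ, e ^ k * x ∈ A := fun x => Iff.rfl
  refine ⟨e, heA, he0, h, hhH, Ω, ?_, ?_, ?_, ?_, fun ω hω => hω, ?_⟩
  · intro x hx
    exact (hΩ x).2 ⟨0, by simpa using hx⟩
  · intro x hx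
    obtain ⟨j, hj⟩ := hd x hx
    refine (hΩ x).2 ⟨j, ?_⟩
    have : e ^ j * x = (d ^ l * h) ^ j * (d ^ j * x) := by simp only [e]; ring
    rw [this]
    exact mul_mem (pow_mem hl _) hj
  · refine (hΩ _).2 ⟨1, ?_⟩
    rw [pow_one, mul_inv_cancel₀ he0]
    exact one_mem _
  · refine (hΩ _).2 ⟨1, ?_⟩
    have : e ^ 1 * h⁻¹ = d * d ^ l := by simp only [e]; field_simp
    rw [this]
    exact mul_mem hdA (hde _)
  · rintro ω hω
    obtain ⟨i, hi⟩ := (hΩ ω).1 hω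
    obtain ⟨j, hj⟩ := hA _ hi
    have h0D := hHD hh0
    have h3D := hHD ht'H
    refine ⟨(l + 2) * i + j, ?_⟩
    have key : h ^ ((l + 2) * i + j) * ω =
        ((h0 ^ (k + 1) * t') ^ (l + 1)) ^ i * (h3 ^ j * (h0 ^ j * (e ^ i * ω))) := by
      have h1 : h = h0 ^ (k + 1) * t' * d := by rw [hh, hh3]; ring
      have h2 : h ^ (l + 2) = (h0 ^ (k + 1) * t') ^ (l + 1) * e := by
        have : h ^ (l + 2) = h ^ (l + 1) * h := by ring
        rw [this]
        simp only [e]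
        nth_rewrite 1 [h1]
        ring
      calc h ^ ((l + 2) * i + j) * ω = (h ^ (l + 2)) ^ i * h ^ j * ω := by rw [pow_add, pow_mul]
        _ = ((h0 ^ (k + 1) * t') ^ (l + 1) * e) ^ i * (h0 * h3) ^ j * ω := by rw [h2, hh]
        _ = _ := by ring
    rw [key]
    exact mul_mem (pow_mem (pow_mem (mul_mem (pow_mem h0D _) ht'D) _) _)
      (mul_mem (pow_mem h3D _) hj)
section
open Polynomial
universe u

theorem null_hom {K A : Type*} [Field K] [IsAlgClosed K] [CommRing A] [Algebra K A]
    [Algebra.FiniteType K A] (m : Ideal A) (hm : m.IsMaximal) :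
    ∃ χ : A →ₐ[K] K, RingHom.ker χ = m := by
  let _ : Field (A ⧸ m) := Ideal.Quotient.field m
  have : Algebra.FiniteType K (A ⧸ m) := inferInstance
  have : Module.Finite K (A ⧸ m) := finite_of_finite_type_of_isJacobsonRing K (A ⧸ m)
  have : Algebra.IsIntegral K (A ⧸ m) := inferInstance
  have hb : Function.Bijective (algebraMap K (A ⧸ m)) :=
    IsAlgClosed.algebraMap_bijective_of_isIntegral
  let e := (AlgEquiv.ofBijective (Algebra.ofId K (A ⧸ m)) hb).symm
  refine ⟨(e : (A ⧸ m) →ₐ[K] K).comp (Ideal.Quotient.mkₐ K m), ?_⟩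
  ext x
  simp [RingHom.mem_ker, Ideal.Quotient.eq_zero_iff_mem]

theorem C_notMem_span {R : Type*} [CommRing R] [IsDomain R] (F : R[X]) (hF : F.Monic)
    (hirr : Irreducible F) (h' : R) (hh' : h' ≠ 0) : C h' ∉ Ideal.span {F} := by
  intro h1
  rw [Ideal.mem_span_singleton] at h1
  refine hF.not_dvd_of_natDegree_lt (by simpa using hh') ?_ h1
  rw [natDegree_C]
  refine Nat.pos_of_ne_zero fun h2 => hirr.not_isUnit ?_
  rw [hF.natDegree_eq_zero.1 h2]
  exact isUnit_one

theorem exists_residue {T : Type u} [CommRing T] (P : Ideal T) (hP : P.IsPrime) :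
    ∃ (κ : Type u) (_ : Field κ) (q : T →+* κ), ∀ t, q t = 0 ↔ t ∈ P := by
  refine ⟨FractionRing (T ⧸ P), inferInstance, (algebraMap _ _).comp (Ideal.Quotient.mk P), ?_⟩
  intro t
  rw [RingHom.comp_apply, FaithfulSMul.algebraMap_eq_zero_iff, Ideal.Quotient.eq_zero_iff_mem]

theorem closed_step {K ι A Ω : Type*} [Field K] [IsAlgClosed K] [Finite ι] [Nonempty ι]
    [CommRing A] [IsDomain A] [Algebra K A] [Algebra.FiniteType K A]
    [CommRing Ω] [IsDomain Ω] [Algebra K Ω] (α : A →+* Ω) (hα : Function.Injective α)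
    (hαK : ∀ c : K, α (algebraMap K A c) = algebraMap K Ω c)
    (τ : (MvPolynomial ι K)[X][X] →+* Ω)
    (hτK : ∀ c : K, τ (C (C (MvPolynomial.C c))) = algebraMap K Ω c)
    (F : (MvPolynomial ι K)[X][X]) (hF : F.Monic) (hirr : Irreducible F)
    (hker : RingHom.ker τ = Ideal.span {F})
    (e : A) (he : IsUnit (α e)) (hel : ∀ ω, ∃ (k : ℕ) (a : A), α e ^ k * ω = α a)
    (h : (MvPolynomial ι K)[X]) (hh : h ≠ 0)
    (hu : IsUnit (τ (C h))) (hhl : ∀ ω, ∃ (k : ℕ) (t : (MvPolynomial ι K)[X][X]),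
      τ (C h) ^ k * ω = τ t) :
    ∃ f : A, f ≠ 0 ∧ ∀ r : Ideal A → Prop,
      (∀ P : Ideal A, P.IsPrime → P ≠ ⊥ → ∀ m n : Ideal A, m.IsMaximal → n.IsMaximal →
        P ≤ m → P ≤ n → r m → r n) →
      ∀ m n : Ideal A, m.IsMaximal → n.IsMaximal → f ∉ m → f ∉ n → r m → r n := by
  obtain ⟨h', hh', H⟩ := core F hF hirr h hh
  have hτh' : τ (C h') ≠ 0 := by
    intro h0
    have h1 : C h' ∈ RingHom.ker τ := h0
    rw [hker] at h1
    exact C_notMem_span F hF hirr h' hh' h1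
  obtain ⟨k', a', ha'⟩ := hel (τ (C h'))
  refine ⟨e * a', ?_, ?_⟩
  · have he0 : e ≠ 0 := by
      rintro rfl
      simp at he
    refine mul_ne_zero he0 ?_
    rintro rfl
    rw [map_zero] at ha'
    exact mul_ne_zero (pow_ne_zero _ he.ne_zero) hτh' ha'
  intro r hr m n hm hn hfm hfn hrm
  -- a point of Ω compatible with K
  have kerMax : ∀ χ : Ω →+* K, (∀ c, χ (algebraMap K Ω c) = c) →
      (RingHom.ker (χ.comp α)).IsMaximal := by
    intro χ hχ
    refine RingHom.ker_isMaximal_of_surjective _ fun c => ⟨algebraMap K A c, ?_⟩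
    rw [RingHom.comp_apply, hαK, hχ]
  have compat : ∀ (χ : Ω →+* K) (a : K) (b : ι → K) (ζ : K), (∀ t, χ (τ t) = evT a b ζ t) →
      ∀ c, χ (algebraMap K Ω c) = c := by
    intro χ a b ζ hχ c
    rw [← hτK, hχ]
    simp [evT]
  have toPt : ∀ χ : Ω →+* K, (∀ c, χ (algebraMap K Ω c) = c) →
      ∃ a b ζ, ∀ t, χ (τ t) = evT a b ζ t := by
    intro χ hχ
    refine ⟨χ (τ (C X)), fun i => χ (τ (C (C (MvPolynomial.X i)))), χ (τ X), fun t => ?_⟩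
    have : χ.comp τ = evT (χ (τ (C X))) (fun i => χ (τ (C (C (MvPolynomial.X i))))) (χ (τ X)) := by
      ext <;> simp [evT, hτK, hχ]
    exact DFunLike.congr_fun this t
  have lift : ∀ m : Ideal A, m.IsMaximal → e * a' ∉ m → ∃ χ : Ω →+* K,
      (∀ c, χ (algebraMap K Ω c) = c) ∧ RingHom.ker (χ.comp α) = m ∧ χ (τ (C h')) ≠ 0 := by
    intro m hm hfm
    obtain ⟨χ₀, hχ₀⟩ := null_hom (K := K) m hm
    have hem : χ₀ e ≠ 0 := by
      intro h0
      apply hfm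
      rw [← hχ₀, RingHom.mem_ker, map_mul, h0, zero_mul]
    have ham : χ₀ a' ≠ 0 := by
      intro h0
      apply hfm
      rw [← hχ₀, RingHom.mem_ker, map_mul, h0, mul_zero]
    obtain ⟨χ, hχ⟩ := loc_ext α e he hel (χ₀ : A →+* K)
      (by rw [(RingHom.injective_iff_ker_eq_bot _).1 hα]; exact bot_le) hem
    refine ⟨χ, fun c => ?_, ?_, fun h0 => ham ?_⟩
    · rw [← hαK, hχ]
      exact χ₀.commutes c
    · rw [← hχ₀]
      ext x
      simp [RingHom.mem_ker, hχ]
    · have := congrArg χ ha'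
      rw [map_mul, h0, mul_zero, hχ] at this
      exact this.symm
  obtain ⟨χm, hχmK, hχm, hχm'⟩ := lift m hm hfm
  obtain ⟨χn, hχnK, hχn, hχn'⟩ := lift n hn hfn
  obtain ⟨a, b, ζ, hp⟩ := toPt χm hχmK
  obtain ⟨a', b', ζ', hp'⟩ := toPt χn hχnK
  have hτF : τ F = 0 := by
    have : F ∈ RingHom.ker τ := by rw [hker]; exact Ideal.mem_span_singleton_self F
    exact this
  have hinj : ∀ χ χ' : Ω →+* K, (∀ t, χ (τ t) = χ' (τ t)) → χ = χ' := by
    intro χ χ' hE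
    ext ω
    obtain ⟨k, t, ht⟩ := hhl ω
    have h1 := congrArg χ ht
    have h2 := congrArg χ' ht
    rw [map_mul, map_pow] at h1 h2
    rw [← hE, ← hE, ← h1] at h2
    exact (mul_left_cancel₀ (pow_ne_zero _ (hu.map χ).ne_zero) h2).symm
  have key := H (fun a b ζ => ∃ χ : Ω →+* K, (∀ t, χ (τ t) = evT a b ζ t) ∧
    r (RingHom.ker (χ.comp α))) ?_ a b ζ a' b' ζ' (by rw [← hp, hτF, map_zero])
    (by rw [← hp', hτF, map_zero]) (by rwa [← hp]) (by rwa [← hp'])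
    ⟨χm, hp, by rwa [hχm]⟩
  · obtain ⟨χ, h1, h2⟩ := key
    have : χ = χn := hinj _ _ fun t => by rw [h1, hp']
    rwa [this, hχn] at h2
  · rintro P hP hFP hPF a b ζ a' b' ζ' hPk hPk' hne hne' ⟨χ, hχ, hrχ⟩
    have hsub : RingHom.ker τ ≤ P := by
      rw [hker]
      exact (Ideal.span_singleton_le_iff_mem _).2 hFP
    obtain ⟨χ', hχ'⟩ := loc_ext τ (C h) hu hhl (evT a' b' ζ') (hsub.trans hPk') hne'
    refine ⟨χ', hχ', ?_⟩
    obtain ⟨κ, _, q, hq⟩ := exists_residue (T := (MvPolynomial ι K)[X][X]) P hP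
    obtain ⟨ψ, hψ⟩ := loc_ext τ (C h) hu hhl q (fun t ht => (hq t).2 (hsub ht))
      (fun h0 => hne (hPk ((hq _).1 h0)))
    have hQle : ∀ (χ : Ω →+* K) a b ζ, (∀ t, χ (τ t) = evT a b ζ t) →
        P ≤ RingHom.ker (evT a b ζ) → ∀ ω, ψ ω = 0 → χ ω = 0 := by
      intro χ a b ζ hχ hPk ω hω
      obtain ⟨k, t, ht⟩ := hhl ω
      have h1 := congrArg ψ ht
      rw [map_mul, hω, mul_zero, hψ, eq_comm, hq] at h1
      have h2 := congrArg χ ht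
      have h3 : evT a b ζ t = 0 := hPk h1
      rw [map_mul, map_pow, hχ t, h3] at h2
      exact (mul_eq_zero.1 h2).resolve_left (pow_ne_zero _ (hu.map χ).ne_zero)
    refine hr (RingHom.ker (ψ.comp α)) (RingHom.ker_isPrime _) ?_ _ _
      (kerMax _ (compat _ _ _ _ hχ)) (kerMax _ (compat _ _ _ _ hχ')) ?_ ?_ hrχ
    · intro hbot
      apply hPF
      intro t ht
      rw [← hker]
      by_contra htk
      obtain ⟨k, x, hx⟩ := hel (τ t)
      have hx0 : x ∈ RingHom.ker (ψ.comp α) := by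
        rw [RingHom.mem_ker, RingHom.comp_apply, ← hx, map_mul, hψ, (hq t).2 ht, mul_zero]
      rw [hbot] at hx0
      rw [(Submodule.mem_bot A).1 hx0, map_zero] at hx
      exact mul_ne_zero (pow_ne_zero _ he.ne_zero) (fun h => htk h) hx
    · intro x hx
      exact hQle χ _ _ _ hχ hPk _ hx
    · intro x hx
      exact hQle χ' _ _ _ hχ' hPk' _ hx
end
section
open Polynomial

theorem setup1 {K A R L : Type*} [Field K] [CommRing A] [IsDomain A] [Algebra K A]
    [Algebra.FiniteType K A] [Field L] [Algebra A L] [IsFractionRing A L] [Algebra K L]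
    [IsScalarTower K A L] [CommRing R] [IsDomain R] [Algebra K R] [Algebra.FiniteType K R]
    [Algebra R L] [IsScalarTower K R L] [FaithfulSMul R L] (z : L) (hz : IsIntegral R z)
    (hgen : ∀ x : L, ∃ h : R, h ≠ 0 ∧ algebraMap R L h * x ∈ Algebra.adjoin R {z}) :
    ∃ e : A, e ≠ 0 ∧ ∃ h : R, h ≠ 0 ∧ ∃ Ω : Subalgebra K L, (∀ a : A, algebraMap A L a ∈ Ω) ∧
      (∀ t : R[X], aeval z t ∈ Ω) ∧ (algebraMap A L e)⁻¹ ∈ Ω ∧ (algebraMap R L h)⁻¹ ∈ Ω ∧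
      (∀ ω ∈ Ω, ∃ (k : ℕ) (a : A), algebraMap A L e ^ k * ω = algebraMap A L a) ∧
      (∀ ω ∈ Ω, ∃ (k : ℕ) (t : R[X]), algebraMap R L h ^ k * ω = aeval z t) := by
  let A' : Subalgebra K L := (IsScalarTower.toAlgHom K A L).range
  let D : Subalgebra K L := (Algebra.adjoin R {z}).restrictScalars K
  have hinjA : Function.Injective (algebraMap A L) := IsFractionRing.injective A L
  have hinjR : Function.Injective (algebraMap R L) := FaithfulSMul.algebraMap_injective R L
  have hA' : ∀ x, x ∈ A' ↔ ∃ a, algebraMap A L a = x := fun x => Iff.rfl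
  have hD : ∀ x, x ∈ D ↔ ∃ t : R[X], aeval z t = x := by
    intro x
    change x ∈ Algebra.adjoin R {z} ↔ _
    rw [Algebra.adjoin_singleton_eq_range_aeval]
    rfl
  let MA : Submonoid L := (nonZeroDivisors A).map (algebraMap A L)
  let MR : Submonoid L := (nonZeroDivisors R).map (algebraMap R L)
  have hMR : (MR : Set L) ⊆ D := by
    rintro _ ⟨x, -, rfl⟩
    exact (hD _).2 ⟨C x, by simp⟩
  have hMA : (MA : Set L) ⊆ A' := by
    rintro _ ⟨x, -, rfl⟩
    exact (hA' _).2 ⟨x, rfl⟩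
  have hA'fg : A'.FG := by
    have : A' = (⊤ : Subalgebra K A).map (IsScalarTower.toAlgHom K A L) := by
      rw [Algebra.map_top]
    rw [this]
    exact Subalgebra.FG.map _ Algebra.FiniteType.out
  have hDfg : D.FG := by
    have h1 : Algebra.FiniteType K R[X] :=
      Algebra.FiniteType.trans (S := R) inferInstance inferInstance
    have : D = (⊤ : Subalgebra K R[X]).map ((aeval z : R[X] →ₐ[R] L).restrictScalars K) := by
      ext x
      rw [hD, Algebra.map_top]
      rfl
    rw [this]
    exact Subalgebra.FG.map _ h1.out
  obtain ⟨d, hd, hdD⟩ := denoms A' D hDfg MA hMA (by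
    intro x
    obtain ⟨a, b, hb, rfl⟩ := IsFractionRing.div_surjective (A := A) x
    refine ⟨algebraMap A L b, ⟨b, hb, rfl⟩, (hA' _).2 ⟨a, ?_⟩⟩
    have : algebraMap A L b ≠ 0 := by
      simpa using nonZeroDivisors.ne_zero hb
    field_simp)
  obtain ⟨h0, hh0, hh0A⟩ := denoms D A' hA'fg MR hMR (by
    intro x
    obtain ⟨h, hne, hx⟩ := hgen x
    exact ⟨_, ⟨h, mem_nonZeroDivisors_of_ne_zero hne, rfl⟩, hx⟩)
  have hd0 : d ≠ 0 := by
    obtain ⟨b, hb, rfl⟩ := hd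
    simpa using nonZeroDivisors.ne_zero hb
  have hint : ∀ t ∈ D, t ≠ 0 → ∃ t' ∈ D, t * t' ∈ MR := by
    intro t ht ht0
    have : Algebra.IsIntegral R (Algebra.adjoin R {z}) := by
      rw [← le_integralClosure_iff_isIntegral]
      exact adjoin_le_integralClosure hz
    have h1 : (⟨t, ht⟩ : Algebra.adjoin R {z}) ≠ 0 := fun h => ht0 (congrArg Subtype.val h)
    have h2 := Ideal.comap_ne_bot_of_integral_mem (R := R) h1
      (Ideal.mem_span_singleton_self _) (Algebra.IsIntegral.isIntegral _)
    obtain ⟨h3, hh3, hne⟩ := Submodule.exists_mem_ne_zero_of_ne_bot h2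
    obtain ⟨t', ht'⟩ := Ideal.mem_span_singleton.1 (Ideal.mem_comap.1 hh3)
    refine ⟨t', t'.2, h3, mem_nonZeroDivisors_of_ne_zero hne, ?_⟩
    exact congrArg Subtype.val ht'
  obtain ⟨e, heA, he0, h, hhH, Ω, h1, h2, h3, h4, h5, h6⟩ := common A' D d (hMA hd) hd0 hdD MR hMR
    (by
      rintro ⟨b, hb, h0⟩
      exact nonZeroDivisors.ne_zero hb (hinjR (by rw [h0, map_zero]))) h0 hh0 hh0A hint
  obtain ⟨e, rfl⟩ := (hA' _).1 heA
  obtain ⟨h, hh, rfl⟩ := hhH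
  refine ⟨e, fun h => he0 (by rw [h, map_zero]), h, nonZeroDivisors.ne_zero hh, Ω,
    fun a => h1 ((hA' _).2 ⟨a, rfl⟩), fun t => h2 ((hD _).2 ⟨t, rfl⟩), h3, h4, ?_, ?_⟩
  · intro ω hω
    obtain ⟨k, hk⟩ := h5 ω hω
    obtain ⟨a, ha⟩ := (hA' _).1 hk
    exact ⟨k, a, ha.symm⟩
  · intro ω hω
    obtain ⟨k, hk⟩ := h6 ω hω
    obtain ⟨a, ha⟩ := (hD _).1 hk
    exact ⟨k, a, ha.symm⟩

theorem gen_aux {K L R : Type*} [Field K] [Field L] [Algebra K L] [CommRing R] [IsDomain R]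
    [Algebra R L] [FaithfulSMul R L]
    (E : IntermediateField K L) (hE : ∀ x ∈ E, ∃ r s : R, algebraMap R L s ≠ 0 ∧
      x = algebraMap R L r / algebraMap R L s)
    [Algebra.IsAlgebraic E L] (z0 : L) (hz0 : IntermediateField.adjoin E {z0} = ⊤) (y : R)
    (hy : y ≠ 0) :
    ∀ x : L, ∃ h : R, h ≠ 0 ∧ algebraMap R L h * x ∈ Algebra.adjoin R {y • z0} := by
  have hD : ∀ h : R, algebraMap R L h ∈ Algebra.adjoin R {y • z0} :=
    fun h => Subalgebra.algebraMap_mem _ h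
  intro x
  have hx : x ∈ Algebra.adjoin E {z0} := by
    rw [← IntermediateField.adjoin_simple_toSubalgebra_of_isAlgebraic
      (Algebra.IsAlgebraic.isAlgebraic z0), hz0]
    trivial
  induction hx using Algebra.adjoin_induction with
  | mem x hx =>
    obtain rfl : x = z0 := hx
    refine ⟨y, hy, Algebra.subset_adjoin ?_⟩
    rw [Set.mem_singleton_iff, Algebra.smul_def]
  | algebraMap c =>
    obtain ⟨r, s, hs, h⟩ := hE c c.2
    refine ⟨s, fun h => hs (by rw [h, map_zero]), ?_⟩
    have : algebraMap R L s * algebraMap E L c = algebraMap R L r := by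
      change _ * (c : L) = _
      rw [h]
      field_simp
    rw [this]
    exact hD r
  | add x y _ _ hx hy =>
    obtain ⟨h, hh, hx⟩ := hx
    obtain ⟨l, hl, hy⟩ := hy
    refine ⟨h * l, mul_ne_zero hh hl, ?_⟩
    have : algebraMap R L (h * l) * (x + y) = algebraMap R L l * (algebraMap R L h * x) +
      algebraMap R L h * (algebraMap R L l * y) := by rw [map_mul]; ring
    rw [this]
    exact add_mem (mul_mem (hD _) hx) (mul_mem (hD _) hy)
  | mul x y _ _ hx hy =>
    obtain ⟨h, hh, hx⟩ := hx
    obtain ⟨l, hl, hy⟩ := hy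
    refine ⟨h * l, mul_ne_zero hh hl, ?_⟩
    have : algebraMap R L (h * l) * (x * y) = (algebraMap R L h * x) * (algebraMap R L l * y) := by
      rw [map_mul]; ring
    rw [this]
    exact mul_mem hx hy

theorem setup2 (K A : Type*) [Field K] [IsAlgClosed K] [CommRing A] [IsDomain A] [Algebra K A]
    [Algebra.FiniteType K A] (P : Ideal A) [P.IsPrime] (hP : P ≠ ⊥) (hPm : ¬ P.IsMaximal) :
    ∃ (n : ℕ) (v : Fin (n + 2) → FractionRing A), AlgebraicIndependent K v ∧
      Algebra.IsAlgebraic (IntermediateField.adjoin K (Set.range v)) (FractionRing A) ∧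
      ∃ z0 : FractionRing A, IntermediateField.adjoin (IntermediateField.adjoin K (Set.range v)) {z0} = ⊤ := by
  obtain ⟨s, hs, hsep⟩ := exists_isTranscendenceBasis_and_isSeparable_of_perfectField K
    (FractionRing A)
  obtain ⟨n, g, hg, -⟩ := noether2 K P hP hPm
  have hi : AlgebraicIndependent K (fun i => algebraMap A (FractionRing A) (g (MvPolynomial.X i))) := by
    rw [algebraicIndependent_iff_injective_aeval]
    have : (MvPolynomial.aeval fun i => algebraMap A (FractionRing A) (g (MvPolynomial.X i))) =
        (IsScalarTower.toAlgHom K A (FractionRing A)).comp g := by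
      ext i
      simp
    rw [this]
    exact (IsFractionRing.injective A (FractionRing A)).comp hg
  have hcard : n + 2 ≤ s.card := by
    have h1 := hi.lift_cardinalMk_le_trdeg
    rw [← hs.cardinalMk_eq_trdeg] at h1
    simp at h1
    exact_mod_cast h1
  obtain ⟨j, hj⟩ := Nat.exists_eq_add_of_le hcard
  have hj' : s.card = (n + j) + 2 := by omega
  let σ : Fin (n + j + 2) ≃ s := (s.equivFinOfCardEq hj').symm
  have hr : Set.range (fun i => (σ i : FractionRing A)) = s := by
    rw [show (fun i => (σ i : FractionRing A)) = Subtype.val ∘ σ from rfl,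
      EquivLike.range_comp]
    simp
  refine ⟨n + j, fun i => σ i, hs.1.comp σ σ.injective, ?_⟩
  rw [hr]
  have : Algebra.EssFiniteType (IntermediateField.adjoin K (s : Set (FractionRing A)))
    (FractionRing A) := .of_comp K _ _
  have : FiniteDimensional (IntermediateField.adjoin K (s : Set (FractionRing A)))
    (FractionRing A) := Algebra.finite_of_essFiniteType_of_isAlgebraic
  exact ⟨inferInstance, Field.exists_primitive_element _ _⟩
end
section
open Polynomial

theorem mem_span_minpoly {R S : Type*} [CommRing R] [CommRing S] [IsDomain R] [IsDomain S]
    [Algebra R S] [IsIntegrallyClosed R] [FaithfulSMul R S] {s : S} (hs : IsIntegral R s)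
    (t : R[X]) : t ∈ Ideal.span {minpoly R s} ↔ aeval s t = 0 := by
  rw [Ideal.mem_span_singleton, minpoly.isIntegrallyClosed_dvd_iff hs]

theorem alg1_closed {K A : Type*} [Field K] [IsAlgClosed K] [CommRing A] [IsDomain A] [Algebra K A]
    [Algebra.FiniteType K A] (P : Ideal A) [P.IsPrime] (hP : P ≠ ⊥) (hPm : ¬ P.IsMaximal) :
    ∃ f : A, f ≠ 0 ∧ ∀ r : Ideal A → Prop,
      (∀ P : Ideal A, P.IsPrime → P ≠ ⊥ → ∀ m n : Ideal A, m.IsMaximal → n.IsMaximal →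
        P ≤ m → P ≤ n → r m → r n) →
      ∀ m n : Ideal A, m.IsMaximal → n.IsMaximal → f ∉ m → f ∉ n → r m → r n := by
  obtain ⟨n, v, hv, halg, z0, hz0⟩ := setup2 K A P hP hPm
  let R0 := (MvPolynomial (Fin (n + 1)) K)[X]
  let φ : R0 →ₐ[K] FractionRing A :=
    (MvPolynomial.aeval v).comp (MvPolynomial.finSuccEquiv K (n + 1)).symm.toAlgHom
  have hφ : Function.Injective φ := by
    intro x y hxy
    exact (MvPolynomial.finSuccEquiv K (n + 1)).symm.injective
      ((algebraicIndependent_iff_injective_aeval.1 hv) hxy)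
  let _ : Algebra R0 (FractionRing A) := φ.toRingHom.toAlgebra
  have : FaithfulSMul R0 (FractionRing A) := (faithfulSMul_iff_algebraMap_injective _ _).2 hφ
  have : IsScalarTower K R0 (FractionRing A) :=
    IsScalarTower.of_algebraMap_eq fun c => (φ.commutes c).symm
  have hE : ∀ x ∈ IntermediateField.adjoin K (Set.range v), ∃ r s : R0,
      algebraMap R0 (FractionRing A) s ≠ 0 ∧
        x = algebraMap R0 (FractionRing A) r / algebraMap R0 (FractionRing A) s := by
    intro x hx
    obtain ⟨r, s, h⟩ := (IntermediateField.mem_adjoin_range_iff _ _ _).1 hx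
    have key : ∀ r, algebraMap R0 (FractionRing A) (MvPolynomial.finSuccEquiv K (n + 1) r) =
        MvPolynomial.aeval v r := fun r => by
      change MvPolynomial.aeval v ((MvPolynomial.finSuccEquiv K (n + 1)).symm _) = _
      rw [AlgEquiv.symm_apply_apply]
    by_cases hs : MvPolynomial.aeval v s = 0
    · refine ⟨0, 1, by simp, ?_⟩
      rw [h, hs]
      simp
    · refine ⟨MvPolynomial.finSuccEquiv K (n + 1) r, MvPolynomial.finSuccEquiv K (n + 1) s, ?_, ?_⟩
      · rwa [key]
      · rw [key, key, h]
  have halgz : IsAlgebraic R0 z0 := by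
    have h1 := IntermediateField.isAlgebraic_adjoin_iff.1 (halg.isAlgebraic z0)
    let f : R0 →+* Algebra.adjoin K (Set.range v) :=
      hv.aevalEquiv.toRingEquiv.toRingHom.comp
        (MvPolynomial.finSuccEquiv K (n + 1)).symm.toRingEquiv.toRingHom
    refine IsAlgebraic.of_ringHom_of_comp_eq (g := RingHom.id (FractionRing A)) (f := f) h1 ?_
      Function.injective_id ?_
    · exact hv.aevalEquiv.surjective.comp (MvPolynomial.finSuccEquiv K (n + 1)).symm.surjective
    · refine RingHom.ext fun x => ?_
      exact hv.algebraMap_aevalEquiv _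
  obtain ⟨y, hy0, hy⟩ := halgz.exists_integral_multiple
  have hgen := gen_aux (R := R0) (IntermediateField.adjoin K (Set.range v)) hE z0 hz0 y hy0
  have hft : Algebra.FiniteType K R0 :=
    Algebra.FiniteType.trans (S := MvPolynomial (Fin (n + 1)) K) inferInstance inferInstance
  obtain ⟨e, he, h, hh, Ω, h1, h2, h3, h4, h5, h6⟩ := setup1 (K := K) (A := A) (R := R0)
    (L := FractionRing A) (y • z0) hy hgen
  have hic : IsIntegrallyClosed R0 := inferInstance
  let α : A →+* Ω := (algebraMap A (FractionRing A)).codRestrict Ω h1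
  let τ : R0[X] →+* Ω := ((aeval (y • z0) : R0[X] →ₐ[R0] FractionRing A) : R0[X] →+* _).codRestrict Ω h2
  have heL : algebraMap A (FractionRing A) e ≠ 0 := by simpa using he
  have hhL : algebraMap R0 (FractionRing A) h ≠ 0 := by simpa using hh
  refine closed_step (ι := Fin (n + 1)) α ?_ ?_ τ ?_ (minpoly R0 (y • z0)) (minpoly.monic hy)
    (minpoly.irreducible hy) ?_ e ?_ ?_ h hh ?_ ?_
  · intro a b hab
    exact IsFractionRing.injective A (FractionRing A) (congrArg Subtype.val hab)
  · intro c
    apply Subtype.ext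
    exact (IsScalarTower.algebraMap_apply K A (FractionRing A) c).symm
  · intro c
    apply Subtype.ext
    change aeval (y • z0) (C (C (MvPolynomial.C c))) = algebraMap K (FractionRing A) c
    rw [aeval_C, IsScalarTower.algebraMap_apply K R0 (FractionRing A) c]
    rfl
  · ext t
    rw [mem_span_minpoly hy]
    exact Subtype.ext_iff
  · refine IsUnit.of_mul_eq_one ⟨_, h3⟩ (Subtype.ext ?_)
    exact mul_inv_cancel₀ heL
  · rintro ⟨ω, hω⟩
    obtain ⟨k, a, ha⟩ := h5 ω hω
    exact ⟨k, a, Subtype.ext ha⟩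
  · refine IsUnit.of_mul_eq_one ⟨_, h4⟩ (Subtype.ext ?_)
    change aeval (y • z0) (C h) * _ = 1
    rw [aeval_C]
    exact mul_inv_cancel₀ hhL
  · rintro ⟨ω, hω⟩
    obtain ⟨k, a, ha⟩ := h6 ω hω
    refine ⟨k, a, Subtype.ext ?_⟩
    change aeval (y • z0) (C h) ^ k * _ = _
    rw [aeval_C]
    exact ha
end
section
universe v

theorem exists_closed_cover {K : Type*} {A : Type v} [Field K] [CommRing A] [IsDomain A] [Algebra K A]
    [Algebra.FiniteType K A] :
    ∃ (K' A' : Type v) (_ : Field K') (_ : CommRing A') (_ : IsAlgClosed K') (_ : IsDomain A')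
      (_ : Algebra K' A') (_ : Algebra A A'), Algebra.FiniteType K' A' ∧
      Algebra.IsIntegral A A' ∧ Function.Injective (algebraMap A A') := by
  let L := AlgebraicClosure (FractionRing A)
  let K' := algebraicClosure K L
  have : IsAlgClosed K' := IsAlgClosure.isAlgClosed K
  obtain ⟨t, ht⟩ := (inferInstance : Algebra.FiniteType K A).out
  let B : Subalgebra K' L := Algebra.adjoin K' (Set.range (algebraMap A L))
  have hB : B = Algebra.adjoin K' ((algebraMap A L) '' (t : Set A)) := by
    apply le_antisymm
    · refine Algebra.adjoin_le ?_
      rintro _ ⟨a, rfl⟩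
      have ha : a ∈ Algebra.adjoin K (t : Set A) := by rw [ht]; trivial
      induction ha using Algebra.adjoin_induction with
      | mem x hx => exact Algebra.subset_adjoin ⟨x, hx, rfl⟩
      | algebraMap r =>
        rw [← IsScalarTower.algebraMap_apply K A L, IsScalarTower.algebraMap_apply K K' L]
        exact Subalgebra.algebraMap_mem _ _
      | add x y _ _ hx hy => rw [map_add]; exact add_mem hx hy
      | mul x y _ _ hx hy => rw [map_mul]; exact mul_mem hx hy
    · exact Algebra.adjoin_mono (Set.image_subset_range _ _)
  let φ : A →+* B := (algebraMap A L).codRestrict B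
    (fun a => Algebra.subset_adjoin ⟨a, rfl⟩)
  let _ : Algebra A B := φ.toAlgebra
  have hinj : Function.Injective (algebraMap A L) := by
    rw [IsScalarTower.algebraMap_eq A (FractionRing A) L]
    exact (algebraMap (FractionRing A) L).injective.comp (IsFractionRing.injective A _)
  have : IsScalarTower A B L := IsScalarTower.of_algebraMap_eq (fun x => rfl)
  refine ⟨K', B, inferInstance, inferInstance, ‹_›, inferInstance, inferInstance, inferInstance,
    ?_, ?_, ?_⟩
  · rw [← Subalgebra.fg_iff_finiteType, hB]
    classical
    exact ⟨t.image (algebraMap A L), by rw [Finset.coe_image]⟩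
  · constructor
    intro b
    have hb : IsIntegral A (b : L) := by
      have := b.2
      generalize (b : L) = z at this
      induction this using Algebra.adjoin_induction with
      | mem x hx => obtain ⟨a, rfl⟩ := hx; exact isIntegral_algebraMap
      | algebraMap r =>
        have h1 : IsIntegral K (algebraMap K' L r) :=
          ((algebraicClosure.isAlgebraic K L).isAlgebraic r).isIntegral.algebraMap
        exact h1.tower_top
      | add x y _ _ hx hy => exact hx.add hy
      | mul x y _ _ hx hy => exact hx.mul hy
    exact (isIntegral_algebraMap_iff (A := B) (B := L) Subtype.val_injective).1 hb
  · intro a b hab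
    exact hinj (congrArg Subtype.val hab)

theorem alg1 {K : Type*} {A : Type v} [Field K] [CommRing A] [IsDomain A] [Algebra K A]
    [Algebra.FiniteType K A] (P : Ideal A) [P.IsPrime] (hP : P ≠ ⊥) (hPm : ¬ P.IsMaximal) :
    ∃ f : A, f ≠ 0 ∧ ∀ r : Ideal A → Prop,
      (∀ P : Ideal A, P.IsPrime → P ≠ ⊥ → ∀ m n : Ideal A, m.IsMaximal → n.IsMaximal →
        P ≤ m → P ≤ n → r m → r n) →
      ∀ m n : Ideal A, m.IsMaximal → n.IsMaximal → f ∉ m → f ∉ n → r m → r n := by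
  obtain ⟨K', B, _, _, _, _, _, _, _, hint, hinj⟩ := exists_closed_cover (K := K) (A := A)
  have hker : RingHom.ker (algebraMap A B) = ⊥ := (RingHom.injective_iff_ker_eq_bot _).1 hinj
  obtain ⟨P', hP', hPP⟩ := Ideal.exists_ideal_over_prime_of_isIntegral_of_isDomain (S := B) P
    (by rw [hker]; exact bot_le)
  have hP'0 : P' ≠ ⊥ := by
    rintro rfl
    apply hP
    rw [← hPP, ← hker]; rfl
  have hP'm : ¬ P'.IsMaximal := by
    intro h
    apply hPm
    rw [← hPP]
    exact Ideal.isMaximal_comap_of_isIntegral_of_isMaximal P'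
  obtain ⟨f', hf', H⟩ := alg1_closed (K := K') P' hP'0 hP'm
  have hne : (Ideal.span {f'}).comap (algebraMap A B) ≠ ⊥ :=
    Ideal.comap_ne_bot_of_integral_mem hf' (Ideal.mem_span_singleton_self f')
      (Algebra.IsIntegral.isIntegral f')
  obtain ⟨f, hf, hf0⟩ := Submodule.exists_mem_ne_zero_of_ne_bot hne
  refine ⟨f, hf0, fun r hr m n hm hn hfm hfn hrm => ?_⟩
  obtain ⟨m', hm', hmm⟩ := Ideal.exists_ideal_over_maximal_of_isIntegral (S := B) m
    (by rw [hker]; exact bot_le)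
  obtain ⟨n', hn', hnn⟩ := Ideal.exists_ideal_over_maximal_of_isIntegral (S := B) n
    (by rw [hker]; exact bot_le)
  have key : ∀ (I : Ideal A) (I' : Ideal B), I'.comap (algebraMap A B) = I → f ∉ I → f' ∉ I' := by
    intro I I' hI hfI hf'
    apply hfI
    rw [← hI]
    exact (Ideal.span_singleton_le_iff_mem I').2 hf' hf
  have := H (fun I => r (I.comap (algebraMap A B))) ?_ m' n' hm' hn' (key _ _ hmm hfm)
    (key _ _ hnn hfn) (by simpa only [hmm] using hrm)
  · simpa only [hnn] using this
  · intro Q hQ hQ0 a b ha hb hQa hQb hra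
    exact hr (Q.comap (algebraMap A B)) inferInstance
      (fun h => hQ0 (Ideal.eq_bot_of_comap_eq_bot h)) _ _
      (Ideal.isMaximal_comap_of_isIntegral_of_isMaximal a)
      (Ideal.isMaximal_comap_of_isIntegral_of_isMaximal b)
      (Ideal.comap_mono hQa) (Ideal.comap_mono hQb) hra
end
section
open Topology TopologicalSpace
universe u

/-- Two closed points lying on a common closed irreducible curve. -/
def CurveRel {X : Type*} [TopologicalSpace X] (x y : X) : Prop :=
  IsClosed ({x} : Set X) ∧ IsClosed ({y} : Set X) ∧
    ∃ C : Set X, IsClosed C ∧ IsIrreducible C ∧ topologicalKrullDim C = 1 ∧ x ∈ C ∧ y ∈ C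

/-- Being joined by a chain of closed irreducible curves. -/
def CurveConn {X : Type*} [TopologicalSpace X] (x y : X) : Prop :=
  Relation.TransGen CurveRel x y

theorem CurveConn.symm {X : Type*} [TopologicalSpace X] {x y : X} (h : CurveConn x y) :
    CurveConn y x := by
  have hs : ∀ a b : X, CurveRel a b → CurveRel b a := by
    rintro a b ⟨ha, hb, C, h1, h2, h3, h4, h5⟩
    exact ⟨hb, ha, C, h1, h2, h3, h5, h4⟩
  unfold CurveConn at h ⊢
  induction h with
  | single h => exact .single (hs _ _ h)
  | tail _ h ih => exact .head (hs _ _ h) ih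

theorem CurveConn.chain {X : Type*} [TopologicalSpace X] {x y : X} (h : CurveConn x y) :
    ∃ (r : ℕ) (C : Fin (r + 1) → Set X),
      (∀ i, IsClosed (C i) ∧ IsIrreducible (C i) ∧ topologicalKrullDim (C i) = 1) ∧
      x ∈ C 0 ∧ y ∈ C (Fin.last r) ∧
      ∀ i : Fin r, ∃ P : X, P ∈ C i.castSucc ∩ C i.succ ∧ IsClosed ({P} : Set X) := by
  unfold CurveConn at h
  induction h using Relation.TransGen.head_induction_on with
  | single h =>
    obtain ⟨ha, hb, C, h1, h2, h3, h4, h5⟩ := h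
    exact ⟨0, fun _ => C, fun _ => ⟨h1, h2, h3⟩, h4, h5, fun i => i.elim0⟩
  | head h _ ih =>
    obtain ⟨ha, hb, D, h1, h2, h3, h4, h5⟩ := h
    obtain ⟨r, C, hC, hx, hy, hi⟩ := ih
    refine ⟨r + 1, Fin.cons D C, ?_, h4, ?_, ?_⟩
    · intro i
      refine Fin.cases ?_ (fun j => ?_) i
      · exact ⟨h1, h2, h3⟩
      · exact hC j
    · exact hy
    · intro i
      refine Fin.cases ?_ (fun j => ?_) i
      · exact ⟨_, ⟨h5, hx⟩, hb⟩
      · exact hi j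

theorem dim_one_of_minimal {X : Type*} [TopologicalSpace X] [T0Space X] [QuasiSober X] (η : X)
    (hη : ¬ IsClosed ({η} : Set X)) (h : ∀ w, η ⤳ w → w ≠ η → IsClosed ({w} : Set X)) :
    topologicalKrullDim (closure ({η} : Set X)) = 1 := by
  have hcl : IsClosedEmbedding (Subtype.val : closure ({η} : Set X) → X) :=
    isClosed_closure.isClosedEmbedding_subtypeVal
  have : QuasiSober (closure ({η} : Set X)) := hcl.quasiSober
  unfold topologicalKrullDim
  let _ := specializationOrder (closure ({η} : Set X))
  rw [Order.krullDim_eq_of_orderIso (irreducibleSetEquivPoints (α := closure ({η} : Set X)))]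
  have hle : ∀ a b : closure ({η} : Set X), a ≤ b ↔ (b : X) ⤳ (a : X) := by
    intro a b
    exact hcl.isInducing.specializes_iff.symm
  apply le_antisymm
  · rw [Order.krullDim_le_one_iff]
    intro x
    by_cases hx : (x : X) = η
    · right
      intro y _
      rw [hle, hx]
      exact specializes_iff_mem_closure.2 y.2
    · left
      intro y hy
      rw [hle] at hy ⊢
      have := (h x (specializes_iff_mem_closure.2 x.2) hx)
      have h2 : (y : X) = x := by simpa using hy.mem_closed this rfl
      rw [h2]
  · rw [Order.one_le_krullDim_iff]
    have : ∃ w, η ⤳ w ∧ w ≠ η := by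
      by_contra hcon
      push Not at hcon
      apply hη
      rw [← closure_eq_iff_isClosed]
      refine Set.Subset.antisymm (fun w hw => hcon w (specializes_iff_mem_closure.2 hw))
        subset_closure
    obtain ⟨w, hw, hne⟩ := this
    refine ⟨⟨w, specializes_iff_mem_closure.1 hw⟩, ⟨η, subset_closure rfl⟩, ?_⟩
    rw [lt_iff_le_not_ge, hle, hle]
    exact ⟨hw, fun h' => hne (h'.antisymm hw).eq⟩

theorem conn_of_charts {X : Type u} [TopologicalSpace X] [T0Space X] [QuasiSober X]
    [NoetherianSpace X] [JacobsonSpace X] (K : Type u) [Field K]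
    (H : ∀ η x : X, η ⤳ x → ∃ (U : Set X) (A : Type u) (_ : CommRing A) (_ : IsDomain A)
      (_ : Algebra K A) (φ : PrimeSpectrum A → X), IsOpen U ∧ x ∈ U ∧ Algebra.FiniteType K A ∧
      IsEmbedding φ ∧ Set.range φ = U ∩ closure {η} ∧
      ∀ p, IsClosed ({φ p} : Set X) ↔ p.asIdeal.IsMaximal)
    (η : X) : ¬ IsClosed ({η} : Set X) → ∀ x y, η ⤳ x → η ⤳ y → IsClosed ({x} : Set X) →
      IsClosed ({y} : Set X) → CurveConn x y := by
  have wf : WellFounded (fun a b : X => Closeds.closure {a} < Closeds.closure {b}) :=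
    InvImage.wf (fun a : X => Closeds.closure {a}) (wellFounded_lt (α := Closeds X))
  induction η using wf.induction with
  | _ η IH0 =>
  intro hη x y hx hy hxc hyc
  have IH : ∀ w, η ⤳ w → w ≠ η → ¬ IsClosed ({w} : Set X) → ∀ x y, w ⤳ x → w ⤳ y →
      IsClosed ({x} : Set X) → IsClosed ({y} : Set X) → CurveConn x y := by
    intro w hw hne
    refine IH0 w (lt_iff_le_not_ge.2 ⟨?_, ?_⟩)
    · exact hw.closure_subset
    · intro h
      exact hne ((specializes_iff_closure_subset.2 h).antisymm hw).eq
  by_cases hmin : ∀ w, η ⤳ w → w ≠ η → IsClosed ({w} : Set X)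
  · exact .single ⟨hxc, hyc, closure {η}, isClosed_closure, isIrreducible_singleton.closure,
      dim_one_of_minimal η hη hmin, specializes_iff_mem_closure.1 hx,
      specializes_iff_mem_closure.1 hy⟩
  push Not at hmin
  obtain ⟨w, hηw, hwne, hwc⟩ := hmin
  have chart_bot : ∀ {U : Set X} {A : Type u} [CommRing A] [IsDomain A] {φ : PrimeSpectrum A → X}
      {x : X}, η ⤳ x → IsOpen U → x ∈ U → IsEmbedding φ → Set.range φ = U ∩ closure {η} →
      φ ⊥ = η := by
    intro U A _ _ φ x hx hU hxU hφ hr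
    have : η ∈ Set.range φ := by
      rw [hr]
      exact ⟨hx.mem_open hU hxU, subset_closure rfl⟩
    obtain ⟨p, hp⟩ := this
    have h1 : φ ⊥ ∈ U ∩ closure {η} := hr ▸ Set.mem_range_self _
    have h2 : φ p ⤳ φ ⊥ := by rw [hp]; exact specializes_iff_mem_closure.2 h1.2
    rw [hφ.isInducing.specializes_iff, ← PrimeSpectrum.le_iff_specializes] at h2
    rw [← hp, le_bot_iff.1 h2]
  have jac : ∀ (w : X) (O : Set X), IsOpen O → w ∈ O →
      ∃ y, w ⤳ y ∧ y ∈ O ∧ IsClosed ({y} : Set X) := by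
    intro w O hO hw
    obtain ⟨y, ⟨h1, h2⟩, h3⟩ := nonempty_inter_closedPoints (Z := closure {w} ∩ O)
      ⟨w, subset_closure rfl, hw⟩ (isClosed_closure.isLocallyClosed.inter hO.isLocallyClosed)
    exact ⟨y, specializes_iff_mem_closure.2 h1, h2, h3⟩
  obtain ⟨U, A, _, _, _, φ, hU, hwU, hft, hφ, hr, hφm⟩ := H η w hηw
  have hbot : φ ⊥ = η := chart_bot hηw hU hwU hφ hr
  obtain ⟨p, hp⟩ : w ∈ Set.range φ := by
    rw [hr]; exact ⟨hwU, specializes_iff_mem_closure.1 hηw⟩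
  have hp0 : p.asIdeal ≠ ⊥ := by
    intro h
    apply hwne
    rw [← hp, ← hbot]
    congr 1
    exact PrimeSpectrum.ext h
  have hpm : ¬ p.asIdeal.IsMaximal := by rw [← hφm, hp]; exact hwc
  obtain ⟨f, hf0, hf⟩ := alg1 (K := K) p.asIdeal hp0 hpm
  obtain ⟨O, hO, hOf⟩ := hφ.isInducing.isOpen_iff.1 (PrimeSpectrum.isOpen_basicOpen (a := f))
  have hηO : η ∈ O ∩ U := by
    refine ⟨?_, hηw.mem_open hU hwU⟩
    have : (⊥ : PrimeSpectrum A) ∈ φ ⁻¹' O := by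
      rw [hOf]; simpa using hf0
    rw [← hbot]; exact this
  have hOU : IsOpen (O ∩ U) := hO.inter hU
  have hconnO : ∀ y z, η ⤳ y → η ⤳ z → y ∈ O ∩ U → z ∈ O ∩ U → IsClosed ({y} : Set X) →
      IsClosed ({z} : Set X) → y = z ∨ CurveConn y z := by
    intro y z hy hz hyO hzO hyc hzc
    obtain ⟨a, rfl⟩ : y ∈ Set.range φ := by
      rw [hr]; exact ⟨hyO.2, specializes_iff_mem_closure.1 hy⟩
    obtain ⟨b, rfl⟩ : z ∈ Set.range φ := by
      rw [hr]; exact ⟨hzO.2, specializes_iff_mem_closure.1 hz⟩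
    have ha : f ∉ a.asIdeal := by
      have : a ∈ φ ⁻¹' O := hyO.1
      rw [hOf] at this; simpa using this
    have hb : f ∉ b.asIdeal := by
      have : b ∈ φ ⁻¹' O := hzO.1
      rw [hOf] at this; simpa using this
    let r : Ideal A → Prop := fun I => ∃ q : PrimeSpectrum A, q.asIdeal = I ∧
      (φ a = φ q ∨ CurveConn (φ a) (φ q))
    have hrr : ∀ P : Ideal A, P.IsPrime → P ≠ ⊥ → ∀ m n : Ideal A, m.IsMaximal → n.IsMaximal →
        P ≤ m → P ≤ n → r m → r n := by
      rintro P hP hP0 _ n hm hn hPm hPn ⟨q, rfl, hq⟩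
      by_cases hPmax : P.IsMaximal
      · have h1 := hPmax.eq_of_le hm.ne_top hPm
        have h2 := hPmax.eq_of_le hn.ne_top hPn
        exact ⟨q, by rw [← h1, h2], hq⟩
      · refine ⟨⟨n, hn.isPrime⟩, rfl, Or.inr ?_⟩
        have hPP := IH (φ ⟨P, hP⟩) ?_ ?_ ?_ (φ q) (φ ⟨n, hn.isPrime⟩) ?_ ?_ ?_ ?_
        · rcases hq with hq | hq
          · rw [hq]; exact hPP
          · exact Relation.TransGen.trans hq hPP
        · rw [← hbot, hφ.isInducing.specializes_iff, ← PrimeSpectrum.le_iff_specializes]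
          exact bot_le
        · rw [← hbot]
          intro h
          exact hP0 (congrArg PrimeSpectrum.asIdeal (hφ.injective h))
        · rwa [hφm]
        · rw [hφ.isInducing.specializes_iff, ← PrimeSpectrum.le_iff_specializes]
          exact hPm
        · rw [hφ.isInducing.specializes_iff, ← PrimeSpectrum.le_iff_specializes]
          exact hPn
        · rwa [hφm]
        · rwa [hφm]
    obtain ⟨q, hq, hq'⟩ := hf r hrr a.asIdeal b.asIdeal ((hφm a).1 hyc) ((hφm b).1 hzc)
      ha hb ⟨a, rfl, Or.inl rfl⟩
    rwa [PrimeSpectrum.ext hq] at hq'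
  have hto : ∀ x, η ⤳ x → IsClosed ({x} : Set X) →
      ∃ y, η ⤳ y ∧ y ∈ O ∩ U ∧ IsClosed ({y} : Set X) ∧ CurveConn x y := by
    intro x hx hxc
    obtain ⟨U', A', _, _, _, φ', hU', hxU', hft', hφ', hr', hφm'⟩ := H η x hx
    have hbot' : φ' ⊥ = η := chart_bot hx hU' hxU' hφ' hr'
    have hηU' : η ∈ U' := hx.mem_open hU' hxU'
    obtain ⟨v, hηv, ⟨hvO, hvU'⟩, hvc⟩ := jac η (O ∩ U ∩ U') (hOU.inter hU') ⟨hηO, hηU'⟩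
    obtain ⟨m, rfl⟩ : v ∈ Set.range φ := by
      rw [hr]; exact ⟨hvO.2, specializes_iff_mem_closure.1 hηv⟩
    obtain ⟨Q, hQ, hQ0, hQm, -⟩ := alg2 K p.asIdeal hp0 hpm m.asIdeal ((hφm m).1 hvc) 1 one_ne_zero
    have hQv : φ ⟨Q, hQ⟩ ⤳ φ m := by
      rw [hφ.isInducing.specializes_iff, ← PrimeSpectrum.le_iff_specializes]
      exact hQm.le
    have hQnm : ¬ Q.IsMaximal := fun h =>
      hQm.ne (h.eq_of_le ((hφm m).1 hvc).ne_top hQm.le)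
    obtain ⟨Q', hQ'⟩ : φ ⟨Q, hQ⟩ ∈ Set.range φ' := by
      rw [hr']
      refine ⟨hQv.mem_open hU' hvU', ?_⟩
      have : φ ⟨Q, hQ⟩ ∈ Set.range φ := Set.mem_range_self _
      rw [hr] at this
      exact this.2
    have hQ'0 : Q'.asIdeal ≠ ⊥ := by
      intro h
      have h1 : Q' = ⊥ := PrimeSpectrum.ext h
      rw [h1, hbot', ← hbot] at hQ'
      exact hQ0 (congrArg PrimeSpectrum.asIdeal (hφ.injective hQ')).symm
    have hQ'm : ¬ Q'.asIdeal.IsMaximal := by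
      rw [← hφm', hQ', hφm]
      exact hQnm
    obtain ⟨mx, rfl⟩ : x ∈ Set.range φ' := by
      rw [hr']; exact ⟨hxU', specializes_iff_mem_closure.1 hx⟩
    obtain ⟨_, ⟨g, rfl⟩, hg0, hg⟩ := PrimeSpectrum.isTopologicalBasis_basic_opens.exists_subset_of_mem_open
      (show (⊥ : PrimeSpectrum A') ∈ φ' ⁻¹' (O ∩ U) by
        rw [Set.mem_preimage, hbot']; exact hηO) (hOU.preimage hφ'.continuous)
    have hg0' : g ≠ 0 := by simpa using hg0
    obtain ⟨Q2, hQ2, hQ20, hQ2m, hgQ2⟩ := alg2 K Q'.asIdeal hQ'0 hQ'm mx.asIdeal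
      ((hφm' mx).1 hxc) g hg0'
    have hw'O : φ' ⟨Q2, hQ2⟩ ∈ O ∩ U := hg (by simpa using hgQ2)
    have hw'x : φ' ⟨Q2, hQ2⟩ ⤳ φ' mx := by
      rw [hφ'.isInducing.specializes_iff, ← PrimeSpectrum.le_iff_specializes]
      exact hQ2m.le
    have hηw' : η ⤳ φ' ⟨Q2, hQ2⟩ := by
      rw [← hbot', hφ'.isInducing.specializes_iff, ← PrimeSpectrum.le_iff_specializes]
      exact bot_le
    obtain ⟨y, hw'y, hyO, hyc⟩ := jac _ _ hOU hw'O
    refine ⟨y, hηw'.trans hw'y, hyO, hyc, IH (φ' ⟨Q2, hQ2⟩) hηw' ?_ ?_ _ _ hw'x hw'y hxc hyc⟩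
    · rw [← hbot']
      intro h
      exact hQ20 (congrArg PrimeSpectrum.asIdeal (hφ'.injective h))
    · rw [hφm']
      exact fun h => hQ2m.ne (h.eq_of_le ((hφm' mx).1 hxc).ne_top hQ2m.le)
  obtain ⟨x', hx', hx'O, hx'c, hxx'⟩ := hto x hx hxc
  obtain ⟨y', hy', hy'O, hy'c, hyy'⟩ := hto y hy hyc
  rcases hconnO x' y' hx' hy' hx'O hy'O hx'c hy'c with rfl | h
  · exact Relation.TransGen.trans hxx' hyy'.symm
  · exact Relation.TransGen.trans hxx' (Relation.TransGen.trans h hyy'.symm)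
end

end

open AlgebraicGeometry CategoryTheory CategoryTheory.Limits

universe u

theorem scheme_chart (K : Type u) [Field K] (X : Scheme.{u}) (f : X ⟶ Spec (CommRingCat.of K))
    [LocallyOfFiniteType f] [JacobsonSpace X] (η x : X) (hx : η ⤳ x) :
    ∃ (U : Set X) (A : Type u) (_ : CommRing A) (_ : IsDomain A)
      (_ : Algebra K A) (φ : PrimeSpectrum A → X), IsOpen U ∧ x ∈ U ∧ Algebra.FiniteType K A ∧
      Topology.IsEmbedding φ ∧ Set.range φ = U ∩ closure {η} ∧
      ∀ p, IsClosed ({φ p} : Set X) ↔ p.asIdeal.IsMaximal := by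
  obtain ⟨U, hU, hxU, -⟩ := exists_isAffineOpen_mem_and_subset (X := X) (x := x) (U := ⊤) trivial
  have hηU : η ∈ U := hx.mem_open U.2 hxU
  obtain ⟨ψ, hψ⟩ := Spec.map_surjective (hU.fromSpec ≫ f)
  have hlft : LocallyOfFiniteType (hU.fromSpec ≫ f) := inferInstance
  rw [← hψ] at hlft
  have hψft : RingHom.FiniteType ψ.hom := HasRingHomProperty.Spec_iff.mp hlft
  let ι : PrimeSpectrum Γ(X, U) → X := fun p => hU.fromSpec p
  have hι : Topology.IsOpenEmbedding ι := hU.fromSpec.isOpenEmbedding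
  have hιr : Set.range ι = U := hU.range_fromSpec
  obtain ⟨p, hp⟩ : η ∈ Set.range ι := by rw [hιr]; exact hηU
  let A := Γ(X, U) ⧸ p.asIdeal
  let π : Γ(X, U) →+* A := Ideal.Quotient.mk p.asIdeal
  let algA : Algebra K A := (π.comp ψ.hom).toAlgebra
  have hft : Algebra.FiniteType K A := by
    have : (π.comp ψ.hom).FiniteType :=
      (RingHom.FiniteType.of_surjective π Ideal.Quotient.mk_surjective).comp hψft
    exact this
  have hc : Topology.IsClosedEmbedding (PrimeSpectrum.comap π) :=
    PrimeSpectrum.isClosedEmbedding_comap_of_surjective _ _ Ideal.Quotient.mk_surjective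
  have hcr : Set.range (PrimeSpectrum.comap π) = closure {p} := by
    rw [range_comap_of_surjective _ _ Ideal.Quotient.mk_surjective,
      PrimeSpectrum.closure_singleton]
    simp [π]
  refine ⟨U, A, inferInstance, inferInstance, algA, ι ∘ PrimeSpectrum.comap π, U.2, hxU, hft,
    hι.isEmbedding.comp hc.isEmbedding, ?_, ?_⟩
  · rw [Set.range_comp, hcr]
    ext z
    constructor
    · rintro ⟨q, hq, rfl⟩
      refine ⟨hιr ▸ Set.mem_range_self q, ?_⟩
      rw [← specializes_iff_mem_closure, ← hp, hι.isInducing.specializes_iff]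
      exact specializes_iff_mem_closure.2 hq
    · rintro ⟨hz, hz'⟩
      rw [← hιr] at hz
      obtain ⟨q, rfl⟩ := hz
      refine ⟨q, ?_, rfl⟩
      rw [← specializes_iff_mem_closure, ← hp, hι.isInducing.specializes_iff] at hz'
      exact specializes_iff_mem_closure.1 hz'
  · intro q
    have h1 : q ∈ (PrimeSpectrum.comap π) ⁻¹' (ι ⁻¹' (closedPoints X)) ↔ q ∈ closedPoints _ := by
      rw [hι.preimage_closedPoints, hc.preimage_closedPoints]
    rw [← PrimeSpectrum.isClosed_singleton_iff_isMaximal]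
    exact h1

theorem closed_of_geom_point (K Kbar : Type u) [Field K] [Field Kbar] [Algebra K Kbar]
    [IsAlgClosure K Kbar] (X : Scheme.{u}) (f : X ⟶ Spec (CommRingCat.of K))
    [LocallyOfFiniteType f] [JacobsonSpace X] (x1 : Spec (CommRingCat.of Kbar) ⟶ X)
    (hx1 : x1 ≫ f = Spec.map (CommRingCat.ofHom (algebraMap K Kbar)))
    (y : Spec (CommRingCat.of Kbar)) : IsClosed ({x1 y} : Set X) := by
  obtain ⟨U, hU, hxU, -⟩ := exists_isAffineOpen_mem_and_subset (X := X) (x := x1 y) (U := ⊤) trivial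
  obtain ⟨ψ, hψ⟩ := Spec.map_surjective (hU.fromSpec ≫ f)
  have hι := hU.fromSpec.isOpenEmbedding
  have hsub : Set.range x1 ⊆ Set.range hU.fromSpec := by
    rw [hU.range_fromSpec]
    rintro _ ⟨z, rfl⟩
    have : z = y := Subsingleton.elim (α := PrimeSpectrum Kbar) _ _
    rw [this]; exact hxU
  obtain ⟨χ, hχ⟩ := Spec.map_surjective (IsOpenImmersion.lift hU.fromSpec x1 hsub)
  have hfac : Spec.map χ ≫ hU.fromSpec = x1 := by
    rw [hχ, IsOpenImmersion.lift_fac]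
  have hcomp : ψ ≫ χ = CommRingCat.ofHom (algebraMap K Kbar) := by
    apply Spec.map_injective
    rw [Spec.map_comp, hψ, ← Category.assoc, hfac, hx1]
  have hint : χ.hom.IsIntegral := by
    apply RingHom.IsIntegral.tower_top ψ.hom
    rw [← CommRingCat.hom_comp, hcomp]
    have : Algebra.IsAlgebraic K Kbar := IsAlgClosure.isAlgebraic
    exact algebraMap_isIntegral_iff.2 inferInstance
  have hy : y.asIdeal.IsMaximal := by
    have hpr : y.asIdeal.IsPrime := y.isPrime
    have h : y.asIdeal = ⊥ := @Ideal.eq_bot_of_prime Kbar _ y.asIdeal hpr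
    rw [h]
    exact Ideal.bot_isMaximal (K := Kbar)
  have hmax : (Spec.map χ y).asIdeal.IsMaximal :=
    Ideal.isMaximal_comap_of_isIntegral_of_isMaximal' χ.hom hint y.asIdeal
  have h1 : Spec.map χ y ∈ closedPoints (Spec Γ(X, U)) :=
    (PrimeSpectrum.isClosed_singleton_iff_isMaximal _).2 hmax
  rw [← hι.preimage_closedPoints] at h1
  rw [← hfac]
  exact h1

/-- **Chains of integral curves connecting two geometric points** (Corollary A.3):
if `X` is an irreducible (not necessarily separated) scheme of finite type over `K`
of Krull dimension at least `1` and `x̄₁, x̄₀` are two `K̄`-points of `X` over `K`,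
then there is a chain of closed irreducible curves `C 0, …, C r` in `|X|`, with the
image of `x̄₁` in the first one, the image of `x̄₀` in the last one, and any two
consecutive curves meeting in a closed point of `X`. -/
theorem chain_of_curves_through_points
    (K Kbar : Type u) [Field K] [Field Kbar] [Algebra K Kbar] [IsAlgClosure K Kbar]
    (X : Scheme.{u}) (f : X ⟶ Spec (CommRingCat.of K))
    [QuasiCompact f] [LocallyOfFiniteType f]
    [IrreducibleSpace X] (hdim : 1 ≤ topologicalKrullDim X)
    (x1 x0 : Spec (CommRingCat.of Kbar) ⟶ X)
    (hx1 : x1 ≫ f = Spec.map (CommRingCat.ofHom (algebraMap K Kbar)))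
    (hx0 : x0 ≫ f = Spec.map (CommRingCat.ofHom (algebraMap K Kbar))) :
    ∃ (r : ℕ) (C : Fin (r + 1) → Set X),
      (∀ i, IsClosed (C i) ∧ IsIrreducible (C i) ∧ topologicalKrullDim (C i) = 1) ∧
      (∀ y : Spec (CommRingCat.of Kbar), x1.base y ∈ C 0) ∧
      (∀ y : Spec (CommRingCat.of Kbar), x0.base y ∈ C (Fin.last r)) ∧
      ∀ i : Fin r, ∃ P : X, P ∈ C i.castSucc ∩ C i.succ ∧ IsClosed ({P} : Set X) := by
  have hJ : JacobsonSpace X := LocallyOfFiniteType.jacobsonSpace f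
  have hN : IsLocallyNoetherian X := LocallyOfFiniteType.isLocallyNoetherian f
  have hQ : CompactSpace X := QuasiCompact.compactSpace_of_compactSpace f
  have hN' : IsNoetherian X := {}
  let η : X := genericPoint X
  have hη : ¬ IsClosed ({η} : Set X) := by
    intro h
    have h1 : ∀ x : X, x = η := fun x => by
      simpa using (genericPoint_specializes x).mem_closed h rfl
    have : Subsingleton X := ⟨fun a b => (h1 a).trans (h1 b).symm⟩
    have h2 : topologicalKrullDim X ≤ 0 := topologicalKrullDim_zero_of_discreteTopology X
    exact absurd (hdim.trans h2) (by decide)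
  let y0 : Spec (CommRingCat.of Kbar) := (⊥ : PrimeSpectrum Kbar)
  have hy0 : ∀ y, y = y0 := fun y => Subsingleton.elim (α := PrimeSpectrum Kbar) _ _
  have := conn_of_charts K (scheme_chart K X f) η hη (x1 y0) (x0 y0)
    (genericPoint_specializes _) (genericPoint_specializes _)
    (closed_of_geom_point K Kbar X f x1 hx1 y0) (closed_of_geom_point K Kbar X f x0 hx0 y0)
  obtain ⟨r, C, h1, h2, h3, h4⟩ := this.chain
  exact ⟨r, C, h1, fun y => hy0 y ▸ h2, fun y => hy0 y ▸ h3, h4⟩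
end

section
/- Let K be a field with algebraic closure K̄, and let T be a normal integral scheme of finite type over K. Write T_K̄ = T ×_{Spec K} Spec K̄ and let p : |T_K̄| → |T| be the projection. Let P be a closed point of T. Then for any two irreducible components Z and Z′ of |T_K̄|, the sets p⁻¹({P}) ∩ Z and p⁻¹({P}) ∩ Z′ are finite and have the same cardinality; that is, the points of T_K̄ lying over P are uniformly distributed among the irreducible components of T_K̄. -/
open AlgebraicGeometry CategoryTheory CategoryTheory.Limits

universe u

/-- Two embeddings of an algebraic closure that agree on the base field differ by an
automorphism over the base field. -/
lemma exists_algEquiv_of_two_embeddings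
    (K Kbar : Type u) [Field K] [Field Kbar] [Algebra K Kbar] [IsAlgClosure K Kbar]
    (Ω : Type u) [Field Ω] (i j : Kbar →+* Ω)
    (h : i.comp (algebraMap K Kbar) = j.comp (algebraMap K Kbar)) :
    ∃ σ : Kbar ≃ₐ[K] Kbar, i.comp (σ : Kbar →+* Kbar) = j := by
  let : Algebra Kbar Ω := i.toAlgebra
  let : Algebra K Ω := (i.comp (algebraMap K Kbar)).toAlgebra
  have : IsScalarTower K Kbar Ω := IsScalarTower.of_algebraMap_eq' rfl
  have : Normal K Kbar := IsAlgClosure.normal K Kbar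
  let ϕ : Kbar →ₐ[K] Ω := { j with commutes' := fun r => (RingHom.congr_fun h r).symm }
  refine ⟨ϕ.restrictNormal' Kbar, ?_⟩
  ext x
  exact ϕ.restrictNormal_commutes Kbar x

/-- The automorphism group of the algebraic closure acts transitively on the fibres of the
projection `T_K̄ → T`. -/
lemma exists_iso_of_fst_eq
    (K Kbar : Type u) [Field K] [Field Kbar] [Algebra K Kbar] [IsAlgClosure K Kbar]
    (T : Scheme.{u}) (f : T ⟶ Spec (CommRingCat.of K))
    (g : Spec (CommRingCat.of Kbar) ⟶ Spec (CommRingCat.of K))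
    (hg : g = Spec.map (CommRingCat.ofHom (algebraMap K Kbar)))
    (z z' : (pullback f g : Scheme.{u}))
    (h : pullback.fst f g z = pullback.fst f g z') :
    ∃ e : pullback f g ≅ pullback f g, e.hom ≫ pullback.fst f g = pullback.fst f g ∧
      e.hom z = z' := by
  obtain ⟨w, hw, hw'⟩ := Scheme.Pullback.exists_preimage_pullback z z' h
  let S := pullback (pullback.fst f g) (pullback.fst f g)
  let r := S.fromSpecResidueField w
  let a := r ≫ pullback.fst (pullback.fst f g) (pullback.fst f g)
  let b := r ≫ pullback.snd (pullback.fst f g) (pullback.fst f g)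
  have hab : a ≫ pullback.fst f g = b ≫ pullback.fst f g := by
    simp only [a, b, Category.assoc, pullback.condition]
  let c : Spec (S.residueField w) := IsLocalRing.closedPoint (S.residueField w)
  have ha : a c = z := by
    rw [← hw]
    exact congrArg (pullback.fst (pullback.fst f g) (pullback.fst f g))
      (S.fromSpecResidueField_apply w c)
  have hb' : b c = z' := by
    rw [← hw']
    exact congrArg (pullback.snd (pullback.fst f g) (pullback.fst f g))
      (S.fromSpecResidueField_apply w c)
  clear_value a b
  let i : CommRingCat.of Kbar ⟶ S.residueField w := Spec.preimage (a ≫ pullback.snd f g)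
  let j : CommRingCat.of Kbar ⟶ S.residueField w := Spec.preimage (b ≫ pullback.snd f g)
  have hi : Spec.map i = a ≫ pullback.snd f g := Spec.map_preimage _
  have hj : Spec.map j = b ≫ pullback.snd f g := Spec.map_preimage _
  have hij : CommRingCat.ofHom (algebraMap K Kbar) ≫ i =
      CommRingCat.ofHom (algebraMap K Kbar) ≫ j := by
    apply Spec.map_injective
    rw [Spec.map_comp, Spec.map_comp, hi, hj, ← hg, Category.assoc, Category.assoc,
      ← pullback.condition (f := f) (g := g), reassoc_of% hab]
  obtain ⟨σ, hσ⟩ := exists_algEquiv_of_two_embeddings K Kbar (S.residueField w) i.hom j.hom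
    (by simpa using congrArg CommRingCat.Hom.hom hij)
  let s (τ : Kbar ≃ₐ[K] Kbar) : CommRingCat.of Kbar ⟶ CommRingCat.of Kbar :=
    CommRingCat.ofHom (τ : Kbar →+* Kbar)
  have hs (τ : Kbar ≃ₐ[K] Kbar) : Spec.map (s τ) ≫ g = g := by
    rw [hg, ← Spec.map_comp]
    congr 1
    ext x
    simp [s]
  let t (τ : Kbar ≃ₐ[K] Kbar) : pullback f g ⟶ pullback f g :=
    pullback.lift (pullback.fst f g) (pullback.snd f g ≫ Spec.map (s τ))
      (by rw [Category.assoc, hs, pullback.condition])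
  have htf (τ : Kbar ≃ₐ[K] Kbar) : t τ ≫ pullback.fst f g = pullback.fst f g :=
    pullback.lift_fst _ _ _
  have hts (τ : Kbar ≃ₐ[K] Kbar) :
      t τ ≫ pullback.snd f g = pullback.snd f g ≫ Spec.map (s τ) :=
    pullback.lift_snd _ _ _
  have ht (τ τ' : Kbar ≃ₐ[K] Kbar) (hτ : ∀ x, τ (τ' x) = x) : t τ ≫ t τ' = 𝟙 _ := by
    have : s τ' ≫ s τ = 𝟙 _ := by
      ext x
      simp [s, hτ]
    apply pullback.hom_ext
    · rw [Category.assoc, htf, htf, Category.id_comp]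
    · rw [Category.assoc, hts, reassoc_of% (hts τ), ← Spec.map_comp, this]
      simp
  refine ⟨⟨t σ, t σ.symm, ht _ _ (by simp), ht _ _ (by simp)⟩, htf σ, ?_⟩
  have hsj : s σ ≫ i = j := by
    ext x
    exact RingHom.congr_fun hσ x
  have hb : a ≫ t σ = b := by
    apply pullback.hom_ext
    · rw [Category.assoc, htf, hab]
    · rw [Category.assoc, hts, ← Category.assoc, ← hi, ← Spec.map_comp, hsj, hj]
  rw [← ha, ← hb', ← hb]
  rfl

/-- The fibre over a closed point is finite. -/
lemma finite_fibre_over_closed_point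
    (K Kbar : Type u) [Field K] [Field Kbar]
    (T : Scheme.{u}) (f : T ⟶ Spec (CommRingCat.of K)) [LocallyOfFiniteType f]
    (g : Spec (CommRingCat.of Kbar) ⟶ Spec (CommRingCat.of K))
    (P : T) (hP : IsClosed ({P} : Set T)) :
    ((pullback.fst f g) ⁻¹' {P}).Finite := by
  have hfin : IsFinite (T.fromSpecResidueField P ≫ f) := by
    rw [isClosed_singleton_iff_isClosedImmersion] at hP
    rw [isFinite_iff_locallyOfFiniteType_of_jacobsonSpace]
    infer_instance
  let q := pullback.snd (T.fromSpecResidueField P ≫ f) g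
  have hW : Finite (pullback (T.fromSpecResidueField P ≫ f) g : Scheme.{u}) := by
    have h1 := q.finite_preimage_singleton (IsLocalRing.closedPoint Kbar)
    rw [← Set.finite_univ_iff]
    exact h1.subset fun x _ => Subsingleton.elim (α := PrimeSpectrum Kbar) _ _
  let m : pullback (T.fromSpecResidueField P ≫ f) g ⟶ pullback f g :=
    pullback.map _ _ _ _ (T.fromSpecResidueField P) (𝟙 _) (𝟙 _) (by simp) (by simp)
  refine (Set.finite_range m).subset fun x hx => ?_
  have hx : pullback.fst f g x = P := hx
  have hpb : IsPullback m (pullback.fst (T.fromSpecResidueField P ≫ f) g)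
      (pullback.fst f g) (T.fromSpecResidueField P) := by
    refine IsPullback.of_right (h₁₂ := pullback.snd f g) (v₁₃ := g) (h₂₂ := f) ?_ ?_
      (IsPullback.of_hasPullback f g).flip
    · have : m ≫ pullback.snd f g = pullback.snd (T.fromSpecResidueField P ≫ f) g := by
        exact (pullback.lift_snd _ _ _).trans (Category.comp_id _)
      rw [this]
      exact (IsPullback.of_hasPullback _ _).flip
    · exact pullback.lift_fst _ _ _
  obtain ⟨y, hy, -⟩ := Scheme.exists_preimage_of_isPullback hpb
    x (IsLocalRing.closedPoint (T.residueField P)) 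
    (hx.trans (T.fromSpecResidueField_apply P _).symm)
  exact ⟨y, hy⟩

/-- **Uniform distribution of geometric points over a closed point**
(end of the proof of Lemma 1.2): let `T` be a normal integral scheme of finite type
over `K` (all local rings are integrally closed domains), and let `P` be a closed
point of `T`.  Then for any two irreducible components `Z`, `Z'` of `|T_K̄|`, the
fibers `p⁻¹(P) ∩ Z` and `p⁻¹(P) ∩ Z'` are finite of the same cardinality. -/
theorem points_over_closed_point_uniformly_distributed
    (K Kbar : Type u) [Field K] [Field Kbar] [Algebra K Kbar] [IsAlgClosure K Kbar]
    (T : Scheme.{u}) (f : T ⟶ Spec (CommRingCat.of K))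
    [QuasiCompact f] [LocallyOfFiniteType f]
    [IsIntegral T]
    (hnormal : ∀ x : T, IsDomain (T.presheaf.stalk x) ∧ IsIntegrallyClosed (T.presheaf.stalk x))
    (P : T) (hP : IsClosed ({P} : Set T)) :
    let g : Spec (CommRingCat.of Kbar) ⟶ Spec (CommRingCat.of K) :=
      Spec.map (CommRingCat.ofHom (algebraMap K Kbar))
    let TK : Scheme.{u} := pullback f g
    let p : TK → T := (pullback.fst f g).base
    ∀ Z ∈ irreducibleComponents TK, ∀ Z' ∈ irreducibleComponents TK,
      (p ⁻¹' {P} ∩ Z).Finite ∧ (p ⁻¹' {P} ∩ Z').Finite ∧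
        (p ⁻¹' {P} ∩ Z).ncard = (p ⁻¹' {P} ∩ Z').ncard := by
  intro g TK p Z hZ Z' hZ'
  have hfin : (p ⁻¹' {P}).Finite := finite_fibre_over_closed_point K Kbar T f g P hP
  refine ⟨hfin.subset Set.inter_subset_left, hfin.subset Set.inter_subset_left, ?_⟩
  have : Flat g := by
    rw [Flat.SpecMap_iff]
    exact (RingHom.flat_algebraMap_iff).mpr inferInstance
  have key : ∀ Z ∈ irreducibleComponents TK, ∃ z : TK, closure {z} = Z ∧
      pullback.fst f g z = genericPoint T := by
    intro Z hZ
    have hcl : IsClosed Z := isClosed_of_mem_irreducibleComponents Z hZ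
    obtain ⟨z, hz⟩ := QuasiSober.sober hZ.1 hcl
    refine ⟨z, hz, ?_⟩
    obtain ⟨z0, hz0, he⟩ := Flat.generalizingMap (pullback.fst f g)
      (genericPoint_specializes (pullback.fst f g z))
    have h1 : Z ⊆ closure {z0} := by
      rw [← hz.def]
      exact closure_minimal (by simpa using hz0.mem_closure) isClosed_closure
    have h2 : closure {z0} ⊆ Z := hZ.2 isIrreducible_singleton.closure h1
    have h3 : z ⤳ z0 := by
      rw [specializes_iff_mem_closure, hz.def]
      exact h2 (subset_closure rfl)
    rw [← he, (h3.antisymm hz0).eq]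
  obtain ⟨z, rfl, hz⟩ := key Z hZ
  obtain ⟨z', rfl, hz'⟩ := key Z' hZ'
  obtain ⟨e, he, hez⟩ := exists_iso_of_fst_eq K Kbar T f g rfl z z' (hz.trans hz'.symm)
  let h : TK ≃ₜ TK := Scheme.homeoOfIso e
  have hh : ∀ x, p (h x) = p x := fun x => by
    change (e.hom ≫ pullback.fst f g) x = _
    rw [he]
  have himg : h '' (p ⁻¹' {P} ∩ closure {z}) = p ⁻¹' {P} ∩ closure {z'} := by
    rw [Set.image_inter h.injective, h.image_closure, Set.image_singleton]
    congr 1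
    · ext y
      obtain ⟨x, rfl⟩ := h.surjective y
      simp [hh]
    · rw [← hez]; rfl
  rw [← himg, Set.ncard_image_of_injective _ h.injective]
end

section
/- Let K be a field with algebraic closure K̄, and let T be a normal integral scheme of finite type over K. Then every irreducible component of the underlying topological space of T_K̄ = T ×_{Spec K} Spec K̄ is open; equivalently, T_K̄ is the disjoint union of its irreducible components, and the irreducible components of |T_K̄| coincide with its connected components. -/
universe u

section AlgebraPart

open TensorProduct

theorem aux_vonNeumann {R : Type*} [CommRing R] [IsArtinianRing R] [IsReduced R] (y : R) :
    ∃ z, y * z * y = y := by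
  classical
  let φ := IsArtinianRing.equivPi R
  let _ : ∀ I : MaximalSpectrum R, Field (R ⧸ I.asIdeal) := fun I => Ideal.Quotient.field _
  refine ⟨φ.symm (fun I => (φ y I)⁻¹), φ.injective ?_⟩
  ext I
  simp only [map_mul, AlgEquiv.apply_symm_apply, Pi.mul_apply]
  exact mul_inv_mul_cancel _

theorem aux_denom {A S L : Type*} [CommRing A] [IsDomain A] [CommRing S] [Algebra A S] [Field L]
    [Algebra A L] [IsFractionRing A L] (z : S ⊗[A] L) :
    ∃ s : A, s ≠ 0 ∧ ∃ c : S, s • z = c ⊗ₜ[A] (1 : L) := by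
  induction z with
  | zero => exact ⟨1, one_ne_zero, 0, by simp⟩
  | tmul x l =>
    obtain ⟨a, b, hb, rfl⟩ := IsFractionRing.div_surjective (A := A) l
    have hb0 : b ≠ 0 := nonZeroDivisors.ne_zero hb
    refine ⟨b, hb0, a • x, ?_⟩
    have : algebraMap A L b ≠ 0 := by simpa using hb0
    rw [← tmul_smul, smul_tmul]
    congr 1
    rw [Algebra.smul_def, Algebra.smul_def, mul_one, mul_div_cancel₀ _ this]
  | add z w hz hw =>
    obtain ⟨s, hs, c, hc⟩ := hz
    obtain ⟨t, ht, d, hd⟩ := hw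
    refine ⟨s * t, mul_ne_zero hs ht, t • c + s • d, ?_⟩
    rw [smul_add, mul_smul, mul_smul, hd, smul_comm, hc, add_tmul, smul_tmul', smul_tmul']

theorem aux_idem {K A F : Type*} [Field K] [CommRing A] [IsDomain A] [IsIntegrallyClosed A]
    [Algebra K A] [Field F] [Algebra K F] [FiniteDimensional K F] [Algebra.IsSeparable K F]
    (y : A ⊗[K] F) :
    ∃ (e c : A ⊗[K] F) (s : A), s ≠ 0 ∧ e * e = e ∧ y = e * y ∧ s • e = y * c := by
  let L := FractionRing A
  let S := A ⊗[K] F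
  have : Algebra.FormallyEtale K F := Algebra.FormallyEtale.of_isSeparable K F
  have : Algebra.FinitePresentation K F :=
    Algebra.FinitePresentation.of_finiteType.1 inferInstance
  have : Algebra.Etale K F := ⟨inferInstance, inferInstance⟩
  have : Algebra.Etale A S := inferInstance
  have : Module.Finite A S := inferInstance
  have : Module.Finite L (L ⊗[A] S) := inferInstance
  have : IsArtinianRing (L ⊗[A] S) := IsArtinianRing.of_finite L _
  have : IsReduced (L ⊗[A] S) := Algebra.FormallyUnramified.isReduced_of_field L _
  let i : S →ₐ[A] S ⊗[A] L := Algebra.TensorProduct.includeLeft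
  have hi : Function.Injective i :=
    Algebra.TensorProduct.includeLeft_injective (IsFractionRing.injective A L)
  obtain ⟨z, hz⟩ : ∃ z, i y * z * i y = i y := by
    let φ := Algebra.TensorProduct.comm A S L
    obtain ⟨z, hz⟩ := aux_vonNeumann (φ (i y))
    exact ⟨φ.symm z, φ.injective (by simpa using hz)⟩
  have hee : (i y * z) * (i y * z) = i y * z := by
    rw [← mul_assoc, hz]
  obtain ⟨e, he⟩ : ∃ e, i e = i y * z := by
    have hint : IsIntegral S (i y * z) := by
      refine ⟨Polynomial.X ^ 2 - Polynomial.X, ?_, ?_⟩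
      · monicity!
      · simp [pow_two, hee]
    obtain ⟨w, hw⟩ := (TensorProduct.toIntegralClosure_bijective_of_smooth (R := A) (S := S)
      (B := L)).2 ⟨_, hint⟩
    have hw' := congrArg Subtype.val hw
    suffices h : ∃ e, i e = (TensorProduct.toIntegralClosure A S L w : S ⊗[A] L) by
      rwa [hw'] at h
    clear hw hw'
    induction w with
    | zero => exact ⟨0, by simp⟩
    | add a b ha hb =>
      obtain ⟨a', ha'⟩ := ha
      obtain ⟨b', hb'⟩ := hb
      exact ⟨a' + b', by simp [ha', hb']⟩
    | tmul x l =>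
      obtain ⟨l, hl⟩ := l
      obtain ⟨a, rfl⟩ := (IsIntegrallyClosed.isIntegral_iff (R := A)).1 hl
      refine ⟨a • x, ?_⟩
      simp [i, TensorProduct.toIntegralClosure, Algebra.algebraMap_eq_smul_one]
  obtain ⟨s, hs, c, hc⟩ := aux_denom z
  refine ⟨e, c, s, hs, hi ?_, hi ?_, hi ?_⟩
  · rw [map_mul, he, hee]
  · rw [map_mul, he, hz]
  · rw [map_smul, he, map_mul, ← mul_smul_comm, hc]; rfl

theorem aux_fin {K A E : Type*} [Field K] [CommRing A] [Algebra K A] [Field E] [Algebra K E]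
    [Algebra.IsAlgebraic K E] (x : A ⊗[K] E) : ∃ F : IntermediateField K E, FiniteDimensional K F ∧
      ∃ y : A ⊗[K] F, Algebra.TensorProduct.map (AlgHom.id A A) F.val y = x := by
  induction x with
  | zero => exact ⟨⊥, inferInstance, 0, by simp⟩
  | tmul a e =>
    refine ⟨IntermediateField.adjoin K {e}, 
      IntermediateField.adjoin.finiteDimensional (Algebra.IsIntegral.isIntegral e), 
      a ⊗ₜ ⟨e, IntermediateField.mem_adjoin_simple_self K e⟩, by simp⟩
  | add x y hx hy =>
    obtain ⟨F, hF, x, rfl⟩ := hx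
    obtain ⟨G, hG, y, rfl⟩ := hy
    refine ⟨F ⊔ G, inferInstance, 
      Algebra.TensorProduct.map (AlgHom.id A A) (IntermediateField.inclusion le_sup_left) x +
      Algebra.TensorProduct.map (AlgHom.id A A) (IntermediateField.inclusion le_sup_right) y, ?_⟩
    rw [map_add, ← AlgHom.comp_apply, ← AlgHom.comp_apply, ← Algebra.TensorProduct.map_comp, 
      ← Algebra.TensorProduct.map_comp]
    rfl

theorem aux_sep {K A E : Type*} [Field K] [CommRing A] [Algebra K A] [Field E] [Algebra K E]
    (k : Type*) [Field k] [Algebra K k] [Algebra k E] [IsScalarTower K k E]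
    [IsPurelyInseparable k E] (x : A ⊗[K] E) : ∃ n > 0, ∃ y : A ⊗[K] k,
        Algebra.TensorProduct.map (AlgHom.id A A) (IsScalarTower.toAlgHom K k E) y = x ^ n := by
  let e₁ : E ⊗[K] A ≃ₐ[k] E ⊗[k] (k ⊗[K] A) :=
    (Algebra.TensorProduct.cancelBaseChange K k k E A).symm
  let e₂ : E ⊗[k] (k ⊗[K] A) ≃ₐ[k] (k ⊗[K] A) ⊗[k] E := Algebra.TensorProduct.comm ..
  let e₃ : A ⊗[K] E ≃ₐ[K] E ⊗[K] A := Algebra.TensorProduct.comm ..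
  obtain ⟨n, hn, y, hy⟩ := IsPurelyInseparable.exists_pow_mem_range_tensorProduct (k := k)
    (K := E) (R := k ⊗[K] A) (e₂ (e₁ (e₃ x)))
  refine ⟨n, hn, Algebra.TensorProduct.comm K k A y, ?_⟩
  apply e₃.injective
  apply e₁.injective
  apply e₂.injective
  rw [map_pow, map_pow, map_pow, ← hy]
  clear hy
  induction y with
  | zero => simp
  | add a b ha hb => simp only [map_add, ha, hb]
  | tmul a b =>
    apply e₂.symm.injective
    apply e₁.symm.injective
    have h : e₂.symm (algebraMap (k ⊗[K] A) _ (a ⊗ₜ[K] b)) = 1 ⊗ₜ[k] (a ⊗ₜ[K] b) := rfl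
    rw [h]
    simp [e₁, e₃, Algebra.algebraMap_eq_smul_one]

theorem aux_alg {K A E : Type*} [Field K] [CommRing A] [IsDomain A] [IsIntegrallyClosed A]
    [Algebra K A] [Field E] [Algebra K E] [Algebra.IsAlgebraic K E] (q₁ q₂ p : Ideal (A ⊗[K] E))
    [q₁.IsPrime] [q₂.IsPrime] [p.IsPrime] (h₁ : q₁ ∈ minimalPrimes (A ⊗[K] E))
    (hp₁ : q₁ ≤ p) (hp₂ : q₂ ≤ p) : q₁ ≤ q₂ := by
  intro x hx
  obtain ⟨n, hn, x', hx'⟩ := aux_sep (separableClosure K E) x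
  obtain ⟨F, hF, y, rfl⟩ := aux_fin x'
  obtain ⟨e, c, s, hs, hee, hye, hse⟩ := aux_idem y
  let ψ := (Algebra.TensorProduct.map (AlgHom.id A A) (IsScalarTower.toAlgHom K (separableClosure K E) E)).comp 
    (Algebra.TensorProduct.map (AlgHom.id A A) F.val)
  replace hx' : ψ y = x ^ n := hx'
  have hyq : ψ y ∈ q₁ := hx' ▸ Ideal.pow_mem_of_mem _ hx _ hn
  have hse' : algebraMap A _ s * ψ e ∈ q₁ := by
    rw [← Algebra.smul_def, ← map_smul, hse, map_mul]
    exact Ideal.mul_mem_right _ _ hyq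
  have hs' : algebraMap A (A ⊗[K] E) s ∉ q₁ := by
    intro h
    refine notMem_nonZeroDivisors_of_mem_mem_minimalPrimes h h₁ ?_
    rw [mem_nonZeroDivisors_iff_right]
    intro z hz
    rw [mul_comm, ← Algebra.smul_def] at hz
    exact (smul_eq_zero.1 hz).resolve_left hs
  have heq : ψ e ∈ q₁ := (Ideal.IsPrime.mem_or_mem ‹_› hse').resolve_left hs'
  have h2 : ψ e ∈ q₂ := by
    have : ψ e * (1 - ψ e) ∈ q₂ := by
      rw [mul_sub, ← map_mul, hee]; simp
    refine (Ideal.IsPrime.mem_or_mem ‹_› this).resolve_right fun h => ?_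
    exact (Ideal.ne_top_iff_one p).1 Ideal.IsPrime.ne_top' (by simpa using add_mem (hp₂ h) (hp₁ heq))
  refine Ideal.IsPrime.mem_of_pow_mem ‹_› n ?_
  rw [← hx', hye, map_mul]
  exact Ideal.mul_mem_right _ _ h2

end AlgebraPart

open AlgebraicGeometry CategoryTheory CategoryTheory.Limits


section SchemePart

open TensorProduct

theorem aux_normal (T : Scheme.{u}) [IsIntegral T]
    (hnormal : ∀ x : T, IsDomain (T.presheaf.stalk x) ∧ IsIntegrallyClosed (T.presheaf.stalk x))
    (U : T.Opens) (hU : IsAffineOpen U) [Nonempty U] : IsIntegrallyClosed Γ(T, U) := by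
  refine IsIntegrallyClosed.of_localization_maximal fun P hP0 hP => ?_
  have hx : hU.fromSpec ⟨P, hP.isPrime⟩ ∈ U := (hU.isoSpec.inv _).2
  have h := hU.isLocalization_stalk' ⟨P, hP.isPrime⟩ hx
  let _ : Algebra Γ(T, U) (T.presheaf.stalk (hU.fromSpec ⟨P, hP.isPrime⟩)) :=
    TopCat.Presheaf.algebra_section_stalk T.presheaf ⟨_, hx⟩
  have := (hnormal (hU.fromSpec ⟨P, hP.isPrime⟩)).2
  have h' : IsLocalization P.primeCompl (T.presheaf.stalk (hU.fromSpec ⟨P, hP.isPrime⟩)) := h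
  exact IsIntegrallyClosed.of_equiv (IsLocalization.algEquiv P.primeCompl
    (T.presheaf.stalk (hU.fromSpec ⟨P, hP.isPrime⟩)) (Localization.AtPrime P)).toRingEquiv

theorem aux_top {X : Type*} [TopologicalSpace X] (hfin : (irreducibleComponents X).Finite)
    (h : ∀ Z ∈ irreducibleComponents X, ∀ W ∈ irreducibleComponents X, ∀ y, y ∈ Z → y ∈ W → Z = W) :
    ∀ Z ∈ irreducibleComponents X, IsOpen Z := by
  intro Z hZ
  have : Zᶜ = ⋃₀ (irreducibleComponents X \ {Z}) := by
    ext y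
    constructor
    · intro hy
      refine ⟨irreducibleComponent y, ⟨irreducibleComponent_mem_irreducibleComponents y, ?_⟩,
        mem_irreducibleComponent⟩
      rintro rfl
      exact hy mem_irreducibleComponent
    · rintro ⟨W, ⟨hW, hWZ⟩, hy⟩ hyZ
      exact hWZ (h W hW Z hZ y hy hyZ)
  rw [← isClosed_compl_iff, this]
  rw [Set.sUnion_eq_biUnion]
  exact Set.Finite.isClosed_biUnion (hfin.subset Set.sdiff_subset)
    fun W hW => isClosed_of_mem_irreducibleComponents W hW.1

theorem aux_chart (K Kbar : Type u) [Field K] [Field Kbar] [Algebra K Kbar]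
    (T : Scheme.{u}) (f : T ⟶ Spec (CommRingCat.of K)) [IsIntegral T]
    (hnormal : ∀ x : T, IsDomain (T.presheaf.stalk x) ∧ IsIntegrallyClosed (T.presheaf.stalk x))
    (y : (pullback f (Spec.map (CommRingCat.ofHom (algebraMap K Kbar))) : Scheme.{u})) :
    ∃ (A : Type u) (_ : CommRing A) (_ : IsDomain A) (_ : IsIntegrallyClosed A) (_ : Algebra K A)
      (h : Spec (CommRingCat.of (A ⊗[K] Kbar)) ⟶
        pullback f (Spec.map (CommRingCat.ofHom (algebraMap K Kbar)))),
        IsOpenImmersion h ∧ y ∈ Set.range h := by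
  generalize hg : Spec.map (CommRingCat.ofHom (algebraMap K Kbar)) = g at y ⊢
  obtain ⟨U, hU, hyU, -⟩ := exists_isAffineOpen_mem_and_subset (x := pullback.fst f g y)
    (U := ⊤) trivial
  have : Nonempty U := ⟨_, hyU⟩
  have := aux_normal T hnormal U hU
  obtain ⟨φ, hφ⟩ := Spec.map_surjective (hU.fromSpec ≫ f)
  let _ : Algebra K Γ(T, U) := φ.hom.toAlgebra
  let m := pullback.map (hU.fromSpec ≫ f) g f g hU.fromSpec (𝟙 _) (𝟙 _) (by simp) (by simp)
  have hm : IsOpenImmersion m := inferInstance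
  have hr : y ∈ Set.range m := by
    rw [Scheme.Pullback.range_map]
    exact ⟨by simpa using hyU, by simp⟩
  let i : pullback (hU.fromSpec ≫ f) g ≅ Spec (CommRingCat.of (Γ(T, U) ⊗[K] Kbar)) :=
    pullback.congrHom hφ.symm hg.symm ≪≫ pullbackSpecIso K Γ(T, U) Kbar
  refine ⟨Γ(T, U), inferInstance, inferInstance, inferInstance, inferInstance, i.inv ≫ m,
    inferInstance, ?_⟩
  obtain ⟨z, hz⟩ := hr
  refine ⟨i.hom z, ?_⟩
  rw [← hz, ← Scheme.Hom.comp_apply, Iso.hom_inv_id_assoc]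

theorem aux_min {X : Scheme.{u}} {B : Type u} [CommRing B] (h : Spec (CommRingCat.of B) ⟶ X)
    [IsOpenImmersion h] (Z : Set X) (hZ : Z ∈ irreducibleComponents X) (y : Spec (CommRingCat.of B))
    (hy : h y ∈ Z) : ∃ q : PrimeSpectrum B, q.asIdeal ∈ minimalPrimes B ∧
      q.asIdeal ≤ PrimeSpectrum.asIdeal y ∧ Z = closure {h q} := by
  have hZc := isClosed_of_mem_irreducibleComponents Z hZ
  obtain ⟨η, hη⟩ := QuasiSober.sober hZ.1 hZc
  have hs : η ⤳ h y := hη.specializes hy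
  obtain ⟨q, rfl⟩ := hs.mem_open h.isOpenEmbedding.isOpen_range ⟨y, rfl⟩
  have key : ∀ a b : PrimeSpectrum B, h a ⤳ h b ↔ a ≤ b := fun a b => by
    rw [PrimeSpectrum.le_iff_specializes]
    exact h.isOpenEmbedding.isInducing.specializes_iff
  refine ⟨q, ?_, (key q y).1 hs, hη.symm⟩
  refine PrimeSpectrum.isMin_iff.1 ?_
  intro r hr
  have h1 : Z ⊆ closure {h r} := by
    rw [← hη]
    exact closure_minimal (by simpa using ((key r q).2 hr).mem_closure) isClosed_closure
  have h2 : closure {h r} ⊆ Z := hZ.2 isIrreducible_singleton.closure h1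
  have : h q ⤳ h r := hη.specializes (h2 (subset_closure rfl))
  exact (key q r).1 this


end SchemePart

/-- **Geometric irreducible components of a normal variety are open**
(from the proof of Lemma 1.2): if `T` is a normal integral scheme of finite type over
`K`, then every irreducible component of `|T_K̄|` is open; equivalently `T_K̄` is the
disjoint union of its irreducible components, which coincide with its connected
components. -/
theorem isOpen_irreducibleComponents_baseChange
    (K Kbar : Type u) [Field K] [Field Kbar] [Algebra K Kbar] [IsAlgClosure K Kbar]
    (T : Scheme.{u}) (f : T ⟶ Spec (CommRingCat.of K))
    [QuasiCompact f] [LocallyOfFiniteType f] [IsIntegral T]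
    (hnormal : ∀ x : T, IsDomain (T.presheaf.stalk x) ∧ IsIntegrallyClosed (T.presheaf.stalk x)) :
    ∀ Z ∈ irreducibleComponents
        (pullback f (Spec.map (CommRingCat.ofHom (algebraMap K Kbar))) : Scheme.{u}),
      IsOpen Z := by
  have : Algebra.IsAlgebraic K Kbar := IsAlgClosure.isAlgebraic
  have : IsLocallyNoetherian
      (pullback f (Spec.map (CommRingCat.ofHom (algebraMap K Kbar))) : Scheme.{u}) :=
    LocallyOfFiniteType.isLocallyNoetherian (pullback.snd _ _)
  have : CompactSpace
      (pullback f (Spec.map (CommRingCat.ofHom (algebraMap K Kbar))) : Scheme.{u}) :=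
    QuasiCompact.compactSpace_of_compactSpace (pullback.snd _ _)
  have : IsNoetherian
      (pullback f (Spec.map (CommRingCat.ofHom (algebraMap K Kbar))) : Scheme.{u}) := ⟨⟩
  refine aux_top finite_irreducibleComponents_of_isNoetherian ?_
  intro Z hZ W hW y hyZ hyW
  obtain ⟨A, _, _, _, _, h, _, y, rfl⟩ := aux_chart K Kbar T f hnormal y
  obtain ⟨q₁, hq₁, hp₁, rfl⟩ := aux_min h Z hZ y hyZ
  obtain ⟨q₂, hq₂, hp₂, rfl⟩ := aux_min h W hW y hyW
  have hp : (PrimeSpectrum.asIdeal y).IsPrime := PrimeSpectrum.isPrime y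
  have : q₁ = q₂ := PrimeSpectrum.ext (le_antisymm (aux_alg q₁.asIdeal q₂.asIdeal _ hq₁ hp₁ hp₂)
    (aux_alg q₂.asIdeal q₁.asIdeal _ hq₂ hp₂ hp₁))
  rw [this]
end
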